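/- arXiv:2209.12217 — 3 statements merged into one kernel-verified Lean document; each statement's English description precedes it below -/
import Mathlib

section
/- Given ξ ∈ H and a γ-Hölder rough path w = (w, w²) on [0,T], there exists T₀ ∈ (0,T] such that the rough evolution equation dy = (Ay + f(y))du + g(y)dw has a solution (y, g_H∘y) on [0,T₀] with initial condition ξ, and this solution is unique: any two solutions on [0,T₀] with initial condition ξ coincide. -/
open Set MeasureTheory

noncomputable section

/-- Pure tensor of two vectors in `ℝ^d`, viewed as a `d × d` matrix. -/
def tensor {d : ℕ} (a b : Fin d → ℝ) : Fin d → Fin d → ℝ := fun i j => a i * b j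

/-- The continuous linear map `h ↦ a ⊗ h`. -/
def tensorL (d : ℕ) (a : Fin d → ℝ) : (Fin d → ℝ) →L[ℝ] (Fin d → Fin d → ℝ) :=
  LinearMap.mkContinuous
    { toFun := fun h => tensor a h
      map_add' := by
        intro x y; funext i j
        simp only [tensor, Pi.add_apply]; ring
      map_smul' := by
        intro c x; funext i j
        simp only [tensor, Pi.smul_apply, smul_eq_mul, RingHom.id_apply]; ring }
    ‖a‖ (fun h => by
      refine (pi_norm_le_iff_of_nonneg (by positivity)).2 fun i => ?_
      refine (pi_norm_le_iff_of_nonneg (by positivity)).2 fun j => ?_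
      show ‖tensor a h i j‖ ≤ ‖a‖ * ‖h‖
      have h1 : ‖tensor a h i j‖ = ‖a i‖ * ‖h j‖ := by
        simp [tensor, Real.norm_eq_abs, abs_mul]
      rw [h1]
      exact mul_le_mul (norm_le_pi_norm a i) (norm_le_pi_norm h j) (norm_nonneg _)
        (norm_nonneg _))

/-- Chen's relation on the interval `[a, b]`. -/
def Chen {d : ℕ} (a b : ℝ) (w : ℝ → Fin d → ℝ) (w2 : ℝ → ℝ → Fin d → Fin d → ℝ) : Prop :=
  ∀ s u t : ℝ, a ≤ s → s ≤ u → u ≤ t → t ≤ b →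
    w2 t s - w2 t u - w2 u s = tensor (w u - w s) (w t - w u)

/-- The set of quotients defining the `e`-Hölder seminorm of a two-parameter map on `[a,b]`. -/
def holderSet {V : Type*} [NormedAddCommGroup V] (a b e : ℝ) (F : ℝ → ℝ → V) : Set ℝ :=
  {r | ∃ s t : ℝ, a ≤ s ∧ s < t ∧ t ≤ b ∧ r = ‖F s t‖ / (t - s) ^ e}

/-- The set of values defining the supremum norm of a map on `[a, b]`. -/
def supSet' {V : Type*} [NormedAddCommGroup V] (a b : ℝ) (F : ℝ → V) : Set ℝ :=
  {r | ∃ u : ℝ, a ≤ u ∧ u ≤ b ∧ r = ‖F u‖}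

/-- A `γ`-Hölder rough path over `ℝ^d` on `[a, b]`. -/
def IsRoughPath {d : ℕ} (γ a b : ℝ) (w : ℝ → Fin d → ℝ)
    (w2 : ℝ → ℝ → Fin d → Fin d → ℝ) : Prop :=
  Chen a b w w2 ∧ BddAbove (holderSet a b γ (fun s t => w t - w s)) ∧
    BddAbove (holderSet a b (2 * γ) (fun s t => w2 t s))

/-- The `γ`-Hölder seminorm `|w|_γ` of the first level of a rough path on `[a, b]`. -/
noncomputable def wSN {d : ℕ} (γ a b : ℝ) (w : ℝ → Fin d → ℝ) : ℝ :=
  sSup (holderSet a b γ (fun s t => w t - w s))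

/-- The `2γ`-Hölder seminorm `|w²|_{2γ}` of the second level of a rough path on `[a, b]`. -/
noncomputable def w2SN {d : ℕ} (γ a b : ℝ) (w2 : ℝ → ℝ → Fin d → Fin d → ℝ) : ℝ :=
  sSup (holderSet a b (2 * γ) (fun s t => w2 t s))

variable {H E : Type*} [NormedAddCommGroup H] [NormedSpace ℝ H] [CompleteSpace H]
  [NormedAddCommGroup E] [NormedSpace ℝ E] [CompleteSpace E]

/-- The quotient set for the seminorm `‖y‖_{η,H}`. -/
def mc1 (η T : ℝ) (SH : ℝ → H →L[ℝ] H) (y : ℝ → H) : Set ℝ :=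
  holderSet 0 T η (fun s t => y t - SH (t - s) (y s))

/-- The value set for the seminorm `‖y'‖_{∞,H}`. -/
def mc2 {d : ℕ} (T : ℝ) (y' : ℝ → (Fin d → ℝ) →L[ℝ] H) : Set ℝ := supSet' 0 T y'

/-- The quotient set for the seminorm `‖y'‖_{γ,E}`. -/
def mc3 {d : ℕ} (γ T : ℝ) (ι : H →L[ℝ] E) (SE : ℝ → E →L[ℝ] E)
    (y' : ℝ → (Fin d → ℝ) →L[ℝ] H) : Set ℝ :=
  holderSet 0 T γ (fun s t => ι.comp (y' t) - (SE (t - s)).comp (ι.comp (y' s)))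

/-- The quotient set for the remainder seminorm `|R^y|_{2γ,E}`. -/
def mc4 {d : ℕ} (γ T : ℝ) (ι : H →L[ℝ] E) (SE : ℝ → E →L[ℝ] E) (w : ℝ → Fin d → ℝ)
    (y : ℝ → H) (y' : ℝ → (Fin d → ℝ) →L[ℝ] H) : Set ℝ :=
  holderSet 0 T (2 * γ)
    (fun s t => ι (y t) - SE (t - s) (ι (y s)) - SE (t - s) (ι (y' s (w t - w s))))

/-- `(y, y')` is a mildly controlled rough path on `[0, T]`: all four seminorms are finite. -/
def MCRP {d : ℕ} (γ η T : ℝ) (ι : H →L[ℝ] E) (SH : ℝ → H →L[ℝ] H) (SE : ℝ → E →L[ℝ] E)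
    (w : ℝ → Fin d → ℝ) (y : ℝ → H) (y' : ℝ → (Fin d → ℝ) →L[ℝ] H) : Prop :=
  BddAbove (mc1 η T SH y) ∧ BddAbove (mc2 T y') ∧ BddAbove (mc3 γ T ι SE y') ∧
    BddAbove (mc4 γ T ι SE w y y')

/-- The norm `‖y, y'‖_D` of a mildly controlled rough path. -/
noncomputable def DNorm {d : ℕ} (γ η T : ℝ) (ι : H →L[ℝ] E) (SH : ℝ → H →L[ℝ] H)
    (SE : ℝ → E →L[ℝ] E) (w : ℝ → Fin d → ℝ) (y : ℝ → H)
    (y' : ℝ → (Fin d → ℝ) →L[ℝ] H) : ℝ :=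
  ‖y 0‖ + ‖ι.comp (y' 0)‖ + sSup (mc1 η T SH y) + sSup (mc2 T y') +
    sSup (mc3 γ T ι SE y') + sSup (mc4 γ T ι SE w y y')

/-- Convergence of compensated Riemann sums over partitions of `[a, b]` as the mesh
tends to `0`. -/
def RiemannLimit {V : Type*} [NormedAddCommGroup V] (a b : ℝ) (F : ℝ → ℝ → V)
    (I : V) : Prop :=
  ∀ ε > (0 : ℝ), ∃ δ > (0 : ℝ), ∀ (n : ℕ) (P : ℕ → ℝ),
    P 0 = a → P n = b → (∀ i < n, P i ≤ P (i + 1)) → (∀ i < n, P (i + 1) - P i < δ) →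
    ‖(∑ i ∈ Finset.range n, F (P i) (P (i + 1))) - I‖ < ε

/-- `(y, g_H ∘ y)` is a solution of the rough evolution equation
`dy = (Ay + f(y))du + g(y)dw` with initial condition `ξ` on `[0, T]`. -/
def IsSolution {d : ℕ} (γ η T : ℝ) (ι : H →L[ℝ] E) (SH : ℝ → H →L[ℝ] H)
    (SE : ℝ → E →L[ℝ] E) (w : ℝ → Fin d → ℝ) (w2 : ℝ → ℝ → Fin d → Fin d → ℝ)
    (fH : H → H) (gH : H → (Fin d → ℝ) →L[ℝ] H) (ξ : H) (y : ℝ → H) : Prop :=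
  y 0 = ξ ∧
  MCRP γ η T ι SH SE w y (fun t => gH (y t)) ∧
  ∃ G : ℝ → (Fin d → Fin d → ℝ) →L[ℝ] H,
    (∀ u : ℝ, 0 ≤ u → u ≤ T → ∀ h k : Fin d → ℝ,
      G u (tensor h k) = (fderiv ℝ gH (y u)) (gH (y u) h) k) ∧
    ∀ t : ℝ, 0 ≤ t → t ≤ T →
      IntervalIntegrable (fun u => SH (t - u) (fH (y u))) volume 0 t ∧
      ∃ It : H,
        RiemannLimit 0 t
          (fun u v => SE (t - u) (ι (gH (y u) (w v - w u)) + ι (G u (w2 v u)))) (ι It) ∧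
        y t = SH t ξ + (∫ u in (0 : ℝ)..t, SH (t - u) (fH (y u))) + It

set_option linter.unusedSectionVars false
set_option linter.unusedVariables false
set_option linter.unusedSimpArgs false

/-- discrete intermediate value -/
theorem disc_ivt (P : ℕ → ℝ) (c : ℝ) (n : ℕ) (h0 : P 0 ≤ c) (hn : c ≤ P (n+1)) :
    ∃ i, i < n + 1 ∧ P i ≤ c ∧ c ≤ P (i+1) := by
  induction n with
  | zero => exact ⟨0, by norm_num, h0, hn⟩
  | succ k ih =>
    by_cases h : c ≤ P (k+1)
    · obtain ⟨i, hi, h1, h2⟩ := ih h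
      exact ⟨i, by omega, h1, h2⟩
    · exact ⟨k+1, by omega, le_of_not_ge h, hn⟩

theorem mono_of_step (P : ℕ → ℝ) (n : ℕ) (h : ∀ i < n, P i ≤ P (i+1)) (i j : ℕ) (hij : i ≤ j)
    (hj : j ≤ n) : P i ≤ P j := by
  induction j with
  | zero => have : i = 0 := by omega
            rw [this]
  | succ k ih =>
    rcases Nat.lt_or_ge i (k+1) with h1 | h1
    · exact (ih (by omega) (by omega)).trans (h k (by omega))
    · have : i = k+1 := by omega
      rw [this]

theorem half_rpow_aux (θ L x : ℝ) (hθ : 1 < θ) (hx : 0 ≤ x) (hL : x ≤ L / 2) :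
    x ^ θ ≤ (2:ℝ)^(1-θ) / 2 * L ^ θ := by
  have hL0 : 0 ≤ L := by linarith
  calc x ^ θ ≤ (L/2)^θ := Real.rpow_le_rpow hx hL (by linarith)
    _ = (2:ℝ)^(1-θ) / 2 * L ^ θ := by
      rw [Real.div_rpow hL0 (by norm_num), Real.rpow_sub (by norm_num), Real.rpow_one]
      field_simp

theorem two_rpow_lt_one (θ : ℝ) (hθ : 1 < θ) : (2:ℝ)^(1-θ) < 1 :=
  Real.rpow_lt_one_of_one_lt_of_neg (by norm_num) (by linarith)

/-- sewing bound for arbitrary partitions -/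
theorem sew_part {V : Type*} [NormedAddCommGroup V] (a b K θ : ℝ) (hK : 0 ≤ K) (hθ : 1 < θ)
    (F : ℝ → ℝ → V) (hF0 : ∀ u, a ≤ u → u ≤ b → F u u = 0)
    (hδ : ∀ u m v, a ≤ u → u ≤ m → m ≤ v → v ≤ b →
      ‖F u v - F u m - F m v‖ ≤ K * (v - u) ^ θ) (n : ℕ) :
    ∀ P : ℕ → ℝ, a ≤ P 0 → P n ≤ b → (∀ i < n, P i ≤ P (i+1)) →
      ‖(∑ i ∈ Finset.range n, F (P i) (P (i+1))) - F (P 0) (P n)‖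
        ≤ 2 / (1 - (2:ℝ)^(1-θ)) * K * (P n - P 0) ^ θ := by
  have hr := two_rpow_lt_one θ hθ
  have hr0 : 0 < (2:ℝ)^(1-θ) := by positivity
  set r := (2:ℝ)^(1-θ) with hrdef
  have hc : 0 ≤ 2 / (1 - r) * K := by
    have : 0 < 1 - r := by linarith
    positivity
  induction n using Nat.strong_induction_on with
  | _ n ih =>
  intro P ha hb hP
  have hmono := mono_of_step P n hP
  rcases n with _ | n
  · have := hF0 (P 0) ha hb
    simp only [Finset.range_zero, Finset.sum_empty, this, sub_zero, norm_zero]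
    rw [sub_self, Real.zero_rpow (by linarith)]; simp
  · have h0n := hmono 0 (n+1) (by omega) le_rfl
    obtain ⟨i, hi, h1, h2⟩ := disc_ivt P ((P 0 + P (n+1))/2) n (by linarith) (by linarith)
    have e1 := hmono 0 i (by omega) (by omega)
    have e2 := hmono i (i+1) (by omega) (by omega)
    have e3 := hmono (i+1) (n+1) (by omega) (by omega)
    obtain ⟨k, hk⟩ : ∃ k, n + 1 = i + 1 + k := ⟨n - i, by omega⟩
    have ihl := ih i (by omega) P ha (by linarith) (fun j hj => hP j (by omega))
    have ihr := ih k (by omega) (fun j => P (i+1+j)) (by simp; linarith)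
      (by show P (i+1+k) ≤ b; rw [← hk]; exact hb)
      (fun j hj => hP (i+1+j) (by omega))
    simp only [add_zero] at ihr
    rw [← hk] at ihr
    set L := P (n+1) - P 0 with hL
    have hL0 : 0 ≤ L := by linarith
    have b1 := half_rpow_aux θ L (P i - P 0) hθ (by linarith) (by linarith)
    have b2 := half_rpow_aux θ L (P (n+1) - P (i+1)) hθ (by linarith) (by linarith)
    have d1 := hδ (P 0) (P i) (P (n+1)) ha e1 (by linarith) hb
    have d2 := hδ (P i) (P (i+1)) (P (n+1)) (by linarith) e2 e3 hb
    have d3 : (P (n+1) - P i) ^ θ ≤ L ^ θ :=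
      Real.rpow_le_rpow (by linarith) (by linarith) (by linarith)
    have key : (∑ j ∈ Finset.range (n+1), F (P j) (P (j+1))) - F (P 0) (P (n+1))
        = ((∑ j ∈ Finset.range i, F (P j) (P (j+1))) - F (P 0) (P i))
        + ((∑ j ∈ Finset.range k, F (P (i+1+j)) (P (i+1+(j+1)))) - F (P (i+1)) (P (n+1)))
        - (F (P 0) (P (n+1)) - F (P 0) (P i) - F (P i) (P (n+1)))
        - (F (P i) (P (n+1)) - F (P i) (P (i+1)) - F (P (i+1)) (P (n+1))) := by
      rw [hk, Finset.sum_range_add, Finset.sum_range_succ]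
      simp only [← hk, add_assoc]
      abel
    rw [key]
    have hLθ : 0 ≤ L ^ θ := by positivity
    refine (norm_sub_le _ _).trans ?_
    refine (add_le_add (norm_sub_le _ _) le_rfl).trans ?_
    refine (add_le_add (add_le_add (norm_add_le _ _) le_rfl) le_rfl).trans ?_
    have c1 := ihl.trans (mul_le_mul_of_nonneg_left b1 hc)
    have c2 := ihr.trans (mul_le_mul_of_nonneg_left b2 hc)
    have c3 := d2.trans (mul_le_mul_of_nonneg_left d3 hK)
    have : 2 / (1 - r) * K * L ^ θ = 2 / (1 - r) * K * (r / 2 * L ^ θ)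
        + 2 / (1 - r) * K * (r / 2 * L ^ θ) + K * L ^ θ + K * L ^ θ := by
      have : 1 - r ≠ 0 := by linarith
      field_simp
      ring
    linarith

theorem sum_range_two_mul {V : Type*} [AddCommMonoid V] (f : ℕ → V) (n : ℕ) :
    ∑ i ∈ Finset.range (2*n), f i = ∑ k ∈ Finset.range n, (f (2*k) + f (2*k+1)) := by
  induction n with
  | zero => simp
  | succ k ih =>
    rw [show 2*(k+1) = 2*k+1+1 by ring, Finset.sum_range_succ, Finset.sum_range_succ, ih,
      Finset.sum_range_succ, add_assoc]

/-- dyadic grid points -/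
def dy (a b : ℝ) (n k : ℕ) : ℝ := a + k * ((b - a) / 2^n)

theorem dy_two (a b : ℝ) (n k : ℕ) : dy a b (n+1) (2*k) = dy a b n k := by
  unfold dy; push_cast; rw [pow_succ]; field_simp

theorem dy_zero (a b : ℝ) (n : ℕ) : dy a b n 0 = a := by simp [dy]

theorem dy_last (a b : ℝ) (n : ℕ) : dy a b n (2^n) = b := by
  unfold dy; push_cast; field_simp; ring

theorem dy_succ (a b : ℝ) (n k : ℕ) : dy a b n (k+1) = dy a b n k + (b-a)/2^n := by
  unfold dy; push_cast; ring

theorem dy_mono (a b : ℝ) (hab : a ≤ b) (n k l : ℕ) (h : k ≤ l) : dy a b n k ≤ dy a b n l := by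
  unfold dy
  have : (k:ℝ) ≤ l := by exact_mod_cast h
  have h2 : 0 ≤ (b-a)/2^n := div_nonneg (by linarith) (by positivity)
  nlinarith

theorem dy_rpow (L θ : ℝ) (hL : 0 ≤ L) (n : ℕ) :
    (2:ℝ)^n * (L / 2^n)^θ = L ^ θ * ((2:ℝ)^(1-θ))^n := by
  rw [Real.div_rpow hL (by positivity), ← Real.rpow_natCast 2 n, ← Real.rpow_mul (by norm_num),
    ← Real.rpow_natCast _ n, ← Real.rpow_mul (by norm_num), mul_div_assoc', mul_comm,
    mul_div_assoc, ← Real.rpow_sub (by norm_num)]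
  congr 2; ring

theorem clip_id {V : Type*} [NormedAddCommGroup V] (a b K θ : ℝ)
    (F : ℝ → ℝ → V) (hF0 : ∀ u, a ≤ u → u ≤ b → F u u = 0) (hK : 0 ≤ K) (hθ : 1 < θ)
    (hδ : ∀ u m v, a ≤ u → u ≤ m → m ≤ v → v ≤ b →
      ‖F u v - F u m - F m v‖ ≤ K * (v - u) ^ θ) (p q u v h : ℝ) (hp : a ≤ p) (hpq : p ≤ q)
      (hu : a ≤ u) (huv : u ≤ v) (hv : v ≤ b) (hq : q - p = h) :
    ‖F (min p v) (min q v) - F (min p u) (min q u)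
      - F (max u (min p v)) (max u (min q v))‖ ≤ K * h ^ θ := by
  have h0 : 0 ≤ h := by linarith
  have hz : 0 ≤ K * h ^ θ := by positivity
  have hu0 := hF0 u hu (by linarith)
  rcases le_total q u with h1 | h1
  · rw [min_eq_left (by linarith : p ≤ v), min_eq_left (by linarith : q ≤ v),
      min_eq_left h1, min_eq_left (by linarith : p ≤ u), max_eq_left h1, 
      max_eq_left (by linarith : p ≤ u), hu0]
    simpa using hz
  · rcases le_total u p with h2 | h2
    · rw [min_eq_right h1, min_eq_right h2, hu0, max_eq_right (le_min h1 huv), 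
        max_eq_right (le_min h2 huv)]
      simpa using hz
    · rw [min_eq_left (by linarith : p ≤ v), min_eq_left h2, min_eq_right h1, max_eq_left h2,
        max_eq_right (le_min h1 huv)]
      refine (hδ p u (min q v) hp h2 (le_min h1 huv) ((min_le_right _ _).trans hv)).trans ?_
      refine mul_le_mul_of_nonneg_left (Real.rpow_le_rpow ?_ ?_ (by linarith)) hK
      · have := le_min h1 huv; linarith
      · have := min_le_left q v; linarith

/-- The sewing lemma. -/
theorem sewing {V : Type*} [NormedAddCommGroup V] [CompleteSpace V] (a b K θ : ℝ) (hK : 0 ≤ K)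
    (hθ : 1 < θ) (hab : a ≤ b)
    (F : ℝ → ℝ → V) (hF0 : ∀ u, a ≤ u → u ≤ b → F u u = 0)
    (hδ : ∀ u m v, a ≤ u → u ≤ m → m ≤ v → v ≤ b →
      ‖F u v - F u m - F m v‖ ≤ K * (v - u) ^ θ) :
    ∃ J : ℝ → V, ∀ u v, a ≤ u → u ≤ v → v ≤ b →
      ‖F u v - (J v - J u)‖ ≤ 2 / (1 - (2:ℝ)^(1-θ)) * K * (v - u) ^ θ := by
  have hr := two_rpow_lt_one θ hθ
  have hr0 : 0 < (2:ℝ)^(1-θ) := by positivity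
  have hL : 0 ≤ b - a := by linarith
  let JN : ℕ → ℝ → V := fun n t => ∑ k ∈ Finset.range (2^n),
    F (min (dy a b n k) t) (min (dy a b n (k+1)) t)
  have hstep : ∀ n t, a ≤ t → t ≤ b → dist (JN n t) (JN (n+1) t)
      ≤ K * (b-a)^θ * ((2:ℝ)^(1-θ))^n := by
    intro n t ht1 ht2
    rw [dist_eq_norm]
    have : JN n t - JN (n+1) t = ∑ k ∈ Finset.range (2^n),
        (F (min (dy a b n k) t) (min (dy a b n (k+1)) t)
         - F (min (dy a b n k) t) (min (dy a b (n+1) (2*k+1)) t)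
         - F (min (dy a b (n+1) (2*k+1)) t) (min (dy a b n (k+1)) t)) := by
      simp only [JN]
      rw [pow_succ, mul_comm, sum_range_two_mul, ← Finset.sum_sub_distrib]
      refine Finset.sum_congr rfl fun k _ => ?_
      rw [dy_two, show 2*k+1+1 = 2*(k+1) by ring, dy_two]
      abel
    rw [this]
    refine (norm_sum_le _ _).trans ?_
    have hb : ∀ k ∈ Finset.range (2^n), ‖(F (min (dy a b n k) t) (min (dy a b n (k+1)) t)
         - F (min (dy a b n k) t) (min (dy a b (n+1) (2*k+1)) t)
         - F (min (dy a b (n+1) (2*k+1)) t) (min (dy a b n (k+1)) t))‖ 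
         ≤ K * ((b-a)/2^n)^θ := by
      intro k _
      have m1 : dy a b n k ≤ dy a b (n+1) (2*k+1) := by
        rw [← dy_two]; exact dy_mono a b hab _ _ _ (by omega)
      have m2 : dy a b (n+1) (2*k+1) ≤ dy a b n (k+1) := by
        rw [← dy_two a b n (k+1)]; exact dy_mono a b hab _ _ _ (by omega)
      have m0 : a ≤ dy a b n k := by
        have := dy_mono a b hab n 0 k (by omega); rwa [dy_zero] at this
      refine (hδ _ _ _ (le_min m0 ht1) (min_le_min_right _ m1) (min_le_min_right _ m2)
        ((min_le_right _ _).trans ht2)).trans ?_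
      refine mul_le_mul_of_nonneg_left (Real.rpow_le_rpow ?_ ?_ (by linarith)) hK
      · have := min_le_min_right t (m1.trans m2); linarith
      · have := dy_succ a b n k
        have h2 : 0 ≤ (b-a)/2^n := by positivity
        rw [this]
        rcases le_total (dy a b n k) t with h | h
        · rw [min_eq_left h]; have := min_le_left (dy a b n k + (b-a)/2^n) t; linarith
        · rw [min_eq_right h]; have := min_le_right (dy a b n k + (b-a)/2^n) t; linarith
    refine (Finset.sum_le_sum hb).trans ?_
    simp only [Finset.sum_const, Finset.card_range, nsmul_eq_mul]
    push_cast
    have := dy_rpow (b-a) θ hL n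
    rw [mul_assoc K, ← this]
    apply le_of_eq; ring
  have hlim : ∀ t, ∃ x : V, (a ≤ t → t ≤ b → Filter.Tendsto (fun n => JN n t) Filter.atTop
      (nhds x)) := by
    intro t
    by_cases h : a ≤ t ∧ t ≤ b
    · obtain ⟨x, hx⟩ := cauchySeq_tendsto_of_complete
        (cauchySeq_of_le_geometric _ _ hr (fun n => hstep n t h.1 h.2))
      exact ⟨x, fun _ _ => hx⟩
    · exact ⟨0, fun h1 h2 => absurd ⟨h1, h2⟩ h⟩
  choose J hJ using hlim
  refine ⟨J, fun u v hu huv hv => ?_⟩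
  have hA : ∀ n, ‖F u v - (JN n v - JN n u)‖ ≤ 2 / (1 - (2:ℝ)^(1-θ)) * K * (v - u) ^ θ 
      + K * (b-a)^θ * ((2:ℝ)^(1-θ))^n := by
    intro n
    let P : ℕ → ℝ := fun k => max u (min (dy a b n k) v)
    have hP0 : P 0 = u := by
      simp only [P, dy_zero]; rw [min_eq_left (by linarith), max_eq_left hu]
    have hPn : P (2^n) = v := by
      simp only [P, dy_last]; rw [min_eq_right hv, max_eq_right huv]
    have h1 := sew_part a b K θ hK hθ F hF0 hδ (2^n) P (by rw [hP0]; exact hu)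
      (by rw [hPn]; exact hv) (fun i _ => max_le_max_left _ (min_le_min_right _ 
        (dy_mono a b hab n _ _ (by omega))))
    rw [hP0, hPn] at h1
    have h2 : ‖(JN n v - JN n u) - ∑ i ∈ Finset.range (2^n), F (P i) (P (i+1))‖
        ≤ K * (b-a)^θ * ((2:ℝ)^(1-θ))^n := by
      simp only [JN]
      rw [← Finset.sum_sub_distrib, ← Finset.sum_sub_distrib]
      refine (norm_sum_le _ _).trans ?_
      refine (Finset.sum_le_sum (fun k _ => clip_id a b K θ F hF0 hK hθ hδ _ _ u v
        ((b-a)/2^n) ?_ ?_ hu huv hv ?_)).trans ?_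
      · have := dy_mono a b hab n 0 k (by omega); rwa [dy_zero] at this
      · exact dy_mono a b hab n _ _ (by omega)
      · rw [dy_succ]; ring
      simp only [Finset.sum_const, Finset.card_range, nsmul_eq_mul]
      push_cast
      have := dy_rpow (b-a) θ hL n
      rw [mul_assoc K, ← this]
      apply le_of_eq; ring
    have : F u v - (JN n v - JN n u) = -((∑ i ∈ Finset.range (2^n), F (P i) (P (i+1))) - F u v)
      - ((JN n v - JN n u) - ∑ i ∈ Finset.range (2^n), F (P i) (P (i+1))) := by abel
    rw [this]
    refine (norm_sub_le _ _).trans ?_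
    rw [norm_neg]
    linarith
  have t1 : Filter.Tendsto (fun n => ‖F u v - (JN n v - JN n u)‖) Filter.atTop
      (nhds ‖F u v - (J v - J u)‖) :=
    (tendsto_const_nhds.sub ((hJ v (by linarith) hv).sub (hJ u hu (by linarith)))).norm
  have t2 : Filter.Tendsto (fun n:ℕ => 2 / (1 - (2:ℝ)^(1-θ)) * K * (v - u) ^ θ 
      + K * (b-a)^θ * ((2:ℝ)^(1-θ))^n) Filter.atTop 
      (nhds (2 / (1 - (2:ℝ)^(1-θ)) * K * (v - u) ^ θ + K * (b-a)^θ * 0)) :=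
    tendsto_const_nhds.add ((tendsto_pow_atTop_nhds_zero_of_lt_one hr0.le hr).const_mul _)
  have := le_of_tendsto_of_tendsto' t1 t2 hA
  simpa using this

theorem riemann_of_additive {V : Type*} [NormedAddCommGroup V] (a b K θ : ℝ) (hK : 0 ≤ K)
    (hθ : 1 < θ) (F : ℝ → ℝ → V) (J : ℝ → V)
    (hJ : ∀ u v, a ≤ u → u ≤ v → v ≤ b → ‖F u v - (J v - J u)‖ ≤ K * (v - u) ^ θ)
    (s t : ℝ) (hs : a ≤ s) (hst : s ≤ t) (ht : t ≤ b) : RiemannLimit s t F (J t - J s) := by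
  intro ε hε
  have hcont : Filter.Tendsto (fun δ : ℝ => K * (t - s) * δ ^ (θ-1)) (nhdsWithin 0 (Ioi 0)) 
      (nhds (K * (t-s) * 0 ^ (θ-1))) := by
    refine Filter.Tendsto.const_mul _ ?_
    exact ((Real.continuous_rpow_const (by linarith : 0 ≤ θ - 1)).tendsto 0).mono_left
      nhdsWithin_le_nhds
  rw [Real.zero_rpow (by linarith), mul_zero] at hcont
  have h1 := (hcont.eventually (gt_mem_nhds hε)).and self_mem_nhdsWithin
  obtain ⟨δ, hδ1, hδ0⟩ := h1.exists
  have hδ0 : 0 < δ := hδ0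
  refine ⟨δ, hδ0, fun n P hP0 hPn hPm hPd => ?_⟩
  have hmono := mono_of_step P n hPm
  have e : (∑ i ∈ Finset.range n, F (P i) (P (i+1))) - (J t - J s)
      = ∑ i ∈ Finset.range n, (F (P i) (P (i+1)) - (J (P (i+1)) - J (P i))) := by
    rw [Finset.sum_sub_distrib, Finset.sum_range_sub (fun i => J (P i)), hP0, hPn]
  rw [e]
  refine lt_of_le_of_lt (norm_sum_le _ _) (lt_of_le_of_lt ?_ hδ1)
  have hb : ∀ i ∈ Finset.range n, ‖F (P i) (P (i+1)) - (J (P (i+1)) - J (P i))‖ 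
      ≤ K * δ^(θ-1) * (P (i+1) - P i) := by
    intro i hi
    have hi : i < n := Finset.mem_range.1 hi
    have l1 := hmono 0 i (by omega) (by omega)
    have l2 := hmono (i+1) n (by omega) (by omega)
    have l3 := hPm i hi
    refine (hJ _ _ (by linarith) l3 (by linarith)).trans ?_
    have hx : 0 ≤ P (i+1) - P i := by linarith
    rw [mul_assoc]
    refine mul_le_mul_of_nonneg_left ?_ hK
    rcases hx.eq_or_lt with h | h
    · rw [← h, Real.zero_rpow (by linarith)]; simp
    · have : (P (i+1) - P i)^θ = (P (i+1) - P i)^(θ-1) * (P (i+1) - P i) := by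
        rw [← Real.rpow_add_one h.ne']; congr 1; ring
      rw [this]
      exact mul_le_mul_of_nonneg_right (Real.rpow_le_rpow hx (hPd i hi).le (by linarith)) hx
  refine (Finset.sum_le_sum hb).trans ?_
  rw [← Finset.mul_sum, Finset.sum_range_sub, hP0, hPn]
  apply le_of_eq; ring

/-- Riemann limits give convergence along dyadic partitions. -/
theorem riemann_dy {V : Type*} [NormedAddCommGroup V] (s t : ℝ) (hst : s ≤ t) (F : ℝ → ℝ → V)
    (I : V) (h : RiemannLimit s t F I) :
    Filter.Tendsto (fun n => ∑ k ∈ Finset.range (2^n), F (dy s t n k) (dy s t n (k+1)))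
      Filter.atTop (nhds I) := by
  rw [Metric.tendsto_atTop]
  intro ε hε
  obtain ⟨δ, hδ, hP⟩ := h ε hε
  have h1 : Filter.Tendsto (fun n:ℕ => (t-s) * (1/2:ℝ)^n) Filter.atTop (nhds ((t-s)*0)) :=
    (tendsto_pow_atTop_nhds_zero_of_lt_one (by norm_num) (by norm_num)).const_mul _
  rw [mul_zero] at h1
  obtain ⟨N, hN⟩ := Filter.eventually_atTop.1 (h1.eventually (gt_mem_nhds hδ))
  refine ⟨N, fun n hn => ?_⟩
  rw [dist_eq_norm]
  refine hP (2^n) (dy s t n) (dy_zero _ _ _) (dy_last _ _ _) 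
    (fun i _ => dy_mono _ _ hst _ _ _ (by omega)) (fun i _ => ?_)
  rw [dy_succ]
  have := hN n hn
  have e : (t-s)/2^n = (t-s) * (1/2:ℝ)^n := by rw [one_div, inv_pow]; rfl
  rw [e]; linarith

theorem riemann_unique {V : Type*} [NormedAddCommGroup V] (s t : ℝ) (hst : s ≤ t) 
    (F : ℝ → ℝ → V) (I I' : V) (h : RiemannLimit s t F I) (h' : RiemannLimit s t F I') : I = I' :=
  tendsto_nhds_unique (riemann_dy s t hst F I h) (riemann_dy s t hst F I' h')

theorem riemann_sub {V : Type*} [NormedAddCommGroup V] (s t : ℝ) 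
    (F F' : ℝ → ℝ → V) (I I' : V) (h : RiemannLimit s t F I) (h' : RiemannLimit s t F' I') : 
    RiemannLimit s t (fun u v => F u v - F' u v) (I - I') := by
  intro ε hε
  obtain ⟨δ, hδ, h1⟩ := h (ε/2) (by linarith)
  obtain ⟨δ', hδ', h2⟩ := h' (ε/2) (by linarith)
  refine ⟨min δ δ', lt_min hδ hδ', fun n P a b c e => ?_⟩
  have a1 := h1 n P a b c (fun i hi => (e i hi).trans_le (min_le_left _ _))
  have a2 := h2 n P a b c (fun i hi => (e i hi).trans_le (min_le_right _ _))
  rw [Finset.sum_sub_distrib]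
  have : (∑ i ∈ Finset.range n, F (P i) (P (i+1))) - (∑ i ∈ Finset.range n, F' (P i) (P (i+1))) 
    - (I - I') = ((∑ i ∈ Finset.range n, F (P i) (P (i+1))) - I) - 
      ((∑ i ∈ Finset.range n, F' (P i) (P (i+1))) - I') := by abel
  rw [this]
  exact (norm_sub_le _ _).trans_lt (by linarith)

/-- Riemann limits only depend on the germ on the simplex. -/
theorem riemann_congr {V : Type*} [NormedAddCommGroup V] (s t : ℝ) 
    (F F' : ℝ → ℝ → V) (I : V) (h : RiemannLimit s t F I)
    (hF : ∀ u v, s ≤ u → u ≤ v → v ≤ t → F u v = F' u v) : 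
    RiemannLimit s t F' I := by
  intro ε hε
  obtain ⟨δ, hδ, h1⟩ := h ε hε
  refine ⟨δ, hδ, fun n P a b c e => ?_⟩
  have a1 := h1 n P a b c e
  have hm := mono_of_step P n c
  have : ∑ i ∈ Finset.range n, F (P i) (P (i+1)) = ∑ i ∈ Finset.range n, F' (P i) (P (i+1)) := by
    refine Finset.sum_congr rfl fun i hi => ?_
    have hi : i < n := Finset.mem_range.1 hi
    refine hF _ _ ?_ (c i hi) ?_
    · rw [← a]; exact hm 0 i (by omega) (by omega)
    · rw [← b]; exact hm (i+1) n (by omega) le_rfl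
  rwa [this] at a1

theorem sum_third (n : ℕ) : ∑ j ∈ Finset.range n, ((j:ℝ)+1)^(-(2/3:ℝ)) ≤ 3 * (n:ℝ)^(1/3:ℝ) := by
  induction n with
  | zero => simp
  | succ k ih =>
    rw [Finset.sum_range_succ]
    have hk : (0:ℝ) ≤ k := by positivity
    have hk1 : (0:ℝ) < (k:ℝ)+1 := by positivity
    set x := (k:ℝ)^(1/3:ℝ) with hx
    set y := ((k:ℝ)+1)^(1/3:ℝ) with hy
    have hx0 : 0 ≤ x := by positivity
    have hy0 : 0 < y := by positivity
    have hxy : x ≤ y := Real.rpow_le_rpow hk (by linarith) (by norm_num)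
    have hx3 : x^3 = k := by
      rw [hx, ← Real.rpow_natCast, ← Real.rpow_mul hk]; norm_num
    have hy3 : y^3 = k+1 := by
      rw [hy, ← Real.rpow_natCast, ← Real.rpow_mul hk1.le]; norm_num
    have hyy : ((k:ℝ)+1)^(-(2/3:ℝ)) = 1/y^2 := by
      rw [hy, ← Real.rpow_natCast, ← Real.rpow_mul hk1.le, one_div, ← Real.rpow_neg hk1.le]
      norm_num
    rw [hyy]
    push_cast
    rw [← hy]
    have : 1 / y^2 ≤ 3 * (y - x) := by
      rw [div_le_iff₀ (by positivity)]
      have e : (y - x) * (y^2+x*y+x^2) = 1 := by ring_nf; rw [hx3, hy3]; ring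
      nlinarith [mul_nonneg (sub_nonneg.2 hxy) (sub_nonneg.2 hxy), mul_nonneg (sub_nonneg.2 hxy) (mul_nonneg hy0.le (sub_nonneg.2 hxy)), mul_nonneg (sub_nonneg.2 hxy) (mul_nonneg hx0 (sub_nonneg.2 hxy))]
    linarith

/-- singular sewing along dyadic partitions -/
theorem sing_sewing {V : Type*} [NormedAddCommGroup V] [CompleteSpace V] (s t K γ : ℝ) 
    (hK : 0 ≤ K) (hγ : 1/3 < γ) (hγ2 : γ ≤ 1/2) (hst : s < t)
    (G : ℝ → ℝ → V) 
    (hδ : ∀ u m v, s ≤ u → u ≤ m → m ≤ v → v ≤ t → m < t →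
      ‖G u v - G u m - G m v‖ ≤ K * ((t - m) ^ (-(2*γ)) * (v - u) ^ (3*γ))) :
    ∃ X : V, Filter.Tendsto 
      (fun n => ∑ k ∈ Finset.range (2^n), G (dy s t n k) (dy s t n (k+1))) Filter.atTop (nhds X) ∧
      ‖X - G s t‖ ≤ 6 / (1 - (2:ℝ)^(1/3-γ)) * K * (t-s)^γ := by
  have hr : (2:ℝ)^(1/3-γ) < 1 := Real.rpow_lt_one_of_one_lt_of_neg (by norm_num) (by linarith)
  have hr0 : 0 < (2:ℝ)^(1/3-γ) := by positivity
  have hL : 0 < t - s := by linarith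
  let X : ℕ → V := fun n => ∑ k ∈ Finset.range (2^n), G (dy s t n k) (dy s t n (k+1))
  have hstep : ∀ n, dist (X n) (X (n+1)) ≤ 6 * K * (t-s)^γ * ((2:ℝ)^(1/3-γ))^n := by
    intro n
    rw [dist_eq_norm]
    have : X n - X (n+1) = ∑ k ∈ Finset.range (2^n),
        (G (dy s t n k) (dy s t n (k+1))
         - G (dy s t n k) (dy s t (n+1) (2*k+1))
         - G (dy s t (n+1) (2*k+1)) (dy s t n (k+1))) := by
      simp only [X]
      rw [pow_succ, mul_comm, sum_range_two_mul, ← Finset.sum_sub_distrib]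
      refine Finset.sum_congr rfl fun k _ => ?_
      rw [dy_two, show 2*k+1+1 = 2*(k+1) by ring, dy_two]
      abel
    rw [this]
    refine (norm_sum_le _ _).trans ?_
    set h := (t-s)/2^n with hh
    have hh0 : 0 < h := by positivity
    have hb : ∀ k ∈ Finset.range (2^n), ‖(G (dy s t n k) (dy s t n (k+1))
         - G (dy s t n k) (dy s t (n+1) (2*k+1))
         - G (dy s t (n+1) (2*k+1)) (dy s t n (k+1)))‖ 
         ≤ 2 * K * h ^ γ * (((2^n - 1 - k : ℕ) : ℝ) + 1) ^ (-(2/3:ℝ)) := by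
      intro k hk
      have hk : k < 2^n := Finset.mem_range.1 hk
      have m1 : dy s t n k ≤ dy s t (n+1) (2*k+1) := by
        rw [← dy_two]; exact dy_mono s t hst.le _ _ _ (by omega)
      have m2 : dy s t (n+1) (2*k+1) ≤ dy s t n (k+1) := by
        rw [← dy_two s t n (k+1)]; exact dy_mono s t hst.le _ _ _ (by omega)
      have m0 : s ≤ dy s t n k := by
        have := dy_mono s t hst.le n 0 k (by omega); rwa [dy_zero] at this
      have m3 : dy s t n (k+1) ≤ t := by
        have := dy_mono s t hst.le n (k+1) (2^n) (by omega); rwa [dy_last] at this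
      obtain ⟨j, hj⟩ : ∃ j, 2^n = k + 1 + j := ⟨2^n - (k+1), by omega⟩
      have hj' : (2:ℝ)^n = k + 1 + j := by exact_mod_cast hj
      have hjj : 2^n - 1 - k = j := by omega
      have htm : t - dy s t (n+1) (2*k+1) = (j + 1/2) * h := by
        have : t = s + 2^n * h := by rw [hh]; field_simp; ring
        have e2 : (t-s)/2^(n+1) = h/2 := by rw [hh, pow_succ]; field_simp
        unfold dy; rw [e2]; nth_rewrite 1 [this]; rw [hj']; push_cast; ring
      have htm2 : (j+1)/2 * h ≤ t - dy s t (n+1) (2*k+1) := by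
        rw [htm]; refine mul_le_mul_of_nonneg_right ?_ hh0.le
        have : (0:ℝ) ≤ j := by positivity
        linarith
      have hpos : 0 < ((j:ℝ)+1)/2*h := by positivity
      refine (hδ _ _ _ m0 m1 m2 m3 (by linarith)).trans ?_
      rw [hjj]
      have e1 : dy s t n (k+1) - dy s t n k = h := by rw [dy_succ]; ring
      rw [e1]
      have p1 : (t - dy s t (n+1) (2*k+1)) ^ (-(2*γ)) ≤ (((j:ℝ)+1)/2*h)^(-(2*γ)) :=
        Real.rpow_le_rpow_of_nonpos hpos htm2 (by linarith)
      have p2 : (((j:ℝ)+1)/2*h)^(-(2*γ)) ≤ 2 * ((j:ℝ)+1)^(-(2/3:ℝ)) * h^(-(2*γ)) := by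
        rw [Real.mul_rpow (by positivity) hh0.le, Real.div_rpow (by positivity) (by norm_num)]
        refine mul_le_mul_of_nonneg_right ?_ (by positivity)
        rw [Real.rpow_neg (by norm_num : (0:ℝ) ≤ 2), div_inv_eq_mul, mul_comm]
        refine mul_le_mul ?_ ?_ (by positivity) (by norm_num)
        · calc (2:ℝ)^(2*γ) ≤ 2^(1:ℝ) := Real.rpow_le_rpow_of_exponent_le (by norm_num) (by linarith)
            _ = 2 := Real.rpow_one _
        · refine Real.rpow_le_rpow_of_exponent_le ?_ (by linarith)
          have : (0:ℝ) ≤ j := by positivity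
          linarith
      have p3 : h^(-(2*γ)) * h^(3*γ) = h^γ := by
        rw [← Real.rpow_add hh0]; congr 1; ring
      calc K * ((t - dy s t (n+1) (2*k+1)) ^ (-(2*γ)) * h ^ (3*γ))
          ≤ K * ((2 * ((j:ℝ)+1)^(-(2/3:ℝ)) * h^(-(2*γ))) * h ^ (3*γ)) := by
            have := p1.trans p2
            gcongr
        _ = 2 * K * h^γ * ((j:ℝ)+1)^(-(2/3:ℝ)) := by rw [← p3]; ring
    refine (Finset.sum_le_sum hb).trans ?_
    rw [← Finset.mul_sum, Finset.sum_range_reflect (fun j => ((j:ℝ)+1)^(-(2/3:ℝ)))]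
    have h3 := sum_third (2^n)
    push_cast at h3
    have : 2 * K * h^γ * (3 * ((2:ℝ)^n)^(1/3:ℝ)) = 6 * K * (t-s)^γ * ((2:ℝ)^(1/3-γ))^n := by
      rw [hh, Real.div_rpow hL.le (by positivity), ← Real.rpow_natCast 2 n, 
        ← Real.rpow_mul (by norm_num), ← Real.rpow_mul (by norm_num), ← Real.rpow_natCast _ n, 
        ← Real.rpow_mul (by norm_num), show (1/3-γ)*(n:ℝ) = n*(1/3) - n*γ by ring,
        Real.rpow_sub (by norm_num)]
      ring
    rw [← this]
    exact mul_le_mul_of_nonneg_left h3 (by positivity)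
  obtain ⟨x, hx⟩ := cauchySeq_tendsto_of_complete (cauchySeq_of_le_geometric _ _ hr hstep)
  refine ⟨x, hx, ?_⟩
  have h0 := dist_le_of_le_geometric_of_tendsto₀ _ _ hr hstep hx
  have : X 0 = G s t := by
    simp only [X]
    have h1 := dy_zero s t 0
    have h2 := dy_last s t 0
    simp at h2
    simp [h1, h2]
  rw [this, dist_comm, dist_eq_norm] at h0
  refine h0.trans (le_of_eq ?_)
  ring

section partTwo

/-- contraction of a bilinear map with a matrix -/
def ctr {d : ℕ} {V : Type*} [NormedAddCommGroup V] [NormedSpace ℝ V]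
    (Z : (Fin d → ℝ) →L[ℝ] (Fin d → ℝ) →L[ℝ] V) : (Fin d → Fin d → ℝ) →L[ℝ] V :=
  ∑ i, ∑ j, (((ContinuousLinearMap.proj j : (Fin d → ℝ) →L[ℝ] ℝ)).comp
    (ContinuousLinearMap.proj i : (Fin d → Fin d → ℝ) →L[ℝ] (Fin d → ℝ))).smulRight
      (Z (Pi.single i 1) (Pi.single j 1))

theorem ctr_apply {d : ℕ} {V : Type*} [NormedAddCommGroup V] [NormedSpace ℝ V]
    (Z : (Fin d → ℝ) →L[ℝ] (Fin d → ℝ) →L[ℝ] V) (M : Fin d → Fin d → ℝ) :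
    ctr Z M = ∑ i, ∑ j, M i j • Z (Pi.single i 1) (Pi.single j 1) := by
  simp [ctr]

theorem ctr_sub {d : ℕ} {V : Type*} [NormedAddCommGroup V] [NormedSpace ℝ V]
    (Z Z' : (Fin d → ℝ) →L[ℝ] (Fin d → ℝ) →L[ℝ] V) (M : Fin d → Fin d → ℝ) :
    ctr (Z - Z') M = ctr Z M - ctr Z' M := by
  simp only [ctr_apply, ← Finset.sum_sub_distrib, sub_apply, smul_sub]

theorem map_ctr {d : ℕ} (ι : H →L[ℝ] E)
    (Z : (Fin d → ℝ) →L[ℝ] (Fin d → ℝ) →L[ℝ] H) (M : Fin d → Fin d → ℝ) :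
    ι (ctr Z M) = ctr ((ContinuousLinearMap.compL ℝ (Fin d → ℝ) H E ι).comp Z) M := by
  simp [ctr_apply]

theorem ctr_of_tensor {d : ℕ} {V : Type*} [NormedAddCommGroup V] [NormedSpace ℝ V]
    (Z : (Fin d → ℝ) →L[ℝ] (Fin d → ℝ) →L[ℝ] V) (G : (Fin d → Fin d → ℝ) →L[ℝ] V)
    (h : ∀ a b, G (tensor a b) = Z a b) (M : Fin d → Fin d → ℝ) : G M = ctr Z M := by
  have hM : M = ∑ i, ∑ j, M i j • tensor (Pi.single i (1:ℝ)) (Pi.single j (1:ℝ)) := by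
    funext a b
    simp [tensor, Finset.sum_apply, Pi.single_apply]
  rw [ctr_apply]
  nth_rewrite 1 [hM]
  simp [h]

theorem ctr_tensor {d : ℕ} {V : Type*} [NormedAddCommGroup V] [NormedSpace ℝ V]
    (Z : (Fin d → ℝ) →L[ℝ] (Fin d → ℝ) →L[ℝ] V) (a b : Fin d → ℝ) :
    ctr Z (tensor a b) = Z a b := by
  have ha : ∀ a : Fin d → ℝ, a = ∑ i, a i • (Pi.single i (1:ℝ) : Fin d → ℝ) := by
    intro a; funext k; simp [Finset.sum_apply, Pi.single_apply]
  rw [ctr_apply]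
  conv_rhs => rw [ha a, ha b]
  simp only [map_sum, map_smul, sum_apply, tensor,
    smul_apply, Finset.smul_sum, smul_smul]
  rw [Finset.sum_comm]
  refine Finset.sum_congr rfl fun i _ => Finset.sum_congr rfl fun j _ => ?_
  rw [mul_comm]

theorem ctr_norm {d : ℕ} {V : Type*} [NormedAddCommGroup V] [NormedSpace ℝ V]
    (Z : (Fin d → ℝ) →L[ℝ] (Fin d → ℝ) →L[ℝ] V) (M : Fin d → Fin d → ℝ) :
    ‖ctr Z M‖ ≤ (d:ℝ)^2 * ‖Z‖ * ‖M‖ := by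
  have h1 : ∀ i : Fin d, ‖(Pi.single i (1:ℝ) : Fin d → ℝ)‖ ≤ 1 := by
    intro i; simp [Pi.norm_single]
  rw [ctr_apply]
  have h2 : ∀ i j, ‖M i j • Z (Pi.single i 1) (Pi.single j 1)‖ ≤ ‖Z‖ * ‖M‖ := by
    intro i j
    rw [norm_smul]
    have a1 : ‖M i j‖ ≤ ‖M‖ := (norm_le_pi_norm (M i) j).trans (norm_le_pi_norm M i)
    have a2 : ‖Z (Pi.single i 1) (Pi.single j 1)‖ ≤ ‖Z‖ := by
      calc _ ≤ ‖Z‖ * ‖(Pi.single i (1:ℝ) : Fin d → ℝ)‖ * ‖(Pi.single j (1:ℝ) : Fin d → ℝ)‖ :=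
            Z.le_opNorm₂ _ _
        _ ≤ ‖Z‖ * 1 * 1 := by gcongr <;> exact h1 _
        _ = ‖Z‖ := by ring
    rw [mul_comm]
    exact mul_le_mul a2 a1 (norm_nonneg _) (by positivity)
  refine (norm_sum_le _ _).trans ((Finset.sum_le_sum fun i _ => (norm_sum_le _ _).trans
    (Finset.sum_le_sum fun j _ => h2 i j)).trans ?_)
  simp only [Finset.sum_const, Finset.card_univ, Fintype.card_fin, nsmul_eq_mul]
  apply le_of_eq; ring

theorem tensor_norm {d : ℕ} (a b : Fin d → ℝ) : ‖tensor a b‖ ≤ ‖a‖ * ‖b‖ := by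
  refine (pi_norm_le_iff_of_nonneg (by positivity)).2 fun i => ?_
  refine (pi_norm_le_iff_of_nonneg (by positivity)).2 fun j => ?_
  simp only [tensor, norm_mul]
  exact mul_le_mul (norm_le_pi_norm a i) (norm_le_pi_norm b j) (norm_nonneg _) (norm_nonneg _)

/-- All the standing assumptions, with one constant. -/
structure RSetup {d : ℕ} (γ T : ℝ) (ι : H →L[ℝ] E) (SH : ℝ → H →L[ℝ] H) (SE : ℝ → E →L[ℝ] E)
    (Sm : ℝ → E →L[ℝ] H) (w : ℝ → Fin d → ℝ) (w2 : ℝ → ℝ → Fin d → Fin d → ℝ) (C : ℝ) :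
    Prop where
  hC : 1 ≤ C
  hγ1 : 1/3 < γ
  hγ2 : γ ≤ 1/2
  hT : 0 < T
  hd : (d:ℝ)^2 ≤ C
  hTγ : ∀ h, 0 ≤ h → h ≤ T → h ^ γ ≤ C
  hTh : ∀ h, 0 ≤ h → h ≤ T → h ≤ C * h ^ γ
  hTh2 : ∀ h, 0 ≤ h → h ≤ T → h ≤ C * h ^ (2*γ)
  inj : Function.Injective ι
  ιle : ∀ x, ‖ι x‖ ≤ ‖x‖
  SH0 : ∀ x, SH 0 x = x
  SHsg : ∀ a b, 0 ≤ a → 0 ≤ b → ∀ x, SH (a+b) x = SH a (SH b x)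
  SEsg : ∀ a b, 0 ≤ a → 0 ≤ b → ∀ x, SE (a+b) x = SE a (SE b x)
  SHc : ∀ x : H, ContinuousOn (fun u => SH u x) (Ici (0 : ℝ))
  comm : ∀ u, 0 ≤ u → ∀ x, ι (SH u x) = SE u (ι x)
  SHb : ∀ u, 0 ≤ u → u ≤ T → ∀ x, ‖SH u x‖ ≤ C * ‖x‖
  SEb : ∀ u, 0 ≤ u → u ≤ T → ∀ x, ‖SE u x‖ ≤ C * ‖x‖
  Smι : ∀ u, 0 < u → u ≤ T → ∀ x, ι (Sm u x) = SE u x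
  Smb : ∀ u, 0 < u → u ≤ T → ∀ x, ‖Sm u x‖ ≤ C * u ^ (-(2*γ)) * ‖x‖
  shold : ∀ u, 0 ≤ u → u ≤ T → ∀ x, ‖SE u (ι x) - ι x‖ ≤ C * u ^ (2*γ) * ‖x‖
  chen : Chen 0 T w w2
  wb : ∀ s t, 0 ≤ s → s ≤ t → t ≤ T → ‖w t - w s‖ ≤ C * (t-s)^γ
  w2b : ∀ s t, 0 ≤ s → s ≤ t → t ≤ T → ‖w2 t s‖ ≤ C * (t-s)^(2*γ)

/-- Bounds of a controlled path. -/
structure CB {d : ℕ} {K KE : Type*} [NormedAddCommGroup K] [NormedSpace ℝ K]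
    [NormedAddCommGroup KE] [NormedSpace ℝ KE] (γ a b : ℝ) (ι : K →L[ℝ] KE) (w : ℝ → Fin d → ℝ)
    (y : ℝ → K) (y' : ℝ → (Fin d → ℝ) →L[ℝ] K) (A A' B B' : ℝ) : Prop where
  hA : ∀ t, a ≤ t → t ≤ b → ‖y t‖ ≤ A
  hA' : ∀ t, a ≤ t → t ≤ b → ‖y' t‖ ≤ A'
  hB : ∀ s t, a ≤ s → s ≤ t → t ≤ b →
    ‖ι (y t) - ι (y s) - ι (y' s (w t - w s))‖ ≤ B * (t-s)^(2*γ)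
  hB' : ∀ s t, a ≤ s → s ≤ t → t ≤ b → ‖ι.comp (y' t) - ι.comp (y' s)‖ ≤ B' * (t-s)^γ

/-- post-composition with `ι` -/
abbrev io (d : ℕ) (ι : H →L[ℝ] E) : ((Fin d → ℝ) →L[ℝ] H) →L[ℝ] ((Fin d → ℝ) →L[ℝ] E) :=
  ContinuousLinearMap.compL ℝ (Fin d → ℝ) H E ι

/-- the compensated germ -/
def germ {d : ℕ} (ι : H →L[ℝ] E) (SE : ℝ → E →L[ℝ] E) (w : ℝ → Fin d → ℝ)
    (w2 : ℝ → ℝ → Fin d → Fin d → ℝ) (z : ℝ → (Fin d → ℝ) →L[ℝ] H)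
    (z' : ℝ → (Fin d → ℝ) →L[ℝ] (Fin d → ℝ) →L[ℝ] H) (t u v : ℝ) : E :=
  SE (t - u) (ι (z u (w v - w u)) + ι (ctr (z' u) (w2 v u)))

theorem rpow_dbl (h γ : ℝ) (hh : 0 ≤ h) : h ^ (2*γ) = (h^γ)^2 := by
  rw [mul_comm, Real.rpow_mul hh]; norm_cast

theorem rpow_tri (h γ : ℝ) (hh : 0 ≤ h) : h ^ (3*γ) = (h^γ)^3 := by
  rw [mul_comm, Real.rpow_mul hh]; norm_cast

variable {d : ℕ} {γ T C : ℝ} {ι : H →L[ℝ] E} {SH : ℝ → H →L[ℝ] H} {SE : ℝ → E →L[ℝ] E}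
  {Sm : ℝ → E →L[ℝ] H} {w : ℝ → Fin d → ℝ} {w2 : ℝ → ℝ → Fin d → Fin d → ℝ}
/-- the defect of the germ -/
def err (ι : H →L[ℝ] E) (SE : ℝ → E →L[ℝ] E) (w : ℝ → Fin d → ℝ)
    (w2 : ℝ → ℝ → Fin d → Fin d → ℝ) (z : ℝ → (Fin d → ℝ) →L[ℝ] H)
    (z' : ℝ → (Fin d → ℝ) →L[ℝ] (Fin d → ℝ) →L[ℝ] H) (u m v : ℝ) : E :=
  SE (m - u) (ι (z u (w v - w m) + ctr (z' u) (w2 v m + tensor (w m - w u) (w v - w m))))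
    - ι (z m (w v - w m)) - ι (ctr (z' m) (w2 v m))

theorem RSetup.w2_self (S : RSetup γ T ι SH SE Sm w w2 C) (u : ℝ) (h0 : 0 ≤ u) (hT : u ≤ T) :
    w2 u u = 0 := by
  have := S.chen u u u h0 le_rfl le_rfl hT
  funext i j
  have := congrFun (congrFun this i) j
  simpa [tensor] using this

theorem RSetup.w2_chen (S : RSetup γ T ι SH SE Sm w w2 C) (u m v : ℝ) (h0 : 0 ≤ u) (h1 : u ≤ m)
    (h2 : m ≤ v) (hT : v ≤ T) :
    w2 v u = w2 m u + (w2 v m + tensor (w m - w u) (w v - w m)) := by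
  rw [← S.chen u m v h0 h1 h2 hT]; abel

theorem germ_delta (S : RSetup γ T ι SH SE Sm w w2 C) (z : ℝ → (Fin d → ℝ) →L[ℝ] H)
    (z' : ℝ → (Fin d → ℝ) →L[ℝ] (Fin d → ℝ) →L[ℝ] H) (t u m v : ℝ) (h0 : 0 ≤ u) (h1 : u ≤ m)
    (h2 : m ≤ v) (hv : v ≤ t) (hT : t ≤ T) :
    germ ι SE w w2 z z' t u v - germ ι SE w w2 z z' t u m - germ ι SE w w2 z z' t m v
      = SE (t - m) (err ι SE w w2 z z' u m v) := by
  have hsg : ∀ x, SE (t-u) x = SE (t-m) (SE (m-u) x) := by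
    intro x
    rw [← S.SEsg _ _ (by linarith) (by linarith)]; congr 2; ring
  simp only [germ, err, hsg]
  rw [S.w2_chen u m v h0 h1 h2 (by linarith), ← map_sub, ← map_sub, ← map_sub]
  congr 1
  have : w v - w u = (w v - w m) + (w m - w u) := by abel
  rw [this]
  simp only [map_add, map_sub]
  abel

theorem err_bound (S : RSetup γ T ι SH SE Sm w w2 C) (z : ℝ → (Fin d → ℝ) →L[ℝ] H)
    (z' : ℝ → (Fin d → ℝ) →L[ℝ] (Fin d → ℝ) →L[ℝ] H) (a b N : ℝ) (ha : 0 ≤ a) (hb : b ≤ T)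
    (hz : CB γ a b (io d ι) w z z' N N N N) (u m v : ℝ) (h0 : a ≤ u) (h1 : u ≤ m)
    (h2 : m ≤ v) (hv : v ≤ b) :
    ‖err ι SE w w2 z z' u m v‖ ≤ (C^2 + C^3*(C+C^2) + C + C^2) * N * (v-u)^(3*γ) := by
  have hC := S.hC
  have hγ := S.hγ1
  have hN : 0 ≤ N := (norm_nonneg _).trans (hz.hA u h0 (by linarith))
  set p := (v-u)^γ with hp
  have hp0 : 0 ≤ p := Real.rpow_nonneg (by linarith) _
  have hpC : p ≤ C := S.hTγ _ (by linarith) (by linarith)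
  have p1 : (v-m)^γ ≤ p := Real.rpow_le_rpow (by linarith) (by linarith) (by linarith)
  have p2 : (m-u)^γ ≤ p := Real.rpow_le_rpow (by linarith) (by linarith) (by linarith)
  have q1 : 0 ≤ (v-m)^γ := Real.rpow_nonneg (by linarith) _
  have q2 : 0 ≤ (m-u)^γ := Real.rpow_nonneg (by linarith) _
  rw [rpow_tri _ _ (by linarith), ← hp]
  have wvm : ‖w v - w m‖ ≤ C * p := (S.wb m v (by linarith) h2 (by linarith)).trans (by gcongr)
  have wmu : ‖w m - w u‖ ≤ C * p := (S.wb u m (by linarith) h1 (by linarith)).trans (by gcongr)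
  have w2vm : ‖w2 v m‖ ≤ C * p^2 := by
    refine (S.w2b m v (by linarith) h2 (by linarith)).trans ?_
    rw [rpow_dbl _ _ (by linarith)]; gcongr
  set x := z u (w v - w m) + ctr (z' u) (w2 v m + tensor (w m - w u) (w v - w m)) with hx
  have xb : ‖x‖ ≤ N * (C * p) + C * N * (C * p^2 + C*p*(C*p)) := by
    refine (norm_add_le _ _).trans (add_le_add ?_ ?_)
    · refine ((z u).le_opNorm _).trans ?_
      have := hz.hA u h0 (by linarith)
      gcongr
    · refine (ctr_norm _ _).trans ?_
      have h1 := hz.hA' u h0 (by linarith)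
      have h2 := S.hd
      have h3 : ‖w2 v m + tensor (w m - w u) (w v - w m)‖ ≤ C * p^2 + C*p*(C*p) := by
        refine (norm_add_le _ _).trans (add_le_add w2vm ((tensor_norm _ _).trans ?_))
        gcongr
      gcongr
  have key : err ι SE w w2 z z' u m v = (SE (m-u) (ι x) - ι x)
      - ((io d ι) (z m) - (io d ι) (z u) - (io d ι) (z' u (w m - w u))) (w v - w m)
      - ctr ((io d ι).comp (z' m) - (io d ι).comp (z' u)) (w2 v m) := by
    rw [ctr_sub, ← map_ctr, ← map_ctr]
    simp only [err, ← hx]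
    have : ι x = ι (z u (w v - w m)) + ι (ctr (z' u) (w2 v m))
        + ι (z' u (w m - w u) (w v - w m)) := by
      rw [hx, map_add (ctr (z' u)), ctr_tensor]; simp only [map_add]; abel
    rw [this]
    simp only [sub_apply, ContinuousLinearMap.compL_apply,
      ContinuousLinearMap.comp_apply]
    abel
  rw [key]
  refine (norm_sub_le _ _).trans ((add_le_add (norm_sub_le _ _) le_rfl).trans ?_)
  have k1 : ‖SE (m-u) (ι x) - ι x‖ ≤ C * p^2 * (N * (C * p) + C * N * (C * p^2 + C*p*(C*p))) := by
    refine (S.shold _ (by linarith) (by linarith) x).trans ?_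
    rw [rpow_dbl _ _ (by linarith)]; gcongr
  have k2 : ‖((io d ι) (z m) - (io d ι) (z u) - (io d ι) (z' u (w m - w u))) (w v - w m)‖
      ≤ N * p^2 * (C*p) := by
    refine (ContinuousLinearMap.le_opNorm _ _).trans ?_
    have := hz.hB u m h0 h1 (by linarith)
    rw [rpow_dbl _ _ (by linarith)] at this
    have h3 : N * ((m-u)^γ)^2 ≤ N * p^2 := by gcongr
    exact mul_le_mul (this.trans h3) wvm (norm_nonneg _) (by positivity)
  have k3 : ‖ctr ((io d ι).comp (z' m) - (io d ι).comp (z' u)) (w2 v m)‖ ≤ C * (N*p) * (C*p^2) := by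
    refine (ctr_norm _ _).trans ?_
    have h1 := (hz.hB' u m h0 h1 (by linarith)).trans (mul_le_mul_of_nonneg_left p2 hN)
    have h2 := S.hd
    gcongr
  have k4 : C * p^2 * (N * (C * p) + C * N * (C * p^2 + C*p*(C*p))) 
      ≤ (C^2 + C^3*(C+C^2)) * N * p^3 := by
    have : C * p^2 * (N * (C * p) + C * N * (C * p^2 + C*p*(C*p))) 
      = (C^2 + C^2*(C+C^2)*p) * N * p^3 := by ring
    rw [this]
    have : C^2*(C+C^2)*p ≤ C^3*(C+C^2) := by
      calc C^2*(C+C^2)*p ≤ C^2*(C+C^2)*C := by gcongr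
        _ = _ := by ring
    gcongr
  have e : (C^2 + C^3*(C+C^2) + C + C^2) * N * p^3 = (C^2 + C^3*(C+C^2)) * N * p^3 + N * p^2 * (C*p)
    + C * (N*p) * (C*p^2) := by ring
  rw [e]
  linarith

theorem int_lemma (S : RSetup γ T ι SH SE Sm w w2 C) :
    ∃ K, 1 ≤ K ∧ ∀ (a b N : ℝ) (z : ℝ → (Fin d → ℝ) →L[ℝ] H)
      (z' : ℝ → (Fin d → ℝ) →L[ℝ] (Fin d → ℝ) →L[ℝ] H), 0 ≤ a → b ≤ T → 0 ≤ N →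
      CB γ a b (io d ι) w z z' N N N N →
      ∃ X : ℝ → ℝ → H, ∀ s t, a ≤ s → s ≤ t → t ≤ b →
        RiemannLimit s t (germ ι SE w w2 z z' t) (ι (X s t)) ∧
        ‖X s t‖ ≤ K * N * (t-s)^γ ∧
        ‖ι (X s t) - SE (t-s) (ι (z s (w t - w s)) + ι (ctr (z' s) (w2 t s)))‖
          ≤ K * N * (t-s)^(3*γ) ∧
        ∀ r, a ≤ r → r ≤ s → X r t = SH (t-s) (X r s) + X s t := by
  have hC := S.hC
  have hγ := S.hγ1
  have hr := two_rpow_lt_one (3*γ) (by linarith)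
  have hr2 : (2:ℝ)^(1/3-γ) < 1 := Real.rpow_lt_one_of_one_lt_of_neg (by norm_num) (by linarith)
  set k0 := C^2 + C^3*(C+C^2) + C + C^2 with hk0
  have hk00 : 0 ≤ k0 := by positivity
  set c1 := 2 / (1 - (2:ℝ)^(1-3*γ)) with hc1
  set c2 := 6 / (1 - (2:ℝ)^(1/3-γ)) with hc2
  have hc10 : 0 ≤ c1 := div_nonneg (by norm_num) (by linarith)
  have hc20 : 0 ≤ c2 := div_nonneg (by norm_num) (by linarith)
  refine ⟨1 + c1*(C*k0) + c2*(C*k0) + C*(C+C*C*C), ?_, ?_⟩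
  · have : 0 ≤ c1*(C*k0) := by positivity
    have : 0 ≤ c2*(C*k0) := by positivity
    have : 0 ≤ C*(C+C*C*C) := by positivity
    linarith
  intro a b N z z' ha hb hN hz
  have g0 : ∀ t u, a ≤ u → u ≤ t → t ≤ b → germ ι SE w w2 z z' t u u = 0 := by
    intro t u h1 h2 h3
    simp [germ, S.w2_self u (by linarith) (by linarith)]
  have gd : ∀ t u m v, a ≤ u → u ≤ m → m ≤ v → v ≤ t → t ≤ b →
      ‖germ ι SE w w2 z z' t u v - germ ι SE w w2 z z' t u m - germ ι SE w w2 z z' t m v‖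
        ≤ C*k0*N*(v-u)^(3*γ) := by
    intro t u m v h1 h2 h3 h4 h5
    rw [germ_delta S z z' t u m v (by linarith) h2 h3 h4 (by linarith)]
    refine (S.SEb _ (by linarith) (by linarith) _).trans ?_
    have := err_bound S z z' a b N ha hb hz u m v h1 h2 h3 (by linarith)
    calc _ ≤ C * (k0 * N * (v-u)^(3*γ)) := by gcongr
      _ = _ := by ring
  have hJ : ∀ t, ∃ J : ℝ → E, a ≤ t → t ≤ b → ∀ u v, a ≤ u → u ≤ v → v ≤ t →
      ‖germ ι SE w w2 z z' t u v - (J v - J u)‖ ≤ c1 * (C*k0*N) * (v-u)^(3*γ) := by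
    intro t
    by_cases h : a ≤ t ∧ t ≤ b
    · obtain ⟨J, hJ⟩ := sewing a t (C*k0*N) (3*γ) (by positivity) (by linarith) h.1
        (germ ι SE w w2 z z' t) (fun u h1 h2 => g0 t u h1 h2 h.2)
        (fun u m v h1 h2 h3 h4 => gd t u m v h1 h2 h3 h4 h.2)
      exact ⟨J, fun _ _ => hJ⟩
    · exact ⟨0, fun h1 h2 => absurd ⟨h1, h2⟩ h⟩
  choose J hJ using hJ
  have hR : ∀ r s t, a ≤ r → r ≤ s → s ≤ t → t ≤ b → 
      RiemannLimit r s (germ ι SE w w2 z z' t) (J t s - J t r) := by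
    intro r s t h1 h2 h3 h4
    exact riemann_of_additive a t (c1 * (C*k0*N)) (3*γ) (by positivity) (by linarith) _ _
      (hJ t (by linarith) h4) r s h1 h2 h3
  -- lift to `H`
  have hX : ∀ s t, ∃ X : H, a ≤ s → s ≤ t → t ≤ b → ι X = J t t - J t s ∧
      ‖X‖ ≤ (c2*(C*k0) + C*(C+C*C*C)) * N * (t-s)^γ := by
    intro s t
    by_cases h : a ≤ s ∧ s < t ∧ t ≤ b
    · obtain ⟨h1, h2, h3⟩ := h
      let G : ℝ → ℝ → H := fun u v => SH (t-u) (z u (w v - w u) + ctr (z' u) (w2 v u))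
      have hG : ∀ u v, u ≤ t → ι (G u v) = germ ι SE w w2 z z' t u v := by
        intro u v hu
        simp only [G, germ]
        rw [S.comm _ (by linarith), map_add]
      obtain ⟨X, hX1, hX2⟩ := sing_sewing s t (C*k0*N) γ (by positivity) hγ S.hγ2 h2 G (by
        intro u m v e1 e2 e3 e4 e5
        have e : G u v - G u m - G m v = Sm (t-m) (err ι SE w w2 z z' u m v) := by
          apply S.inj
          rw [S.Smι _ (by linarith) (by linarith), map_sub, map_sub, hG _ _ (by linarith),
            hG _ _ (by linarith), hG _ _ (by linarith),
            germ_delta S z z' t u m v (by linarith) e2 e3 e4 (by linarith)]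
        rw [e]
        refine (S.Smb _ (by linarith) (by linarith) _).trans ?_
        have e7 := err_bound S z z' a b N ha hb hz u m v (by linarith) e2 e3 (by linarith)
        have e6 : 0 ≤ (t-m)^(-(2*γ)) := Real.rpow_nonneg (by linarith) _
        calc _ ≤ C * (t-m)^(-(2*γ)) * (k0 * N * (v-u)^(3*γ)) := by gcongr
          _ = _ := by ring)
      refine ⟨X, fun _ _ _ => ⟨?_, ?_⟩⟩
      · have t1 := riemann_dy s t h2.le _ _ (hR s t t h1 h2.le le_rfl h3)
        have t2 := (ι.continuous.tendsto X).comp hX1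
        refine tendsto_nhds_unique t2 (t1.congr fun n => ?_)
        simp only [Function.comp, map_sum]
        refine Finset.sum_congr rfl fun k hk => ?_
        have hk : k < 2^n := Finset.mem_range.1 hk
        rw [hG]
        have := dy_mono s t h2.le n k (2^n) (by omega)
        rwa [dy_last] at this
      · set p := (t-s)^γ with hp
        have hp0 : 0 ≤ p := Real.rpow_nonneg (by linarith) _
        have hpC : p ≤ C := S.hTγ _ (by linarith) (by linarith)
        have hGs : ‖G s t‖ ≤ C * (N * (C*p) + C*N*(C*p^2)) := by
          refine (S.SHb _ (by linarith) (by linarith) _).trans ?_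
          refine mul_le_mul_of_nonneg_left ?_ (by linarith)
          refine (norm_add_le _ _).trans (add_le_add ?_ ?_)
          · refine ((z s).le_opNorm _).trans ?_
            have := hz.hA s h1 (by linarith)
            have := S.wb s t (by linarith) h2.le (by linarith)
            gcongr
          · refine (ctr_norm _ _).trans ?_
            have h4 := hz.hA' s h1 (by linarith)
            have h5 := S.hd
            have h6 := S.w2b s t (by linarith) h2.le (by linarith)
            rw [rpow_dbl _ _ (by linarith)] at h6
            gcongr
        have : C * (N * (C*p) + C*N*(C*p^2)) ≤ C*(C+C*C*C) * N * p := by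
          calc _ = C * (C + C*C*p)*N*p := by ring
            _ ≤ _ := by gcongr
        have e : X = (X - G s t) + G s t := by abel
        rw [e]
        refine (norm_add_le _ _).trans ?_
        calc _ ≤ c2 * (C*k0*N) * p + C*(C+C*C*C) * N * p := by linarith
          _ = _ := by ring
    · by_cases h' : a ≤ s ∧ s = t ∧ t ≤ b
      · refine ⟨0, fun h1 h2 h3 => ?_⟩
        have : s = t := h'.2.1
        subst this
        simp [Real.zero_rpow (by linarith : γ ≠ 0)]
      · refine ⟨0, fun h1 h2 h3 => ?_⟩
        rcases h2.eq_or_lt with h4 | h4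
        · exact absurd ⟨h1, h4, h3⟩ h'
        · exact absurd ⟨h1, h4, h3⟩ h
  choose X hX using hX
  refine ⟨X, fun s t h1 h2 h3 => ?_⟩
  obtain ⟨x1, x2⟩ := hX s t h1 h2 h3
  have pp : 0 ≤ (t-s)^γ := Real.rpow_nonneg (by linarith) _
  have pp3 : 0 ≤ (t-s)^(3*γ) := Real.rpow_nonneg (by linarith) _
  refine ⟨?_, ?_, ?_, ?_⟩
  · rw [x1]; exact hR s t t h1 h2 le_rfl h3
  · refine x2.trans ?_
    gcongr
    have : 0 ≤ c1*(C*k0) := by positivity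
    linarith
  · rw [x1, norm_sub_rev]
    have := hJ t (by linarith) h3 s t h1 h2 le_rfl
    simp only [germ] at this
    refine this.trans ?_
    rw [show c1 * (C*k0*N) = c1*(C*k0)*N by ring]
    gcongr
    have : 0 ≤ c2*(C*k0) := by positivity
    have : 0 ≤ C*(C+C*C*C) := by positivity
    linarith
  · intro r h4 h5
    apply S.inj
    rw [map_add, S.comm _ (by linarith), (hX r t h4 (by linarith) h3).1, x1]
    have t1 := riemann_dy r s h5 _ _ (hR r s t h4 h5 h2 h3)
    have t2 := riemann_dy r s h5 _ _ (hR r s s h4 h5 le_rfl (by linarith))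
    rw [← (hX r s h4 h5 (by linarith)).1] at t2
    have t3 := ((SE (t-s)).continuous.tendsto _).comp t2
    have : SE (t-s) (ι (X r s)) = J t s - J t r := by
      refine tendsto_nhds_unique t3 (t1.congr fun n => ?_)
      simp only [Function.comp, map_sum]
      refine Finset.sum_congr rfl fun k hk => ?_
      have hk : k < 2^n := Finset.mem_range.1 hk
      have := dy_mono r s h5 n k (2^n) (by omega)
      rw [dy_last] at this
      simp only [germ]
      rw [← S.SEsg _ _ (by linarith) (by linarith)]
      congr 2; ring
    rw [this]; abel

end partTwo

section partThree
variable {d : ℕ} {γ T C : ℝ} {ι : H →L[ℝ] E} {SH : ℝ → H →L[ℝ] H} {SE : ℝ → E →L[ℝ] E}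
  {Sm : ℝ → E →L[ℝ] H} {w : ℝ → Fin d → ℝ} {w2 : ℝ → ℝ → Fin d → Fin d → ℝ}
theorem phi_bound (S : RSetup γ T ι SH SE Sm w w2 C) :
    ∃ K, 1 ≤ K ∧ ∀ (a b N p q : ℝ) (x0 : H) (z : ℝ → (Fin d → ℝ) →L[ℝ] H)
      (z' : ℝ → (Fin d → ℝ) →L[ℝ] (Fin d → ℝ) →L[ℝ] H) (φ y X : ℝ → H), 
      0 ≤ a → b ≤ T → 0 ≤ N → p ≤ N → 0 ≤ p → 0 ≤ q →
      CB γ a b (io d ι) w z z' N p N N → (∀ t, a ≤ t → t ≤ b → ‖φ t‖ ≤ q) →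
      (∀ t, a ≤ t → t ≤ b → IntervalIntegrable (fun u => SH (t-u) (φ u)) volume a t) →
      (∀ t, a ≤ t → t ≤ b → RiemannLimit a t (germ ι SE w w2 z z' t) (ι (X t))) →
      (∀ t, a ≤ t → t ≤ b → y t = SH (t-a) x0 + (∫ u in a..t, SH (t-u) (φ u)) + X t) →
      (∀ t, a ≤ t → t ≤ b → ‖y t‖ ≤ C * ‖x0‖ + K * (N+q) * (b-a)^γ) ∧
      (∀ s t, a ≤ s → s ≤ t → t ≤ b → ‖y t - SH (t-s) (y s)‖ ≤ K * (N+q) * (t-s)^γ) ∧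
      (∀ s t, a ≤ s → s ≤ t → t ≤ b → ‖ι (y t) - ι (y s) - ι (z s (w t - w s))‖ 
        ≤ K * (‖x0‖ + q + p + N * (b-a)^γ) * (t-s)^(2*γ)) ∧
      (∀ s t, a ≤ s → s ≤ t → t ≤ b → ∃ X' : H, 
        RiemannLimit s t (germ ι SE w w2 z z' t) (ι X') ∧ 
        y t = SH (t-s) (y s) + (∫ u in s..t, SH (t-u) (φ u)) + X') := by
  obtain ⟨K1, hK1, hI⟩ := int_lemma S
  have hC := S.hC
  have hγ := S.hγ1
  set K' := C^2 + K1 with hK'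
  have hK'0 : 0 ≤ K' := by positivity
  refine ⟨K' + (C^2 + C*K' + C^2*K' + C^2 + K1 + C^2 + C^3), ?_, ?_⟩
  · have : 0 ≤ (C^2 + C*K' + C^2*K' + C^2 + K1 + C^2 + C^3) := by positivity
    have : 0 ≤ C^2 := by positivity
    linarith
  set K2 := (C^2 + C*K' + C^2*K' + C^2 + K1 + C^2 + C^3) with hK2
  have hK20 : 0 ≤ K2 := by positivity
  intro a b N p q x0 z z' φ y X ha hb hN hpN hp hq hz hφ hint hX hy
  have hz' : CB γ a b (io d ι) w z z' N N N N := 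
    ⟨hz.hA, fun t h1 h2 => (hz.hA' t h1 h2).trans hpN, hz.hB, hz.hB'⟩
  obtain ⟨X0, hX0⟩ := hI a b N z z' ha hb hN hz'
  have hXX : ∀ t, a ≤ t → t ≤ b → X t = X0 a t := by
    intro t h1 h2
    apply S.inj
    exact riemann_unique a t h1 _ _ _ (hX t h1 h2) (hX0 a t le_rfl h1 h2).1
  have hsub : ∀ s t, a ≤ s → s ≤ t → t ≤ b → 
      IntervalIntegrable (fun u => SH (t-u) (φ u)) volume a s ∧
      IntervalIntegrable (fun u => SH (t-u) (φ u)) volume s t := by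
    intro s t h1 h2 h3
    have h := hint t (by linarith) h3
    constructor
    · refine h.mono_set ?_
      rw [uIcc_of_le h1, uIcc_of_le (by linarith)]; exact Icc_subset_Icc le_rfl h2
    · refine h.mono_set ?_
      rw [uIcc_of_le h2, uIcc_of_le (by linarith)]; exact Icc_subset_Icc h1 le_rfl
  have hstep : ∀ s t, a ≤ s → s ≤ t → t ≤ b → 
      y t = SH (t-s) (y s) + (∫ u in s..t, SH (t-u) (φ u)) + X0 s t := by
    intro s t h1 h2 h3
    rw [hy t (by linarith) h3, hy s h1 (by linarith), hXX t (by linarith) h3, 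
      hXX s h1 (by linarith), (hX0 s t h1 h2 h3).2.2.2 a le_rfl h1]
    have e1 : SH (t-a) x0 = SH (t-s) (SH (s-a) x0) := by
      rw [← S.SHsg _ _ (by linarith) (by linarith)]; congr 2; ring
    have e2 : (∫ u in a..t, SH (t-u) (φ u)) = SH (t-s) (∫ u in a..s, SH (s-u) (φ u)) 
        + ∫ u in s..t, SH (t-u) (φ u) := by
      rw [← intervalIntegral.integral_add_adjacent_intervals (hsub s t h1 h2 h3).1 
        (hsub s t h1 h2 h3).2]
      congr 1
      rw [← ContinuousLinearMap.intervalIntegral_comp_comm _ (hint s h1 (by linarith))]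
      refine intervalIntegral.integral_congr fun u hu => ?_
      rw [uIcc_of_le h1] at hu
      show SH (t-u) (φ u) = SH (t-s) (SH (s-u) (φ u))
      rw [← S.SHsg _ _ (by linarith) (by linarith [hu.2])]; congr 2; ring
    rw [e1, e2]
    simp only [map_add]
    abel
  have hib : ∀ s t, a ≤ s → s ≤ t → t ≤ b → ‖∫ u in s..t, SH (t-u) (φ u)‖ ≤ C * q * (t-s) := by
    intro s t h1 h2 h3
    have := intervalIntegral.norm_integral_le_of_norm_le_const (a := s) (b := t) 
      (f := fun u => SH (t-u) (φ u)) (C := C*q) (by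
        intro u hu
        rw [uIoc_of_le h2] at hu
        refine (S.SHb _ (by linarith [hu.2]) (by linarith [hu.1]) _).trans ?_
        have := hφ u (by linarith [hu.1]) (by linarith [hu.2])
        gcongr)
    rwa [abs_of_nonneg (by linarith)] at this
  have hinc : ∀ s t, a ≤ s → s ≤ t → t ≤ b → 
      ‖(∫ u in s..t, SH (t-u) (φ u)) + X0 s t‖ ≤ K' * (N+q) * (t-s)^γ := by
    intro s t h1 h2 h3
    refine (norm_add_le _ _).trans ?_
    have i1 := hib s t h1 h2 h3
    have i2 := (hX0 s t h1 h2 h3).2.1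
    have i3 := S.hTh (t-s) (by linarith) (by linarith)
    have i4 : 0 ≤ (t-s)^γ := Real.rpow_nonneg (by linarith) _
    have i5 : C * q * (t-s) ≤ C^2 * q * (t-s)^γ := by
      calc C * q * (t-s) ≤ C*q*(C*(t-s)^γ) := by gcongr
        _ = _ := by ring
    have i6 : K' * (N+q) * (t-s)^γ = C^2*q*(t-s)^γ + K1*N*(t-s)^γ 
      + (C^2*N*(t-s)^γ + K1*q*(t-s)^γ) := by rw [hK']; ring
    have i7 : 0 ≤ C^2*N*(t-s)^γ + K1*q*(t-s)^γ := by positivity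
    linarith
  have h1' : ∀ t, a ≤ t → t ≤ b → ‖y t‖ ≤ C * ‖x0‖ + K' * (N+q) * (b-a)^γ := by
    intro t h1 h2
    rw [hy t h1 h2, hXX t h1 h2, add_assoc]
    refine (norm_add_le _ _).trans (add_le_add (S.SHb _ (by linarith) (by linarith) _) ?_)
    refine (hinc a t le_rfl h1 h2).trans ?_
    have : (t-a)^γ ≤ (b-a)^γ := Real.rpow_le_rpow (by linarith) (by linarith) (by linarith)
    gcongr
  refine ⟨?_, ?_, ?_, ?_⟩
  · intro t h1 h2
    refine (h1' t h1 h2).trans ?_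
    have : 0 ≤ (b-a)^γ := Real.rpow_nonneg (by linarith) _
    gcongr
    linarith
  · intro s t h1 h2 h3
    rw [hstep s t h1 h2 h3, add_assoc, add_sub_cancel_left]
    refine (hinc s t h1 h2 h3).trans ?_
    have : 0 ≤ (t-s)^γ := Real.rpow_nonneg (by linarith) _
    gcongr
    linarith
  · intro s t h1 h2 h3
    set θ := (b-a)^γ with hθ
    set π := (t-s)^γ with hπ
    have hπ0 : 0 ≤ π := Real.rpow_nonneg (by linarith) _
    have hπθ : π ≤ θ := Real.rpow_le_rpow (by linarith) (by linarith) (by linarith)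
    have hθC : θ ≤ C := S.hTγ _ (by linarith) (by linarith)
    have hθ0 : 0 ≤ θ := by linarith
    have key : ι (y t) - ι (y s) - ι (z s (w t - w s)) = (SE (t-s) (ι (y s)) - ι (y s))
        + ι (∫ u in s..t, SH (t-u) (φ u)) 
        + (ι (X0 s t) - SE (t-s) (ι (z s (w t - w s)) + ι (ctr (z' s) (w2 t s))))
        + (SE (t-s) (ι (z s (w t - w s))) - ι (z s (w t - w s)))
        + SE (t-s) (ι (ctr (z' s) (w2 t s))) := by
      rw [hstep s t h1 h2 h3, map_add, map_add, S.comm _ (by linarith), map_add (SE (t-s))]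
      abel
    rw [key, rpow_dbl _ _ (by linarith), ← hπ]
    refine (norm_add_le _ _).trans ((add_le_add (norm_add₄_le) le_rfl).trans ?_)
    have b1 : ‖SE (t-s) (ι (y s)) - ι (y s)‖ ≤ C * π^2 * (C * ‖x0‖ + K' * (N+q) * θ) := by
      refine (S.shold _ (by linarith) (by linarith) _).trans ?_
      rw [rpow_dbl _ _ (by linarith)]
      have := h1' s h1 (by linarith)
      gcongr
    have b2 : ‖ι (∫ u in s..t, SH (t-u) (φ u))‖ ≤ C * q * (C * π^2) := by
      refine (S.ιle _).trans ((hib s t h1 h2 h3).trans ?_)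
      have := S.hTh2 (t-s) (by linarith) (by linarith)
      rw [rpow_dbl _ _ (by linarith)] at this
      gcongr
    have b3 : ‖ι (X0 s t) - SE (t-s) (ι (z s (w t - w s)) + ι (ctr (z' s) (w2 t s)))‖ 
        ≤ K1 * N * (θ * π^2) := by
      refine (hX0 s t h1 h2 h3).2.2.1.trans ?_
      rw [rpow_tri _ _ (by linarith), ← hπ, pow_succ' π 2]
      gcongr
    have b4 : ‖SE (t-s) (ι (z s (w t - w s))) - ι (z s (w t - w s))‖ ≤ C * π^2 * (N * (C*θ)) := by
      refine (S.shold _ (by linarith) (by linarith) _).trans ?_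
      rw [rpow_dbl _ _ (by linarith)]
      have e1 := hz.hA s h1 (by linarith)
      have e2 := (S.wb s t (by linarith) h2 (by linarith)).trans 
        (mul_le_mul_of_nonneg_left hπθ (by linarith))
      have e3 : ‖z s (w t - w s)‖ ≤ N * (C*θ) := ((z s).le_opNorm _).trans (by gcongr)
      gcongr
    have b5 : ‖SE (t-s) (ι (ctr (z' s) (w2 t s)))‖ ≤ C * (C * p * (C*π^2)) := by
      refine (S.SEb _ (by linarith) (by linarith) _).trans ?_
      refine mul_le_mul_of_nonneg_left ((S.ιle _).trans ((ctr_norm _ _).trans ?_)) (by linarith)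
      have e1 := hz.hA' s h1 (by linarith)
      have e2 := S.hd
      have e3 := S.w2b s t (by linarith) h2 (by linarith)
      rw [rpow_dbl _ _ (by linarith)] at e3
      gcongr
    set P := π^2 with hP
    have hP0 : 0 ≤ P := by positivity
    have hx0 := norm_nonneg x0
    set n0 := ‖x0‖
    have c1 : C * P * (C * n0 + K' * (N+q) * θ) 
        ≤ (C^2 * n0 + C*K'*(N*θ) + C^2*K'*q) * P := by
      have : K' * q * θ ≤ K' * q * C := by gcongr
      calc C * P * (C * n0 + K' * (N+q) * θ) = C*P*(C*n0 + K'*N*θ + K'*q*θ) := by ring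
        _ ≤ C*P*(C*n0 + K'*N*θ + K'*q*C) := by gcongr
        _ = _ := by ring
    have c2 : (C^2 * n0 + C*K'*(N*θ) + C^2*K'*q) * P + C*q*(C*P) + K1*N*(θ*P) + C*P*(N*(C*θ))
        + C*(C*p*(C*P)) = (C^2 * n0 + (C^2*K' + C^2) * q + C^3 * p + (C*K' + K1 + C^2)*(N*θ))*P := by 
      ring
    have hNθ : 0 ≤ N * θ := by positivity
    have c3 : C^2 * n0 + (C^2*K' + C^2) * q + C^3 * p + (C*K' + K1 + C^2)*(N*θ) 
        ≤ (K'+K2) * (n0 + q + p + N*θ) := by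
      have l1 : C^2 ≤ K'+K2 := by
        rw [hK']; linarith
      have l2 : C^2*K' + C^2 ≤ K'+K2 := by
        have : K2 = (C^2*K' + C^2) + (C^2+C*K'+K1+C^2+C^3) := by rw [hK2]; ring
        have : 0 ≤ C^2+C*K'+K1+C^2+C^3 := by positivity
        linarith
      have l3 : C^3 ≤ K'+K2 := by
        have : K2 = C^3 + (C^2+C*K'+K1+C^2+C^2*K'+C^2) := by rw [hK2]; ring
        have : 0 ≤ C^2+C*K'+K1+C^2+C^2*K'+C^2 := by positivity
        linarith
      have l4 : C*K' + K1 + C^2 ≤ K'+K2 := by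
        have : K2 = (C*K' + K1 + C^2) + (C^3+C^2+C^2*K'+C^2) := by rw [hK2]; ring
        have : 0 ≤ C^3+C^2+C^2*K'+C^2 := by positivity
        linarith
      calc _ ≤ (K'+K2) * n0 + (K'+K2)*q + (K'+K2)*p + (K'+K2)*(N*θ) := by gcongr
        _ = _ := by ring
    have c4 := mul_le_mul_of_nonneg_right c3 hP0
    linarith
  · intro s t h1 h2 h3
    exact ⟨X0 s t, (hX0 s t h1 h2 h3).1, hstep s t h1 h2 h3⟩

/-- continuity from mild Hölder continuity -/
theorem mild_cont (S : RSetup γ T ι SH SE Sm w w2 C) (a b K : ℝ) (hab : b - a ≤ T)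
    (y : ℝ → H) (hK : 0 ≤ K)
    (hy : ∀ s t, a ≤ s → s ≤ t → t ≤ b → ‖y t - SH (t-s) (y s)‖ ≤ K * (t-s)^γ) :
    ContinuousOn y (Icc a b) := by
  have hγ := S.hγ1
  intro t ht
  rw [ContinuousWithinAt, Metric.tendsto_nhdsWithin_nhds]
  intro ε hε
  -- a small time step
  obtain ⟨ρ, hρ0, hρ⟩ : ∃ ρ > 0, K * ρ^γ < ε/3 := by
    have h1 : Filter.Tendsto (fun r : ℝ => K * r^γ) (nhdsWithin 0 (Ioi 0)) (nhds (K * 0^γ)) :=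
      (((Real.continuous_rpow_const (by linarith : 0 ≤ γ)).tendsto 0).const_mul K).mono_left
        nhdsWithin_le_nhds
    rw [Real.zero_rpow (by linarith), mul_zero] at h1
    obtain ⟨ρ, h2, h3⟩ := ((h1.eventually (gt_mem_nhds (by linarith : 0 < ε/3))).and 
      self_mem_nhdsWithin).exists
    exact ⟨ρ, h3, h2⟩
  set r := max a (t - ρ/2) with hr
  have hra : a ≤ r := le_max_left _ _
  have hrt : r ≤ t := max_le ht.1 (by linarith)
  have hrt2 : t - ρ/2 ≤ r := le_max_right _ _
  have hc := S.SHc (y r) (t - r) (by simp; linarith)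
  rw [ContinuousWithinAt, Metric.tendsto_nhdsWithin_nhds] at hc
  obtain ⟨δ, hδ, hcδ⟩ := hc (ε/3) (by linarith)
  have hbd : ∀ s, r ≤ s → s ≤ b → s - r ≤ ρ → ‖y s - SH (s-r) (y r)‖ < ε/3 := by
    intro s h1 h2 h3
    refine (hy r s hra h1 h2).trans_lt (lt_of_le_of_lt ?_ hρ)
    exact mul_le_mul_of_nonneg_left (Real.rpow_le_rpow (by linarith) h3 (by linarith)) hK
  refine ⟨min δ (ρ/2), lt_min hδ (by linarith), fun s hs hd => ?_⟩
  rw [Real.dist_eq] at hd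
  have hd1 := hd.trans_le (min_le_left _ _)
  have hd2 := abs_lt.1 (hd.trans_le (min_le_right _ _))
  have hrs : r ≤ s := max_le hs.1 (by linarith)
  have k1 := hbd s hrs hs.2 (by linarith)
  have k2 := hbd t hrt ht.2 (by linarith)
  have k3 := @hcδ (s - r) (by simp; linarith) (by rw [Real.dist_eq]; simpa using hd1)
  rw [dist_eq_norm] at k3 ⊢
  have e : y s - y t = (y s - SH (s-r) (y r)) - (y t - SH (t-r) (y r)) 
    + (SH (s-r) (y r) - SH (t-r) (y r)) := by abel
  rw [e]
  refine (norm_add_le _ _).trans_lt ((add_le_add (norm_sub_le _ _) le_rfl).trans_lt ?_)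
  linarith

theorem conv_int (S : RSetup γ T ι SH SE Sm w w2 C) (a t : ℝ) (hat : a ≤ t) (htT : t - a ≤ T)
    (φ : ℝ → H) (hφ : ContinuousOn φ (Icc a t)) :
    IntervalIntegrable (fun u => SH (t-u) (φ u)) volume a t := by
  apply ContinuousOn.intervalIntegrable
  rw [uIcc_of_le hat]
  intro u hu
  have h1 : Filter.Tendsto (fun v => SH (t-v) (φ u)) (nhdsWithin u (Icc a t)) 
      (nhds (SH (t-u) (φ u))) := by
    have := S.SHc (φ u) (t-u) (by simpa using hu.2)
    refine this.tendsto.comp (tendsto_nhdsWithin_of_tendsto_nhds_of_eventually_within _ ?_ ?_)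
    · exact ((continuous_const.sub continuous_id).tendsto u).mono_left nhdsWithin_le_nhds
    · filter_upwards [self_mem_nhdsWithin] with v hv
      simpa using hv.2
  have h2 : Filter.Tendsto (fun v => SH (t-v) (φ v - φ u)) (nhdsWithin u (Icc a t)) (nhds 0) := by
    have h3 : Filter.Tendsto (fun v => C * ‖φ v - φ u‖) (nhdsWithin u (Icc a t)) 
        (nhds (C * ‖φ u - φ u‖)) := (((hφ u hu).tendsto.sub_const _).norm).const_mul _
    rw [sub_self, norm_zero, mul_zero] at h3
    refine squeeze_zero_norm' ?_ h3
    filter_upwards [self_mem_nhdsWithin] with v hv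
    exact S.SHb _ (by linarith [hv.2]) (by linarith [hv.1]) _
  have h4 := h2.add h1
  rw [zero_add] at h4
  refine h4.congr fun v => ?_
  rw [map_sub]; abel
end partThree

section partFour
/-- bounds on derivatives -/
structure NB {V F : Type*} [NormedAddCommGroup V] [NormedSpace ℝ V] [NormedAddCommGroup F]
    [NormedSpace ℝ F] (g : V → F) (G : ℝ) : Prop where
  hG : 1 ≤ G
  D0 : Differentiable ℝ g
  D1 : Differentiable ℝ (fderiv ℝ g)
  b1 : ∀ x, ‖fderiv ℝ g x‖ ≤ G
  b2 : ∀ x, ‖fderiv ℝ (fderiv ℝ g) x‖ ≤ G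
  l2 : ∀ x y, ‖fderiv ℝ (fderiv ℝ g) x - fderiv ℝ (fderiv ℝ g) y‖ ≤ G * ‖x - y‖

theorem lip_of {V F : Type*} [NormedAddCommGroup V] [NormedSpace ℝ V] [NormedAddCommGroup F]
    [NormedSpace ℝ F] (ψ : V → F) (L : ℝ) (h0 : Differentiable ℝ ψ) (h1 : ∀ x, ‖fderiv ℝ ψ x‖ ≤ L) 
    (x y : V) : ‖ψ x - ψ y‖ ≤ L * ‖x - y‖ :=
  Convex.norm_image_sub_le_of_norm_fderiv_le (s := univ) (fun x _ => h0 x) (fun x _ => h1 x) 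
    convex_univ (mem_univ y) (mem_univ x)

theorem NB_of {V F : Type*} [NormedAddCommGroup V] [NormedSpace ℝ V] [NormedAddCommGroup F]
    [NormedSpace ℝ F] (g : V → F) (Cg G : ℝ) (h1 : 1 ≤ G) (hG : Cg ≤ G) (hg : ContDiff ℝ 3 g)
    (hb : ∀ x, ‖iteratedFDeriv ℝ 1 g x‖ ≤ Cg ∧ ‖iteratedFDeriv ℝ 2 g x‖ ≤ Cg ∧
      ‖iteratedFDeriv ℝ 3 g x‖ ≤ Cg) : NB g G := by
  have c1 : ContDiff ℝ 2 (fderiv ℝ g) := hg.fderiv_right (by norm_num)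
  have c2 : ContDiff ℝ 1 (fderiv ℝ (fderiv ℝ g)) := c1.fderiv_right (by norm_num)
  refine ⟨h1, hg.differentiable (by norm_num), c1.differentiable (by norm_num), 
    fun x => ?_, fun x => ?_, lip_of _ _ (c2.differentiable (by norm_num)) fun x => ?_⟩
  · have := (hb x).1
    rw [norm_iteratedFDeriv_one] at this
    linarith
  · have := (hb x).2.1
    rw [← norm_iteratedFDeriv_fderiv, norm_iteratedFDeriv_one] at this
    linarith
  · have := (hb x).2.2
    rw [← norm_iteratedFDeriv_fderiv, ← norm_iteratedFDeriv_fderiv, norm_iteratedFDeriv_one] at this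
    linarith

section calc1
variable {V F : Type*} [NormedAddCommGroup V] [NormedSpace ℝ V] [NormedAddCommGroup F]
    [NormedSpace ℝ F]

theorem four_pt (ψ : V → F) (L : ℝ) (h0 : Differentiable ℝ ψ) (h1 : ∀ x, ‖fderiv ℝ ψ x‖ ≤ L) 
    (h2 : ∀ x y, ‖fderiv ℝ ψ x - fderiv ℝ ψ y‖ ≤ L * ‖x - y‖) (x x' h h' : V) : 
    ‖(ψ (x+h) - ψ x) - (ψ (x'+h') - ψ x')‖ ≤ L * ‖h - h'‖ + L * ‖x - x'‖ * ‖h'‖ := by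
  have e : (ψ (x+h) - ψ x) - (ψ (x'+h') - ψ x') = (ψ (x+h) - ψ (x+h')) + 
    ((ψ (x+h') - ψ (x'+h')) - (ψ (x+0) - ψ (x'+0))) := by simp only [add_zero]; abel
  rw [e]
  refine (norm_add_le _ _).trans (add_le_add ?_ ?_)
  · have := lip_of ψ L h0 h1 (x+h) (x+h')
    rwa [add_sub_add_left_eq_sub] at this
  · have hd : ∀ (x u : V), HasFDerivAt (fun u => ψ (x+u)) (fderiv ℝ ψ (x+u)) u := by
      intro x u
      have := (h0 (x+u)).hasFDerivAt
      exact this.comp u ((hasFDerivAt_id u).const_add x)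
    have hd2 : ∀ u, HasFDerivAt (fun u => ψ (x+u) - ψ (x'+u)) 
      (fderiv ℝ ψ (x+u) - fderiv ℝ ψ (x'+u)) u := fun u => (hd x u).sub (hd x' u)
    have := lip_of (fun u => ψ (x+u) - ψ (x'+u)) (L * ‖x-x'‖) (fun u => (hd2 u).differentiableAt) 
      (fun u => by
        rw [(hd2 u).fderiv]
        have := h2 (x+u) (x'+u)
        rwa [add_sub_add_right_eq_sub] at this) h' 0
    rwa [sub_zero] at this

theorem NB.l0 {g : V → F} {G : ℝ} (h : NB g G) (x y : V) : ‖g x - g y‖ ≤ G * ‖x - y‖ := 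
  lip_of _ _ h.D0 h.b1 x y
theorem NB.l1 {g : V → F} {G : ℝ} (h : NB g G) (x y : V) : 
    ‖fderiv ℝ g x - fderiv ℝ g y‖ ≤ G * ‖x - y‖ := lip_of _ _ h.D1 h.b2 x y
theorem NB.f0 {g : V → F} {G : ℝ} (hg : NB g G) (x x' h h' : V) : 
    ‖(g (x+h) - g x) - (g (x'+h') - g x')‖ ≤ G * ‖h - h'‖ + G * ‖x - x'‖ * ‖h'‖ := 
  four_pt _ _ hg.D0 hg.b1 hg.l1 x x' h h'
theorem NB.f1 {g : V → F} {G : ℝ} (hg : NB g G) (x x' h h' : V) : 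
    ‖(fderiv ℝ g (x+h) - fderiv ℝ g x) - (fderiv ℝ g (x'+h') - fderiv ℝ g x')‖ 
      ≤ G * ‖h - h'‖ + G * ‖x - x'‖ * ‖h'‖ := 
  four_pt _ _ hg.D1 hg.b2 hg.l2 x x' h h'

/-- second order Taylor remainder -/
def QQ (g : V → F) (x h : V) : F := g (x+h) - g x - fderiv ℝ g x h

theorem NB.q_deriv {g : V → F} {G : ℝ} (hg : NB g G) (x u : V) : 
    HasFDerivAt (QQ g x) (fderiv ℝ g (x+u) - fderiv ℝ g x) u := by
  have h1 : HasFDerivAt (fun u => g (x+u)) (fderiv ℝ g (x+u)) u := 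
    (hg.D0 (x+u)).hasFDerivAt.comp u ((hasFDerivAt_id u).const_add x)
  exact (h1.sub_const (g x)).sub (fderiv ℝ g x).hasFDerivAt

theorem NB.q {g : V → F} {G : ℝ} (hg : NB g G) (x x' h h' : V) : 
    ‖QQ g x h - QQ g x' h'‖ ≤ G * (‖h‖ + ‖h'‖) * ‖h - h'‖ + G * ‖x - x'‖ * ‖h'‖ * ‖h'‖ := by
  have hG := hg.hG
  have e : QQ g x h - QQ g x' h' = (QQ g x h - QQ g x h') + 
    ((QQ g x h' - QQ g x' h') - (QQ g x 0 - QQ g x' 0)) := by 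
    have : ∀ x, QQ g x 0 = 0 := by intro x; simp [QQ]
    rw [this, this]; abel
  rw [e]
  refine (norm_add_le _ _).trans (add_le_add ?_ ?_)
  · refine Convex.norm_image_sub_le_of_norm_hasFDerivWithin_le (s := Metric.closedBall 0 (‖h‖+‖h'‖)) 
      (fun u _ => (hg.q_deriv x u).hasFDerivWithinAt) (fun u hu => ?_) (convex_closedBall _ _) 
      (by simp) (by simp)
    rw [mem_closedBall_zero_iff] at hu
    have := hg.l1 (x+u) x
    rw [add_sub_cancel_left] at this
    refine this.trans (by gcongr)
  · have := Convex.norm_image_sub_le_of_norm_hasFDerivWithin_le (s := Metric.closedBall 0 (‖h'‖)) 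
      (f := fun u => QQ g x u - QQ g x' u) (C := G * ‖x-x'‖ * ‖h'‖) (x := 0) (y := h')
      (fun u _ => ((hg.q_deriv x u).sub (hg.q_deriv x' u)).hasFDerivWithinAt) (fun u hu => by
        rw [mem_closedBall_zero_iff] at hu
        have := hg.f1 x x' u u
        rw [sub_self, norm_zero, mul_zero, zero_add] at this
        refine this.trans ?_
        gcongr) (convex_closedBall _ _) 
      (by simp) (by simp)
    rwa [sub_zero] at this

theorem NB.q0 {g : V → F} {G : ℝ} (hg : NB g G) (x h : V) : ‖QQ g x h‖ ≤ G * ‖h‖ ^ 2 := by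
  have := hg.q x x h 0
  simp only [sub_self, norm_zero, add_zero, mul_zero, sub_zero] at this
  have e : QQ g x 0 = 0 := by simp [QQ]
  rw [e, sub_zero] at this
  linarith
end calc1

theorem comp_diff {V1 V2 V3 : Type*} [NormedAddCommGroup V1] [NormedSpace ℝ V1] 
    [NormedAddCommGroup V2] [NormedSpace ℝ V2] [NormedAddCommGroup V3] [NormedSpace ℝ V3] 
    (L L' : V2 →L[ℝ] V3) (Y Y' : V1 →L[ℝ] V2) : 
    ‖L.comp Y - L'.comp Y'‖ ≤ ‖L‖ * ‖Y - Y'‖ + ‖L - L'‖ * ‖Y'‖ := by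
  have e : L.comp Y - L'.comp Y' = L.comp (Y - Y') + (L - L').comp Y' := by
    ext x; simp
  rw [e]
  exact (norm_add_le _ _).trans (add_le_add (ContinuousLinearMap.opNorm_comp_le _ _) 
    (ContinuousLinearMap.opNorm_comp_le _ _))

theorem app_diff {V2 V3 : Type*} 
    [NormedAddCommGroup V2] [NormedSpace ℝ V2] [NormedAddCommGroup V3] [NormedSpace ℝ V3] 
    (L L' : V2 →L[ℝ] V3) (Y Y' : V2) : 
    ‖L Y - L' Y'‖ ≤ ‖L‖ * ‖Y - Y'‖ + ‖L - L'‖ * ‖Y'‖ := by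
  have e : L Y - L' Y' = L (Y - Y') + (L - L') Y' := by simp
  rw [e]
  exact (norm_add_le _ _).trans (add_le_add (ContinuousLinearMap.le_opNorm _ _) 
    (ContinuousLinearMap.le_opNorm _ _))

/-- increments of a controlled path -/
theorem CB.inc {d : ℕ} {γ a b C : ℝ} {ι : H →L[ℝ] E} {w : ℝ → Fin d → ℝ} {y : ℝ → H}
    {y' : ℝ → (Fin d → ℝ) →L[ℝ] H} {A A' B B' : ℝ} (hι : ∀ x, ‖ι x‖ ≤ ‖x‖)
    (hwb : ∀ s t, a ≤ s → s ≤ t → t ≤ b → ‖w t - w s‖ ≤ C * (t-s)^γ) (hγ : 0 ≤ γ)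
    (h : CB γ a b ι w y y' A A' B B') (hB : 0 ≤ B) (s t : ℝ) (h1 : a ≤ s) (h2 : s ≤ t) (h3 : t ≤ b) : 
    ‖ι (y t) - ι (y s)‖ ≤ (A' * C + B * (b-a)^γ) * (t-s)^γ := by
  have e : ι (y t) - ι (y s) = ι (y' s (w t - w s)) + 
    (ι (y t) - ι (y s) - ι (y' s (w t - w s))) := by abel
  rw [e]
  refine (norm_add_le _ _).trans ?_
  have i1 : ‖ι (y' s (w t - w s))‖ ≤ A' * (C * (t-s)^γ) := by
    refine (hι _).trans (((y' s).le_opNorm _).trans ?_)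
    exact mul_le_mul (h.hA' s h1 (by linarith)) (hwb s t h1 h2 h3) (norm_nonneg _) 
      ((norm_nonneg _).trans (h.hA' s h1 (by linarith)))
  have i2 := h.hB s t h1 h2 h3
  rw [rpow_dbl _ _ (by linarith)] at i2
  have i3 : (t-s)^γ ≤ (b-a)^γ := Real.rpow_le_rpow (by linarith) (by linarith) hγ
  have i4 : 0 ≤ (t-s)^γ := Real.rpow_nonneg (by linarith) _
  have i5 : B * ((t-s)^γ)^2 ≤ B * ((b-a)^γ * (t-s)^γ) := by rw [sq]; gcongr
  linarith

theorem chain_comm {K KE : Type*} [NormedAddCommGroup K] [NormedSpace ℝ K]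
    [NormedAddCommGroup KE] [NormedSpace ℝ KE] {ι : H →L[ℝ] E} {j : K →L[ℝ] KE} {gH : H → K} 
    {g : E → KE} (hH : Differentiable ℝ gH) (hE : Differentiable ℝ g) 
    (hc : ∀ x, j (gH x) = g (ι x)) (x : H) : 
    j.comp (fderiv ℝ gH x) = (fderiv ℝ g (ι x)).comp ι := by
  have h1 : HasFDerivAt (fun x => j (gH x)) (j.comp (fderiv ℝ gH x)) x := 
    j.hasFDerivAt.comp x (hH x).hasFDerivAt
  have h2 : HasFDerivAt (fun x => g (ι x)) ((fderiv ℝ g (ι x)).comp ι) x := 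
    (hE (ι x)).hasFDerivAt.comp x ι.hasFDerivAt
  have e : (fun x => j (gH x)) = fun x => g (ι x) := funext hc
  rw [e] at h1
  exact h1.unique h2
end partFour

section partFive
/-- a pair of compatible nonlinearities -/
structure GS {K KE : Type*} [NormedAddCommGroup K] [NormedSpace ℝ K]
    [NormedAddCommGroup KE] [NormedSpace ℝ KE] (ι : H →L[ℝ] E) (j : K →L[ℝ] KE) (gH : H → K) 
    (g : E → KE) (G : ℝ) : Prop where
  nH : NB gH G
  nE : NB g G
  hc : ∀ x, j (gH x) = g (ι x)

/-- derivative of the composition -/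
def dz {d : ℕ} {K : Type*} [NormedAddCommGroup K] [NormedSpace ℝ K] (gH : H → K) (y : ℝ → H) 
    (y' : ℝ → (Fin d → ℝ) →L[ℝ] H) (t : ℝ) : (Fin d → ℝ) →L[ℝ] K := 
  (fderiv ℝ gH (y t)).comp (y' t)

variable {K KE : Type*} [NormedAddCommGroup K] [NormedSpace ℝ K]
    [NormedAddCommGroup KE] [NormedSpace ℝ KE] {ι : H →L[ℝ] E} {j : K →L[ℝ] KE} {gH : H → K} 
    {g : E → KE} {G : ℝ} {d : ℕ} {γ a b C : ℝ} {w : ℝ → Fin d → ℝ}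

theorem GS.der (S : GS ι j gH g G) (y : ℝ → H) (y' : ℝ → (Fin d → ℝ) →L[ℝ] H) (t : ℝ) : 
    j.comp (dz gH y y' t) = (fderiv ℝ g (ι (y t))).comp (ι.comp (y' t)) := by
  rw [dz, ← ContinuousLinearMap.comp_assoc, chain_comm S.nH.D0 S.nE.D0 S.hc, 
    ContinuousLinearMap.comp_assoc]

theorem GS.rem (S : GS ι j gH g G) (y : ℝ → H) (y' : ℝ → (Fin d → ℝ) →L[ℝ] H) (s t : ℝ) 
    (v : Fin d → ℝ) : 
    j (gH (y t)) - j (gH (y s)) - j (dz gH y y' s v) = QQ g (ι (y s)) (ι (y t) - ι (y s)) 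
      + fderiv ℝ g (ι (y s)) (ι (y t) - ι (y s) - ι (y' s v)) := by
  have := congrArg (fun L => L v) (S.der y y' s)
  simp only [ContinuousLinearMap.comp_apply] at this
  rw [this, S.hc, S.hc, QQ, add_sub_cancel, map_sub _ _ (ι (y' s v))]
  abel

theorem comp_norm_le (hι : ∀ x, ‖ι x‖ ≤ ‖x‖) (Y : (Fin d → ℝ) →L[ℝ] H) : ‖ι.comp Y‖ ≤ ‖Y‖ :=
  ContinuousLinearMap.opNorm_le_bound _ (norm_nonneg _) fun v => (hι _).trans (Y.le_opNorm v)

theorem comp_bd (S : GS ι j gH g G) (hC : 1 ≤ C) (hι : ∀ x, ‖ι x‖ ≤ ‖x‖) (hγ : 0 ≤ γ)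
    (hθ : (b-a)^γ ≤ C) 
    (hwb : ∀ s t, a ≤ s → s ≤ t → t ≤ b → ‖w t - w s‖ ≤ C * (t-s)^γ) 
    (y : ℝ → H) (y' : ℝ → (Fin d → ℝ) →L[ℝ] H) (A A' M : ℝ) (hM : 0 ≤ M) (hA'M : A' ≤ M)
    (h : CB γ a b ι w y y' A A' M M) : 
    CB γ a b j w (fun t => gH (y t)) (dz gH y y') (‖gH 0‖ + G * A) (G * A') 
      (20*G*C^2*(1+M)^2) (20*G*C^2*(1+M)^2) := by
  have hG := S.nH.hG
  have hinc : ∀ s t, a ≤ s → s ≤ t → t ≤ b → ‖ι (y t) - ι (y s)‖ ≤ 2*C*M * (t-s)^γ := by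
    intro s t h1 h2 h3
    refine (h.inc hι hwb hγ hM s t h1 h2 h3).trans ?_
    have : 0 ≤ (t-s)^γ := Real.rpow_nonneg (by linarith) _
    refine mul_le_mul_of_nonneg_right ?_ this
    have e1 : A' * C ≤ M * C := by gcongr
    have e2 : M * (b-a)^γ ≤ M * C := by gcongr
    linarith
  refine ⟨fun t h1 h2 => ?_, fun t h1 h2 => ?_, fun s t h1 h2 h3 => ?_, fun s t h1 h2 h3 => ?_⟩
  · have := S.nH.l0 (y t) 0
    rw [sub_zero] at this
    have e := norm_le_norm_add_norm_sub' (gH (y t)) (gH 0)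
    have : G * ‖y t‖ ≤ G * A := by have := h.hA t h1 h2; gcongr
    linarith
  · refine (ContinuousLinearMap.opNorm_comp_le _ _).trans ?_
    have := h.hA' t h1 h2
    have := S.nH.b1 (y t)
    gcongr
  · rw [S.rem, rpow_dbl _ _ (by linarith)]
    have e1 := S.nE.q0 (ι (y s)) (ι (y t) - ι (y s))
    have e2 := hinc s t h1 h2 h3
    have e3 := h.hB s t h1 h2 h3
    rw [rpow_dbl _ _ (by linarith)] at e3
    have e4 := (fderiv ℝ g (ι (y s))).le_opNorm (ι (y t) - ι (y s) - ι (y' s (w t - w s)))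
    have e5 := S.nE.b1 (ι (y s))
    set π := (t-s)^γ
    have e6 : G * ‖ι (y t) - ι (y s)‖^2 ≤ G * (2*C*M*π)^2 := by gcongr
    have e7 : ‖fderiv ℝ g (ι (y s))‖ * ‖ι (y t) - ι (y s) - ι (y' s (w t - w s))‖ ≤ G * (M * π^2) := by
      gcongr
    refine (norm_add_le _ _).trans ((add_le_add (e1.trans e6) (e4.trans e7)).trans ?_)
    have hC2 : 1 ≤ C^2 := one_le_pow₀ hC
    have e8 : G * (M * π^2) ≤ C^2 * (G * (M * π^2)) := le_mul_of_one_le_left (by positivity) hC2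
    have e9 : 20*G*C^2*(1+M)^2*π^2 = G*(2*C*M*π)^2 + C^2*(G*(M*π^2)) + 
      (20*G*C^2*π^2 + 39*G*C^2*M*π^2 + 16*G*C^2*M^2*π^2) := by ring
    rw [e9]
    have : 0 ≤ 20*G*C^2*π^2 + 39*G*C^2*M*π^2 + 16*G*C^2*M^2*π^2 := by positivity
    linarith
  · rw [S.der, S.der]
    refine (comp_diff _ _ _ _).trans ?_
    have e1 := S.nE.b1 (ι (y t))
    have e2 := S.nE.l1 (ι (y t)) (ι (y s))
    have e3 := hinc s t h1 h2 h3
    have e4 := h.hB' s t h1 h2 h3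
    have e5 : ‖ι.comp (y' s)‖ ≤ M := (comp_norm_le hι _).trans ((h.hA' s h1 (by linarith)).trans hA'M)
    have hπ : 0 ≤ (t-s)^γ := Real.rpow_nonneg (by linarith) _
    set π := (t-s)^γ
    have e6 : ‖fderiv ℝ g (ι (y t))‖ * ‖ι.comp (y' t) - ι.comp (y' s)‖ ≤ G * (M * π) := by gcongr
    have e7 : ‖fderiv ℝ g (ι (y t)) - fderiv ℝ g (ι (y s))‖ * ‖ι.comp (y' s)‖ 
      ≤ (G * (2*C*M*π)) * M := by
      refine mul_le_mul (e2.trans ?_) e5 (norm_nonneg _) (by positivity)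
      gcongr
    refine (add_le_add e6 e7).trans ?_
    have hC2 : 1 ≤ C^2 := one_le_pow₀ hC
    have hC3 : C ≤ C^2 := by nlinarith
    have e8 : G * (M * π) ≤ C^2 * (G * (M * π)) := le_mul_of_one_le_left (by positivity) hC2
    have e10 : C * (2*G*M*π*M) ≤ C^2 * (2*G*M*π*M) := by gcongr
    have e9 : 20*G*C^2*(1+M)^2*π = C^2 * (G * (M * π)) + C^2 * (2*G*M*π*M) + 
      (20*G*C^2*π + 39*G*C^2*M*π + 18*G*C^2*M^2*π) := by ring
    rw [e9]
    have : 0 ≤ 20*G*C^2*π + 39*G*C^2*M*π + 18*G*C^2*M^2*π := by positivity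
    linarith

theorem comp_df (S : GS ι j gH g G) (hC : 1 ≤ C) (hι : ∀ x, ‖ι x‖ ≤ ‖x‖) (hγ : 0 ≤ γ)
    (hθ : (b-a)^γ ≤ C) 
    (hwb : ∀ s t, a ≤ s → s ≤ t → t ≤ b → ‖w t - w s‖ ≤ C * (t-s)^γ) 
    (y x : ℝ → H) (y' x' : ℝ → (Fin d → ℝ) →L[ℝ] H) (A A' n M : ℝ) (hM : 0 ≤ M) (hn : 0 ≤ n) 
    (hAn : A ≤ n) (hA'n : A' ≤ n)
    (hy : CB γ a b ι w y y' M M M M) (hx : CB γ a b ι w x x' M M M M) 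
    (h : CB γ a b ι w (fun t => y t - x t) (fun t => y' t - x' t) A A' n n) : 
    CB γ a b j w (fun t => gH (y t) - gH (x t)) (fun t => dz gH y y' t - dz gH x x' t) 
      (G * A) (20*G*C^2*(1+M)^2 * (A+A'))
      (20*G*C^2*(1+M)^2*n) (20*G*C^2*(1+M)^2*n) := by
  have hG := S.nH.hG
  have hincM : ∀ (y : ℝ → H) (y' : ℝ → (Fin d → ℝ) →L[ℝ] H), CB γ a b ι w y y' M M M M → 
      ∀ s t, a ≤ s → s ≤ t → t ≤ b → ‖ι (y t) - ι (y s)‖ ≤ 2*C*M * (t-s)^γ := by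
    intro y y' h s t h1 h2 h3
    refine (h.inc hι hwb hγ hM s t h1 h2 h3).trans ?_
    have : 0 ≤ (t-s)^γ := Real.rpow_nonneg (by linarith) _
    refine mul_le_mul_of_nonneg_right ?_ this
    have e2 : M * (b-a)^γ ≤ M * C := by gcongr
    linarith
  have hinc : ∀ s t, a ≤ s → s ≤ t → t ≤ b → 
      ‖(ι (y t) - ι (y s)) - (ι (x t) - ι (x s))‖ ≤ 2*C*n * (t-s)^γ := by
    intro s t h1 h2 h3
    have e : (ι (y t) - ι (y s)) - (ι (x t) - ι (x s)) = ι (y t - x t) - ι (y s - x s) := by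
      simp only [map_sub]; abel
    rw [e]
    refine (h.inc hι hwb hγ hn s t h1 h2 h3).trans ?_
    have : 0 ≤ (t-s)^γ := Real.rpow_nonneg (by linarith) _
    refine mul_le_mul_of_nonneg_right ?_ this
    have e1 : A' * C ≤ n * C := by gcongr
    have e2 : n * (b-a)^γ ≤ n * C := by gcongr
    linarith
  have hAA : ∀ t, a ≤ t → t ≤ b → ‖ι (y t) - ι (x t)‖ ≤ n := by
    intro t h1 h2
    rw [← map_sub]
    exact (hι _).trans ((h.hA t h1 h2).trans hAn)
  have hAA' : ∀ t, a ≤ t → t ≤ b → ‖ι.comp (y' t) - ι.comp (x' t)‖ ≤ n := by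
    intro t h1 h2
    rw [← ContinuousLinearMap.comp_sub]
    exact (comp_norm_le hι _).trans ((h.hA' t h1 h2).trans hA'n)
  have hC2 : 1 ≤ C^2 := one_le_pow₀ hC
  have hC3 : C ≤ C^2 := by nlinarith
  refine ⟨fun t h1 h2 => ?_, fun t h1 h2 => ?_, fun s t h1 h2 h3 => ?_, fun s t h1 h2 h3 => ?_⟩
  · refine (S.nH.l0 (y t) (x t)).trans ?_
    have := h.hA t h1 h2
    gcongr
  · refine (comp_diff _ _ _ _).trans ?_
    have e1 := h.hA' t h1 h2
    have e2 := S.nH.b1 (y t)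
    have e3 := (S.nH.l1 (y t) (x t)).trans (mul_le_mul_of_nonneg_left (h.hA t h1 h2) (by linarith))
    have e4 := hx.hA' t h1 h2
    have hA0 : 0 ≤ A := (norm_nonneg _).trans (h.hA t h1 h2)
    have hA'0 : 0 ≤ A' := (norm_nonneg _).trans e1
    have e5 : ‖fderiv ℝ gH (y t)‖ * ‖y' t - x' t‖ ≤ G * A' := by gcongr
    have e6 : ‖fderiv ℝ gH (y t) - fderiv ℝ gH (x t)‖ * ‖x' t‖ ≤ G * A * M := by gcongr
    refine (add_le_add e5 e6).trans ?_
    have e7 : G * A' + G*A*M ≤ C^2 * (G * A' + G*A*M) := le_mul_of_one_le_left (by positivity) hC2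
    have e9 : 20*G*C^2*(1+M)^2*(A+A') = C^2 * (G * A' + G*A*M) + 
      (20*G*C^2*A + 39*G*C^2*M*A + 20*G*C^2*M^2*A + 19*G*C^2*A' + 40*G*C^2*M*A' 
        + 20*G*C^2*M^2*A') := by ring
    rw [e9]
    have : 0 ≤ (20*G*C^2*A + 39*G*C^2*M*A + 20*G*C^2*M^2*A + 19*G*C^2*A' + 40*G*C^2*M*A' 
        + 20*G*C^2*M^2*A') := by positivity
    linarith
  · have key : j (gH (y t) - gH (x t)) - j (gH (y s) - gH (x s)) 
        - j ((dz gH y y' s - dz gH x x' s) (w t - w s)) = 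
        (QQ g (ι (y s)) (ι (y t) - ι (y s)) - QQ g (ι (x s)) (ι (x t) - ι (x s))) + 
        (fderiv ℝ g (ι (y s)) (ι (y t) - ι (y s) - ι (y' s (w t - w s))) - 
         fderiv ℝ g (ι (x s)) (ι (x t) - ι (x s) - ι (x' s (w t - w s)))) := by
      have e1 := S.rem y y' s t (w t - w s)
      have e2 := S.rem x x' s t (w t - w s)
      rw [← add_sub_add_comm, ← e1, ← e2, sub_apply]
      simp only [map_sub]
      abel
    rw [key, rpow_dbl _ _ (by linarith)]
    have e1 := S.nE.q (ι (y s)) (ι (x s)) (ι (y t) - ι (y s)) (ι (x t) - ι (x s))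
    have e2 := app_diff (fderiv ℝ g (ι (y s))) (fderiv ℝ g (ι (x s))) 
      (ι (y t) - ι (y s) - ι (y' s (w t - w s))) (ι (x t) - ι (x s) - ι (x' s (w t - w s)))
    have i1 := hincM y y' hy s t h1 h2 h3
    have i2 := hincM x x' hx s t h1 h2 h3
    have i3 := hinc s t h1 h2 h3
    have i4 := hAA s h1 (by linarith)
    have i5 := S.nE.b1 (ι (y s))
    have i6 : ‖fderiv ℝ g (ι (y s)) - fderiv ℝ g (ι (x s))‖ ≤ G * n := 
      (S.nE.l1 _ _).trans (by gcongr)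
    have i7 := hx.hB s t h1 h2 h3
    have i8 : ‖(ι (y t) - ι (y s) - ι (y' s (w t - w s))) - (ι (x t) - ι (x s) - ι (x' s (w t - w s)))‖
        ≤ n * (t-s)^(2*γ) := by
      refine le_trans (le_of_eq ?_) (h.hB s t h1 h2 h3)
      congr 1
      simp only [map_sub, sub_apply]
      abel
    rw [rpow_dbl _ _ (by linarith)] at i7 i8
    have hπ : 0 ≤ (t-s)^γ := Real.rpow_nonneg (by linarith) _
    set π := (t-s)^γ
    have k1 : G * (‖ι (y t) - ι (y s)‖ + ‖ι (x t) - ι (x s)‖) * 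
        ‖(ι (y t) - ι (y s)) - (ι (x t) - ι (x s))‖ ≤ G * (2*C*M*π + 2*C*M*π) * (2*C*n*π) := by
      gcongr
    have k2 : G * ‖ι (y s) - ι (x s)‖ * ‖ι (x t) - ι (x s)‖ * ‖ι (x t) - ι (x s)‖ 
        ≤ G * n * (2*C*M*π) * (2*C*M*π) := by gcongr
    have k3 : ‖fderiv ℝ g (ι (y s))‖ * 
        ‖(ι (y t) - ι (y s) - ι (y' s (w t - w s))) - (ι (x t) - ι (x s) - ι (x' s (w t - w s)))‖
        ≤ G * (n * π^2) := by gcongr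
    have k4 : ‖fderiv ℝ g (ι (y s)) - fderiv ℝ g (ι (x s))‖ * 
        ‖ι (x t) - ι (x s) - ι (x' s (w t - w s))‖ ≤ (G * n) * (M * π^2) := by gcongr
    refine (norm_add_le _ _).trans ((add_le_add (e1.trans (add_le_add k1 k2)) 
      (e2.trans (add_le_add k3 k4))).trans ?_)
    have e8 : G * (n * π^2) + (G * n) * (M * π^2) ≤ C^2 * (G * (n * π^2) + (G * n) * (M * π^2)) := 
      le_mul_of_one_le_left (by positivity) hC2
    have e9 : 20*G*C^2*(1+M)^2*n*π^2 = G * (2*C*M*π + 2*C*M*π) * (2*C*n*π) + 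
      G * n * (2*C*M*π) * (2*C*M*π) + C^2 * (G * (n * π^2) + (G * n) * (M * π^2)) + 
      (19*G*C^2*n*π^2 + 31*G*C^2*M*n*π^2 + 16*G*C^2*M^2*n*π^2) := by ring
    rw [e9]
    have : 0 ≤ 19*G*C^2*n*π^2 + 31*G*C^2*M*n*π^2 + 16*G*C^2*M^2*n*π^2 := by positivity
    linarith
  · have key : j.comp (dz gH y y' t - dz gH x x' t) - j.comp (dz gH y y' s - dz gH x x' s) = 
        ((fderiv ℝ g (ι (y t))).comp (ι.comp (y' t) - ι.comp (y' s)) - 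
         (fderiv ℝ g (ι (x t))).comp (ι.comp (x' t) - ι.comp (x' s))) + 
        ((fderiv ℝ g (ι (y t)) - fderiv ℝ g (ι (y s))).comp (ι.comp (y' s)) - 
         (fderiv ℝ g (ι (x t)) - fderiv ℝ g (ι (x s))).comp (ι.comp (x' s))) := by
      rw [ContinuousLinearMap.comp_sub, ContinuousLinearMap.comp_sub, S.der, S.der, S.der, S.der]
      ext v
      simp only [ContinuousLinearMap.comp_apply, sub_apply, add_apply, map_sub]
      abel
    rw [key]
    have e1 := comp_diff (fderiv ℝ g (ι (y t))) (fderiv ℝ g (ι (x t))) 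
      (ι.comp (y' t) - ι.comp (y' s)) (ι.comp (x' t) - ι.comp (x' s))
    have e2 := comp_diff (fderiv ℝ g (ι (y t)) - fderiv ℝ g (ι (y s))) 
      (fderiv ℝ g (ι (x t)) - fderiv ℝ g (ι (x s))) (ι.comp (y' s)) (ι.comp (x' s))
    have i1 := hincM y y' hy s t h1 h2 h3
    have i2 := hincM x x' hx s t h1 h2 h3
    have i3 := hinc s t h1 h2 h3
    have i4 := hAA s h1 (by linarith)
    have i5 := S.nE.b1 (ι (y t))
    have i6 : ‖fderiv ℝ g (ι (y t)) - fderiv ℝ g (ι (x t))‖ ≤ G * n := by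
      have := hAA t (by linarith) h3
      exact (S.nE.l1 _ _).trans (by gcongr)
    have i7 := hx.hB' s t h1 h2 h3
    have i8 : ‖(ι.comp (y' t) - ι.comp (y' s)) - (ι.comp (x' t) - ι.comp (x' s))‖ ≤ n * (t-s)^γ := by
      refine le_trans (le_of_eq ?_) (h.hB' s t h1 h2 h3)
      congr 1
      simp only [ContinuousLinearMap.comp_sub]
      abel
    have i9 := hAA' s h1 (by linarith)
    have i10 : ‖ι.comp (x' s)‖ ≤ M := (comp_norm_le hι _).trans (hx.hA' s h1 (by linarith))
    have i11 := S.nE.f1 (ι (y s)) (ι (x s)) (ι (y t) - ι (y s)) (ι (x t) - ι (x s))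
    rw [add_sub_cancel, add_sub_cancel] at i11
    have i12 : ‖fderiv ℝ g (ι (y t)) - fderiv ℝ g (ι (y s))‖ ≤ G * (2*C*M * (t-s)^γ) := 
      (S.nE.l1 _ _).trans (by gcongr)
    have hπ : 0 ≤ (t-s)^γ := Real.rpow_nonneg (by linarith) _
    set π := (t-s)^γ
    have i13 : G * ‖(ι (y t) - ι (y s)) - (ι (x t) - ι (x s))‖ + 
      G * ‖ι (y s) - ι (x s)‖ * ‖ι (x t) - ι (x s)‖ ≤ G * (2*C*n*π) + G * n * (2*C*M*π) := by gcongr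
    have k1 : ‖fderiv ℝ g (ι (y t))‖ * 
      ‖(ι.comp (y' t) - ι.comp (y' s)) - (ι.comp (x' t) - ι.comp (x' s))‖ ≤ G * (n * π) := by gcongr
    have k2 : ‖fderiv ℝ g (ι (y t)) - fderiv ℝ g (ι (x t))‖ * ‖ι.comp (x' t) - ι.comp (x' s)‖
      ≤ G * n * (M * π) := by gcongr
    have k3 : ‖fderiv ℝ g (ι (y t)) - fderiv ℝ g (ι (y s))‖ * ‖ι.comp (y' s) - ι.comp (x' s)‖ 
      ≤ G * (2*C*M * π) * n := by gcongr
    have k4 : ‖(fderiv ℝ g (ι (y t)) - fderiv ℝ g (ι (y s))) - 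
      (fderiv ℝ g (ι (x t)) - fderiv ℝ g (ι (x s)))‖ * ‖ι.comp (x' s)‖ ≤ 
      (G * (2*C*n*π) + G * n * (2*C*M*π)) * M := by
      refine mul_le_mul (i11.trans i13) i10 (norm_nonneg _) (by positivity)
    refine (norm_add_le _ _).trans ((add_le_add (e1.trans (add_le_add k1 k2)) 
      (e2.trans (add_le_add k3 k4))).trans ?_)
    have e8 : G * (n * π) + G * n * (M * π) ≤ C^2 * (G * (n * π) + (G * n) * (M * π)) := 
      le_mul_of_one_le_left (by positivity) hC2
    have e10 : C * (4*G*M*π*n + 2*G*M*M*π*n) ≤ C^2 * (4*G*M*π*n + 2*G*M*M*π*n) := by gcongr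
    have e9 : 20*G*C^2*(1+M)^2*n*π = C^2 * (G * (n * π) + (G * n) * (M * π)) + 
      C^2 * (4*G*M*π*n + 2*G*M*M*π*n) +
      (19*G*C^2*n*π + 35*G*C^2*M*n*π + 18*G*C^2*M^2*n*π) := by ring
    rw [e9]
    have : 0 ≤ 19*G*C^2*n*π + 35*G*C^2*M*n*π + 18*G*C^2*M^2*n*π := by positivity
    linarith
end partFive

section partSix
/-- one Picard step -/
def Stp {d : ℕ} (a b : ℝ) (ι : H →L[ℝ] E) (SH : ℝ → H →L[ℝ] H)
    (SE : ℝ → E →L[ℝ] E) (w : ℝ → Fin d → ℝ) (w2 : ℝ → ℝ → Fin d → Fin d → ℝ)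
    (fH : H → H) (gH : H → (Fin d → ℝ) →L[ℝ] H) (x0 : H) (y : ℝ → H) 
    (y' : ℝ → (Fin d → ℝ) →L[ℝ] H) (Y : ℝ → H) : Prop := 
  ∀ t, a ≤ t → t ≤ b → IntervalIntegrable (fun u => SH (t-u) (fH (y u))) volume a t ∧ 
    ∃ X : H, RiemannLimit a t (germ ι SE w w2 (fun t => gH (y t)) (dz gH y y') t) (ι X) ∧ 
      Y t = SH (t-a) x0 + (∫ u in a..t, SH (t-u) (fH (y u))) + X

variable {d : ℕ} {γ T C : ℝ} {ι : H →L[ℝ] E} {SH : ℝ → H →L[ℝ] H} {SE : ℝ → E →L[ℝ] E}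
  {Sm : ℝ → E →L[ℝ] H} {w : ℝ → Fin d → ℝ} {w2 : ℝ → ℝ → Fin d → Fin d → ℝ}

theorem germ_sub (z x : ℝ → (Fin d → ℝ) →L[ℝ] H)
    (z' x' : ℝ → (Fin d → ℝ) →L[ℝ] (Fin d → ℝ) →L[ℝ] H) (t u v : ℝ) : 
    germ ι SE w w2 z z' t u v - germ ι SE w w2 x x' t u v = 
      germ ι SE w w2 (fun t => z t - x t) (fun t => z' t - x' t) t u v := by
  simp only [germ, ctr_sub, sub_apply, map_sub, map_add]
  abel

set_option maxHeartbeats 1000000 in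
theorem contr (S : RSetup γ T ι SH SE Sm w w2 C) {gH : H → (Fin d → ℝ) →L[ℝ] H} 
    {g : E → (Fin d → ℝ) →L[ℝ] E} {G : ℝ} (hg : GS ι (io d ι) gH g G) {fH : H → H} {L : ℝ} 
    (hL : 0 ≤ L) (hf : ∀ x y, ‖fH x - fH y‖ ≤ L * ‖x - y‖) (M : ℝ) (hM : 0 ≤ M) : 
    ∃ l δ : ℝ, 1 ≤ l ∧ 0 < δ ∧ ∀ (a b n : ℝ) (x0 : H) (y x : ℝ → H) 
      (y' x' : ℝ → (Fin d → ℝ) →L[ℝ] H) (Y X : ℝ → H), 0 ≤ a → b ≤ T → (b-a)^γ ≤ δ → 0 ≤ n → 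
      CB γ a b ι w y y' M M M M → CB γ a b ι w x x' M M M M → 
      CB γ a b ι w (fun t => y t - x t) (fun t => y' t - x' t) (n/l^2) (n/l) n n → 
      Stp a b ι SH SE w w2 fH gH x0 y y' Y → Stp a b ι SH SE w w2 fH gH x0 x x' X → 
      CB γ a b ι w (fun t => Y t - X t) (fun t => gH (y t) - gH (x t)) (n/2/l^2) (n/2/l) (n/2) (n/2) := by
  obtain ⟨K, hK1, hΦ⟩ := phi_bound S
  have hC := S.hC
  have hG := hg.nH.hG
  have hγ : 0 ≤ γ := by linarith [S.hγ1]
  set c1 := 20*G*C^2*(1+M)^2 with hc1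
  have hC2 : 1 ≤ C^2 := one_le_pow₀ hC
  have hM2 : 1 ≤ (1+M)^2 := one_le_pow₀ (by linarith)
  have hGc1 : G ≤ c1 := by
    have : G * 1 * 1 ≤ 20 * G * C^2 * (1+M)^2 := by
      have : G ≤ 20*G := by linarith
      gcongr
    linarith
  set c := K*(2*c1+L) + 2*G*C*M + G*C + G with hc
  have hc10 : 0 ≤ c1 := by linarith
  have t1 : 0 ≤ K*(2*c1+L) := by positivity
  have t2 : 0 ≤ 2*G*C*M := by positivity
  have t3 : 0 ≤ G*C := by positivity
  have hcG : G ≤ c := by linarith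
  have hc1' : 1 ≤ c := by linarith
  have hc0 : 0 < c := by linarith
  refine ⟨4*c, 1/(32*c^3), by linarith, by positivity, ?_⟩
  intro a b n x0 y x y' x' Y X ha hb hδ hn hy hx hd hY hX
  by_cases hab : a ≤ b
  swap
  · exact ⟨fun t h1 h2 => absurd (h1.trans h2) hab, fun t h1 h2 => absurd (h1.trans h2) hab, 
      fun s t h1 h2 h3 => absurd (h1.trans (h2.trans h3)) hab, 
      fun s t h1 h2 h3 => absurd (h1.trans (h2.trans h3)) hab⟩
  have hθ0 : 0 ≤ (b-a)^γ := Real.rpow_nonneg (by linarith) _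
  have hθC : (b-a)^γ ≤ C := S.hTγ _ (by linarith) (by linarith)
  set θ := (b-a)^γ with hθ
  set A := n/(4*c)^2 with hA
  set A' := n/(4*c) with hA'
  have hA0 : 0 ≤ A := by positivity
  have hA'0 : 0 ≤ A' := by positivity
  have h4c : (1:ℝ) ≤ 4*c := by linarith
  have hA'n : A' ≤ n := div_le_self hn h4c
  have hAA' : A ≤ A' := by
    rw [hA, hA']
    gcongr
    nlinarith
  have hcA' : c * A' = n/4 := by rw [hA']; field_simp
  have hcA : c * A = A'/4 := by rw [hA', hA]; field_simp
  have hcθ : c * θ ≤ 1/(32*c^2) := by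
    calc c * θ ≤ c * (1/(32*c^3)) := by gcongr
      _ = _ := by field_simp
  have hcθA : c * n * θ ≤ A/2 := by
    calc c*n*θ = n * (c * θ) := by ring
      _ ≤ n * (1/(32*c^2)) := by gcongr
      _ = A/2 := by rw [hA]; field_simp; ring_nf
  have hwb : ∀ s t, a ≤ s → s ≤ t → t ≤ b → ‖w t - w s‖ ≤ C * (t-s)^γ := 
    fun s t h1 h2 h3 => S.wb s t (by linarith) h2 (by linarith)
  have hz := comp_df hg hC S.ιle hγ hθC hwb y x y' x' A A' n M hM hn (hAA'.trans hA'n) hA'n hy hx hd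
  rw [← hc1] at hz
  have hz2 : CB γ a b (io d ι) w (fun t => gH (y t) - gH (x t)) (fun t => dz gH y y' t - dz gH x x' t) 
      (2*c1*n) (c1*(A+A')) (2*c1*n) (2*c1*n) := by
    have hcn : 0 ≤ c1*n := by positivity
    refine ⟨fun t h1 h2 => (hz.hA t h1 h2).trans ?_, hz.hA', fun s t h1 h2 h3 => 
      (hz.hB s t h1 h2 h3).trans ?_, fun s t h1 h2 h3 => (hz.hB' s t h1 h2 h3).trans ?_⟩
    · have : G * A ≤ c1 * n := by have := hAA'.trans hA'n; gcongr
      linarith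
    · have : 0 ≤ (t-s)^(2*γ) := Real.rpow_nonneg (by linarith) _
      gcongr; linarith
    · have : 0 ≤ (t-s)^γ := Real.rpow_nonneg (by linarith) _
      gcongr; linarith
  choose! hYi X1 hX1 hYe using hY
  choose! hXi X2 hX2 hXe using hX
  obtain ⟨r1, r2, r3, -⟩ := hΦ a b (2*c1*n) (c1*(A+A')) (L*A) 0 (fun t => gH (y t) - gH (x t)) 
    (fun t => dz gH y y' t - dz gH x x' t) (fun t => fH (y t) - fH (x t)) (fun t => Y t - X t) 
    (fun t => X1 t - X2 t) ha hb (by positivity) 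
    (by have : c1 * (A + A') ≤ c1 * (n+n) := by gcongr; exact hAA'.trans hA'n
        linarith) (by positivity) (by positivity) hz2 
    (fun t h1 h2 => (hf _ _).trans (by have := hd.hA t h1 h2; gcongr)) 
    (fun t h1 h2 => by
      have := (hYi t h1 h2).sub (hXi t h1 h2)
      simpa only [map_sub] using this) 
    (fun t h1 h2 => by
      rw [map_sub]
      exact riemann_congr _ _ _ _ _ (riemann_sub _ _ _ _ _ _ (hX1 t h1 h2) (hX2 t h1 h2)) 
        (fun u v _ _ _ => germ_sub _ _ _ _ _ _ _)) 
    (fun t h1 h2 => by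
      have := intervalIntegral.integral_sub (hYi t h1 h2) (hXi t h1 h2)
      simp only [map_sub, map_zero, zero_add]
      rw [this, hYe t h1 h2, hXe t h1 h2]
      abel)
  have hKc : K*(2*c1+L) ≤ c := by linarith
  refine ⟨fun t h1 h2 => ?_, fun t h1 h2 => ?_, fun s t h1 h2 h3 => ?_, fun s t h1 h2 h3 => ?_⟩
  · refine (r1 t h1 h2).trans ?_
    rw [norm_zero, mul_zero, zero_add]
    have e : L * A ≤ L * n := by have := hAA'.trans hA'n; gcongr
    calc K * (2*c1*n + L*A) * θ ≤ K * (2*c1*n + L*n) * θ := by gcongr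
      _ = K*(2*c1+L) * n * θ := by ring
      _ ≤ c * n * θ := by gcongr
      _ ≤ A/2 := hcθA
      _ = _ := by rw [hA]; ring
  · refine (hg.nH.l0 _ _).trans ?_
    have := hd.hA t h1 h2
    calc G * ‖y t - x t‖ ≤ c * A := by gcongr
      _ = A'/4 := hcA
      _ ≤ A'/2 := by linarith
      _ = _ := by rw [hA']; ring
  · refine (r3 s t h1 h2 h3).trans ?_
    have : 0 ≤ (t-s)^(2*γ) := Real.rpow_nonneg (by linarith) _
    refine mul_le_mul_of_nonneg_right ?_ this
    rw [norm_zero, zero_add]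
    calc K * (L*A + c1*(A+A') + 2*c1*n*θ) ≤ K * (L*A' + c1*(A'+A') + 2*c1*n*θ) := by gcongr
      _ = K*(2*c1+L) * A' + K*(2*c1+0)*n*θ := by ring
      _ ≤ K*(2*c1+L) * A' + K*(2*c1+L)*n*θ := by gcongr
      _ ≤ c * A' + c*n*θ := by gcongr
      _ ≤ n/4 + A/2 := by linarith
      _ ≤ n/2 := by
        have : c * A ≤ n/4 := by linarith
        have : A ≤ c * A := le_mul_of_one_le_left hA0 hc1'
        linarith
  · have hπ : 0 ≤ (t-s)^γ := Real.rpow_nonneg (by linarith) _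
    have e1 := hd.inc S.ιle hwb hγ hn s t h1 h2 h3
    have e2 := hx.inc S.ιle hwb hγ hM s t h1 h2 h3
    have e3 := hg.nE.f0 (ι (y s)) (ι (x s)) (ι (y t) - ι (y s)) (ι (x t) - ι (x s))
    rw [add_sub_cancel, add_sub_cancel] at e3
    have e4 : ι.comp (gH (y t) - gH (x t)) - ι.comp (gH (y s) - gH (x s)) = 
        (g (ι (y t)) - g (ι (y s))) - (g (ι (x t)) - g (ι (x s))) := by
      rw [← hg.hc, ← hg.hc, ← hg.hc, ← hg.hc]
      simp only [io, ContinuousLinearMap.compL_apply, ContinuousLinearMap.comp_sub]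
      abel
    rw [e4]
    refine e3.trans ?_
    have e5 : ι (y t) - ι (y s) - (ι (x t) - ι (x s)) = ι (y t - x t) - ι (y s - x s) := by
      simp only [map_sub]; abel
    rw [e5, ← map_sub ι (y s)]
    have e6 : ‖ι (y s - x s)‖ ≤ A := (S.ιle _).trans (hd.hA s h1 (by linarith))
    rw [← hθ] at e1 e2
    set π := (t-s)^γ
    have e7 : ‖ι (x t) - ι (x s)‖ ≤ (M*C + M*C)*π := e2.trans (by gcongr)
    calc G * ‖ι (y t - x t) - ι (y s - x s)‖ + G * ‖ι (y s - x s)‖ * ‖ι (x t) - ι (x s)‖ 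
        ≤ G * ((A' * C + n * θ) * π) + G * A * ((M*C+M*C)*π) := by gcongr
      _ ≤ G * ((A' * C + n * θ) * π) + G * A' * ((M*C+M*C)*π) := by gcongr
      _ = ((G*C + 2*G*C*M)*A' + G*n*θ) * π := by ring
      _ ≤ (c*A' + c*n*θ) * π := by gcongr; linarith
      _ ≤ (n/4 + A/2) * π := by gcongr; linarith
      _ ≤ n/2*π := by
        have : c * A ≤ n/4 := by linarith
        have : A ≤ c * A := le_mul_of_one_le_left hA0 hc1'
        gcongr
        linarith
end partSix

section partSeven
section cbgen
variable {K KE : Type*} [NormedAddCommGroup K] [NormedSpace ℝ K]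
    [NormedAddCommGroup KE] [NormedSpace ℝ KE] {j : K →L[ℝ] KE} {d : ℕ} {γ a b : ℝ} 
    {w : ℝ → Fin d → ℝ} {y x : ℝ → K} {y' x' : ℝ → (Fin d → ℝ) →L[ℝ] K}

theorem CB.mono {A A' B B' A1 A1' B1 B1' : ℝ} (h : CB γ a b j w y y' A A' B B') (h1 : A ≤ A1) 
    (h2 : A' ≤ A1') (h3 : B ≤ B1) (h4 : B' ≤ B1') : CB γ a b j w y y' A1 A1' B1 B1' := 
  ⟨fun t i1 i2 => (h.hA t i1 i2).trans h1, fun t i1 i2 => (h.hA' t i1 i2).trans h2, 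
    fun s t i1 i2 i3 => (h.hB s t i1 i2 i3).trans 
      (mul_le_mul_of_nonneg_right h3 (Real.rpow_nonneg (by linarith) _)), 
    fun s t i1 i2 i3 => (h.hB' s t i1 i2 i3).trans 
      (mul_le_mul_of_nonneg_right h4 (Real.rpow_nonneg (by linarith) _))⟩

theorem CB.restrict {A A' B B' a1 b1 : ℝ} (h : CB γ a b j w y y' A A' B B') (h1 : a ≤ a1) 
    (h2 : b1 ≤ b) : CB γ a1 b1 j w y y' A A' B B' := 
  ⟨fun t i1 i2 => h.hA t (by linarith) (by linarith), fun t i1 i2 => h.hA' t (by linarith) (by linarith), 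
    fun s t i1 i2 i3 => h.hB s t (by linarith) i2 (by linarith), 
    fun s t i1 i2 i3 => h.hB' s t (by linarith) i2 (by linarith)⟩

theorem CB.sub {A A' B B' A1 A1' B1 B1' : ℝ} (h : CB γ a b j w y y' A A' B B') 
    (h2 : CB γ a b j w x x' A1 A1' B1 B1') : 
    CB γ a b j w (fun t => y t - x t) (fun t => y' t - x' t) (A+A1) (A'+A1') (B+B1) (B'+B1') := by
  refine ⟨fun t i1 i2 => (norm_sub_le _ _).trans (add_le_add (h.hA t i1 i2) (h2.hA t i1 i2)), 
    fun t i1 i2 => (norm_sub_le _ _).trans (add_le_add (h.hA' t i1 i2) (h2.hA' t i1 i2)), 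
    fun s t i1 i2 i3 => ?_, fun s t i1 i2 i3 => ?_⟩
  · have e : j (y t - x t) - j (y s - x s) - j ((y' s - x' s) (w t - w s)) = 
      (j (y t) - j (y s) - j (y' s (w t - w s))) - (j (x t) - j (x s) - j (x' s (w t - w s))) := by
      simp only [sub_apply, map_sub]; abel
    rw [e, add_mul]
    exact (norm_sub_le _ _).trans (add_le_add (h.hB s t i1 i2 i3) (h2.hB s t i1 i2 i3))
  · have e : j.comp (y' t - x' t) - j.comp (y' s - x' s) = 
      (j.comp (y' t) - j.comp (y' s)) - (j.comp (x' t) - j.comp (x' s)) := by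
      simp only [ContinuousLinearMap.comp_sub]; abel
    rw [e, add_mul]
    exact (norm_sub_le _ _).trans (add_le_add (h.hB' s t i1 i2 i3) (h2.hB' s t i1 i2 i3))
end cbgen

variable {d : ℕ} {γ T C : ℝ} {ι : H →L[ℝ] E} {SH : ℝ → H →L[ℝ] H} {SE : ℝ → E →L[ℝ] E}
  {Sm : ℝ → E →L[ℝ] H} {w : ℝ → Fin d → ℝ} {w2 : ℝ → ℝ → Fin d → Fin d → ℝ}
variable {gH : H → (Fin d → ℝ) →L[ℝ] H} {g : E → (Fin d → ℝ) →L[ℝ] E} {G : ℝ} {fH : H → H} {L : ℝ}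

theorem uniq_short (S : RSetup γ T ι SH SE Sm w w2 C) (hg : GS ι (io d ι) gH g G) 
    (hL : 0 ≤ L) (hf : ∀ x y, ‖fH x - fH y‖ ≤ L * ‖x - y‖) (M : ℝ) (hM : 0 ≤ M) : 
    ∃ δ : ℝ, 0 < δ ∧ ∀ (a b : ℝ) (x0 : H) (y x : ℝ → H), 0 ≤ a → b ≤ T → (b-a)^γ ≤ δ → 
      CB γ a b ι w y (fun t => gH (y t)) M M M M → CB γ a b ι w x (fun t => gH (x t)) M M M M → 
      Stp a b ι SH SE w w2 fH gH x0 y (fun t => gH (y t)) y → 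
      Stp a b ι SH SE w w2 fH gH x0 x (fun t => gH (x t)) x → 
      ∀ t, a ≤ t → t ≤ b → y t = x t := by
  obtain ⟨l, δ, hl, hδ, h⟩ := contr S hg hL hf M hM
  refine ⟨δ, hδ, ?_⟩
  intro a b x0 y x ha hb hab hy hx hY hX t ht1 ht2
  have hl0 : 0 < l := by linarith
  have h0 : CB γ a b ι w (fun t => y t - x t) (fun t => gH (y t) - gH (x t)) 
      (2*M*l^2/l^2) (2*M*l^2/l) (2*M*l^2) (2*M*l^2) := by
    have hl2 : 1 ≤ l^2 := one_le_pow₀ hl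
    have e : 2*M ≤ 2*M*l^2 := le_mul_of_one_le_right (by linarith) hl2
    refine (hy.sub hx).mono ?_ ?_ ?_ ?_
    · rw [mul_div_cancel_right₀ _ (by positivity)]; linarith
    · have : 2*M*l^2/l = 2*M*l := by field_simp
      rw [this]
      have : 2*M ≤ 2*M*l := le_mul_of_one_le_right (by linarith) hl
      linarith
    · linarith
    · linarith
  have hk : ∀ k : ℕ, CB γ a b ι w (fun t => y t - x t) (fun t => gH (y t) - gH (x t)) 
      (2*M*l^2*(1/2)^k/l^2) (2*M*l^2*(1/2)^k/l) (2*M*l^2*(1/2)^k) (2*M*l^2*(1/2)^k) := by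
    intro k
    induction k with
    | zero => simpa using h0
    | succ k ih =>
      have := h a b (2*M*l^2*(1/2)^k) x0 y x _ _ y x ha hb hab (by positivity) hy hx ih hY hX
      have e : 2*M*l^2*(1/2)^(k+1) = 2*M*l^2*(1/2)^k/2 := by ring
      rw [e]
      exact this
  have hlim : Filter.Tendsto (fun k : ℕ => 2*M*l^2*(1/2:ℝ)^k/l^2) Filter.atTop (nhds 0) := by
    have := (tendsto_pow_atTop_nhds_zero_of_lt_one (r := (1/2:ℝ)) (by norm_num) (by norm_num)).const_mul (2*M*l^2)
    have := this.div_const (l^2)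
    simpa using this
  have : ‖y t - x t‖ ≤ 0 := ge_of_tendsto' hlim fun k => (hk k).hA t ht1 ht2
  exact sub_eq_zero.1 (norm_le_zero_iff.1 this)

/-- bounds of the image -/
theorem stp_facts (S : RSetup γ T ι SH SE Sm w w2 C) (hg : GS ι (io d ι) gH g G) 
    (hL : 0 ≤ L) (hf : ∀ x y, ‖fH x - fH y‖ ≤ L * ‖x - y‖) : 
    ∃ K, 1 ≤ K ∧ ∀ (a b M A A' : ℝ) (x0 : H) (y : ℝ → H) (y' : ℝ → (Fin d → ℝ) →L[ℝ] H) (Y : ℝ → H), 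
      0 ≤ a → a ≤ b → b ≤ T → 0 ≤ M → A ≤ M → A' ≤ M → CB γ a b ι w y y' A A' M M → 
      Stp a b ι SH SE w w2 fH gH x0 y y' Y → ∃ N, 0 ≤ N ∧ 
       N = ‖gH 0‖ + G * M + 20*G*C^2*(1+M)^2 + ‖fH 0‖ + L * M ∧ 
      (∀ t, a ≤ t → t ≤ b → ‖Y t‖ ≤ C * ‖x0‖ + K * N * (b-a)^γ) ∧
      (∀ s t, a ≤ s → s ≤ t → t ≤ b → ‖Y t - SH (t-s) (Y s)‖ ≤ K * N * (t-s)^γ) ∧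
      (∀ s t, a ≤ s → s ≤ t → t ≤ b → ‖ι (Y t) - ι (Y s) - ι (gH (y s) (w t - w s))‖ 
        ≤ K * (‖x0‖ + (‖fH 0‖ + L * A) + G*A' + N * (b-a)^γ) * (t-s)^(2*γ)) ∧ 
      (∀ s, a ≤ s → Stp s b ι SH SE w w2 fH gH (Y s) y y' Y) := by
  obtain ⟨K, hK, hΦ⟩ := phi_bound S
  have hC := S.hC
  have hG := hg.nH.hG
  have hγ : 0 ≤ γ := by linarith [S.hγ1]
  refine ⟨K, hK, ?_⟩
  intro a b M A A' x0 y y' Y ha hab hb hM hAM hA'M hy hY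
  have hA0 : 0 ≤ A := (norm_nonneg _).trans (hy.hA a le_rfl hab)
  have hA'0 : 0 ≤ A' := (norm_nonneg _).trans (hy.hA' a le_rfl hab)
  have hN : 0 ≤ ‖gH 0‖ + G * M + 20*G*C^2*(1+M)^2 + ‖fH 0‖ + L * M := by positivity
  refine ⟨_, hN, rfl, ?_⟩
  have hwb : ∀ s t, a ≤ s → s ≤ t → t ≤ b → ‖w t - w s‖ ≤ C * (t-s)^γ := 
    fun s t h1 h2 h3 => S.wb s t (by linarith) h2 (by linarith)
  have hz := comp_bd hg hC S.ιle hγ (S.hTγ _ (by linarith) (by linarith)) hwb y y' A A' M hM hA'M hy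
  set N1 := ‖gH 0‖ + G * M + 20*G*C^2*(1+M)^2 with hN1
  have p1 : 0 ≤ 20*G*C^2*(1+M)^2 := by positivity
  have p2 : 0 ≤ G*M := by positivity
  have p3 : 0 ≤ ‖gH 0‖ := norm_nonneg _
  have p4 : G * A ≤ G * M := by gcongr
  have p5 : G * A' ≤ G * M := by gcongr
  have p6 : 0 ≤ ‖fH 0‖ := norm_nonneg _
  have p7 : 0 ≤ L * M := by positivity
  have p8 : L * A ≤ L * M := by gcongr
  have p9 : 0 ≤ L * A := by positivity
  have hz1 := hz.mono (A1 := N1) (A1' := G*A') (B1 := N1) (B1' := N1) (by linarith) le_rfl 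
    (by linarith) (by linarith)
  have hY0 := hY
  choose! hYi X1 hX1 hYe using hY
  obtain ⟨r1, r2, r3, r4⟩ := hΦ a b N1 (G*A') (‖fH 0‖ + L*A) x0 (fun t => gH (y t)) (dz gH y y') 
    (fun t => fH (y t)) Y X1 ha hb (by linarith) (by linarith) (by positivity) (by linarith) hz1 
    (fun t h1 h2 => by
      have e1 := hf (y t) 0
      rw [sub_zero] at e1
      have e2 := norm_le_norm_add_norm_sub' (fH (y t)) (fH 0)
      have : L * ‖y t‖ ≤ L * A := by have := hy.hA t h1 h2; gcongr
      linarith) 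
    hYi hX1 hYe
  have hK0 : 0 ≤ K := by linarith
  have hNe : N1 + (‖fH 0‖ + L*A) ≤ N1 + ‖fH 0‖ + L * M := by linarith
  have hNe2 : N1 ≤ N1 + ‖fH 0‖ + L * M := by linarith
  refine ⟨fun t h1 h2 => (r1 t h1 h2).trans ?_, fun s t h1 h2 h3 => (r2 s t h1 h2 h3).trans ?_, 
    fun s t h1 h2 h3 => (r3 s t h1 h2 h3).trans ?_, fun s hs t h1 h2 => ?_⟩
  · have : 0 ≤ (b-a)^γ := Real.rpow_nonneg (by linarith) _
    gcongr
  · have : 0 ≤ (t-s)^γ := Real.rpow_nonneg (by linarith) _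
    gcongr
  · have : 0 ≤ (b-a)^γ := Real.rpow_nonneg (by linarith) _
    have : 0 ≤ (t-s)^(2*γ) := Real.rpow_nonneg (by linarith) _
    gcongr
  · refine ⟨?_, r4 s t hs h1 h2⟩
    refine (hYi t (by linarith) h2).mono_set ?_
    rw [uIcc_of_le h1, uIcc_of_le (by linarith)]; exact Icc_subset_Icc hs le_rfl

theorem uniq_long (S : RSetup γ T ι SH SE Sm w w2 C) (hg : GS ι (io d ι) gH g G) 
    (hL : 0 ≤ L) (hf : ∀ x y, ‖fH x - fH y‖ ≤ L * ‖x - y‖) (M : ℝ) (hM : 0 ≤ M) 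
    (b : ℝ) (hb : b ≤ T) (x0 : H) (y x : ℝ → H) 
    (hy : CB γ 0 b ι w y (fun t => gH (y t)) M M M M) (hx : CB γ 0 b ι w x (fun t => gH (x t)) M M M M)
    (hY : Stp 0 b ι SH SE w w2 fH gH x0 y (fun t => gH (y t)) y) 
    (hX : Stp 0 b ι SH SE w w2 fH gH x0 x (fun t => gH (x t)) x) (t : ℝ) (h0 : 0 ≤ t) (h1 : t ≤ b)
    (hy0 : y 0 = x 0) : y t = x t := by
  obtain ⟨δ, hδ, hu⟩ := uniq_short (fH := fH) S hg hL hf M hM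
  obtain ⟨K, hK, hs⟩ := stp_facts (fH := fH) S hg hL hf
  have hγ : 0 < γ := by linarith [S.hγ1]
  set ε := δ^(1/γ) with hε
  have hε0 : 0 < ε := Real.rpow_pos_of_pos hδ _
  have hεδ : ε^γ = δ := by
    rw [hε, ← Real.rpow_mul hδ.le, one_div_mul_cancel hγ.ne', Real.rpow_one]
  have key : ∀ k : ℕ, ∀ t, 0 ≤ t → t ≤ b → t ≤ k * ε → y t = x t := by
    intro k
    induction k with
    | zero =>
      intro t h0 h1 h2
      have : t = 0 := le_antisymm (by simpa using h2) h0
      rw [this, hy0]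
    | succ k ih =>
      intro t h0 h1 h2
      by_cases h3 : t ≤ k*ε
      · exact ih t h0 h1 h3
      push Not at h3
      have ha0 : 0 ≤ k*ε := by positivity
      have hya : y (k*ε) = x (k*ε) := ih _ ha0 (by linarith) le_rfl
      push_cast at h2
      obtain ⟨N, -, -, -, -, -, q1⟩ := hs 0 b M M M x0 y _ y le_rfl (by linarith) hb hM le_rfl le_rfl hy hY
      obtain ⟨N', -, -, -, -, -, q2⟩ := hs 0 b M M M x0 x _ x le_rfl (by linarith) hb hM le_rfl le_rfl hx hX
      have q1 := q1 (k*ε) ha0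
      have q2 := q2 (k*ε) ha0
      rw [← hya] at q2
      refine hu (k*ε) t (y (k*ε)) y x ha0 (by linarith) ?_ (hy.restrict ha0 h1) (hx.restrict ha0 h1) 
        (fun s i1 i2 => q1 s i1 (by linarith)) (fun s i1 i2 => q2 s i1 (by linarith)) t h3.le le_rfl
      rw [← hεδ]
      exact Real.rpow_le_rpow (by linarith) (by linarith) hγ.le
  obtain ⟨k, hk⟩ := exists_nat_ge (t/ε)
  exact key k t h0 h1 ((div_le_iff₀ hε0).1 hk)
end partSeven

section partEight
open Filter Topology
theorem CB.limit {K KE : Type*} [NormedAddCommGroup K] [NormedSpace ℝ K]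
    [NormedAddCommGroup KE] [NormedSpace ℝ KE] {j : K →L[ℝ] KE} {d : ℕ} {γ a b : ℝ} 
    {w : ℝ → Fin d → ℝ} {p : ℕ → ℝ → K} {p' : ℕ → ℝ → (Fin d → ℝ) →L[ℝ] K} {y : ℝ → K} 
    {y' : ℝ → (Fin d → ℝ) →L[ℝ] K} {A A' B B' : ℝ} 
    (h : ∀ k, CB γ a b j w (p k) (p' k) A A' B B') 
    (hp : ∀ t, a ≤ t → t ≤ b → Tendsto (fun k => p k t) atTop (𝓝 (y t))) 
    (hp' : ∀ t, a ≤ t → t ≤ b → Tendsto (fun k => p' k t) atTop (𝓝 (y' t))) : 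
    CB γ a b j w y y' A A' B B' := by
  refine ⟨fun t h1 h2 => le_of_tendsto' (hp t h1 h2).norm fun k => (h k).hA t h1 h2, 
    fun t h1 h2 => le_of_tendsto' (hp' t h1 h2).norm fun k => (h k).hA' t h1 h2, 
    fun s t h1 h2 h3 => ?_, fun s t h1 h2 h3 => ?_⟩
  · refine le_of_tendsto' (x := (atTop : Filter ℕ)) (Tendsto.norm ?_) fun k => (h k).hB s t h1 h2 h3
    have e1 : ∀ u, a ≤ u → u ≤ b → Tendsto (fun k => j (p k u)) atTop (𝓝 (j (y u))) := 
      fun u i1 i2 => (j.continuous.tendsto _).comp (hp u i1 i2)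
    have e2 : Tendsto (fun k => p' k s (w t - w s)) atTop (𝓝 (y' s (w t - w s))) := 
      ((ContinuousLinearMap.apply ℝ K (w t - w s)).continuous.tendsto _).comp (hp' s h1 (by linarith))
    exact ((e1 t (by linarith) h3).sub (e1 s h1 (by linarith))).sub ((j.continuous.tendsto _).comp e2)
  · refine le_of_tendsto' (x := (atTop : Filter ℕ)) (Tendsto.norm ?_) fun k => (h k).hB' s t h1 h2 h3
    have e1 : ∀ u, a ≤ u → u ≤ b → Tendsto (fun k => j.comp (p' k u)) atTop (𝓝 (j.comp (y' u))) := 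
      fun u i1 i2 => ((ContinuousLinearMap.compL ℝ (Fin d → ℝ) K KE j).continuous.tendsto _).comp 
        (hp' u i1 i2)
    exact (e1 t (by linarith) h3).sub (e1 s h1 (by linarith))

variable {d : ℕ} {γ T C : ℝ} {ι : H →L[ℝ] E} {SH : ℝ → H →L[ℝ] H} {SE : ℝ → E →L[ℝ] E}
  {Sm : ℝ → E →L[ℝ] H} {w : ℝ → Fin d → ℝ} {w2 : ℝ → ℝ → Fin d → Fin d → ℝ}
variable {gH : H → (Fin d → ℝ) →L[ℝ] H} {g : E → (Fin d → ℝ) →L[ℝ] E} {G : ℝ} {fH : H → H} {L : ℝ}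

theorem stp_exists (S : RSetup γ T ι SH SE Sm w w2 C) (hg : GS ι (io d ι) gH g G) 
    (hL : 0 ≤ L) (hf : ∀ x y, ‖fH x - fH y‖ ≤ L * ‖x - y‖) (b M : ℝ) (hb : b ≤ T) (hb0 : 0 ≤ b)
    (hM : 0 ≤ M) (x0 : H) (y : ℝ → H) (y' : ℝ → (Fin d → ℝ) →L[ℝ] H) 
    (hy : CB γ 0 b ι w y y' M M M M) (hyc : ContinuousOn y (Icc 0 b)) : 
    ∃ Y : ℝ → H, Stp 0 b ι SH SE w w2 fH gH x0 y y' Y := by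
  obtain ⟨K, hK, hI⟩ := int_lemma S
  have hG := hg.nH.hG
  have hC := S.hC
  have hγ : 0 ≤ γ := by linarith [S.hγ1]
  have hwb : ∀ s t, 0 ≤ s → s ≤ t → t ≤ b → ‖w t - w s‖ ≤ C * (t-s)^γ := 
    fun s t h1 h2 h3 => S.wb s t (by linarith) h2 (by linarith)
  have hz := comp_bd hg hC S.ιle hγ (S.hTγ _ (by linarith) (by linarith)) hwb y y' M M M hM le_rfl hy
  have p1 : 0 ≤ 20*G*C^2*(1+M)^2 := by positivity
  have p2 : 0 ≤ G*M := by positivity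
  have p3 : 0 ≤ ‖gH 0‖ := norm_nonneg _
  set N1 := ‖gH 0‖ + G * M + 20*G*C^2*(1+M)^2 with hN1
  have hz1 := hz.mono (A1 := N1) (A1' := N1) (B1 := N1) (B1' := N1) (by linarith) (by linarith)
    (by linarith) (by linarith)
  obtain ⟨X, hX⟩ := hI 0 b N1 _ _ le_rfl hb (by positivity) hz1
  have hfc : Continuous fH := by
    have : LipschitzWith L.toNNReal fH := LipschitzWith.of_dist_le_mul fun x y => by
      rw [dist_eq_norm, dist_eq_norm, Real.coe_toNNReal _ hL]; exact hf x y
    exact this.continuous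
  refine ⟨fun t => SH (t-0) x0 + (∫ u in (0:ℝ)..t, SH (t-u) (fH (y u))) + X 0 t, fun t h1 h2 => 
    ⟨?_, X 0 t, (hX 0 t le_rfl h1 h2).1, rfl⟩⟩
  refine conv_int S 0 t h1 (by linarith) (fun u => fH (y u)) ?_
  exact hfc.comp_continuousOn (hyc.mono (Icc_subset_Icc le_rfl h2))

set_option maxHeartbeats 1000000 in
theorem exist (S : RSetup γ T ι SH SE Sm w w2 C) (hg : GS ι (io d ι) gH g G) 
    (hL : 0 ≤ L) (hf : ∀ x y, ‖fH x - fH y‖ ≤ L * ‖x - y‖) (ξ : H) : 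
    ∃ b M : ℝ, 0 < b ∧ b ≤ T ∧ 0 ≤ M ∧ ∃ y : ℝ → H, CB γ 0 b ι w y (fun t => gH (y t)) M M M M ∧ 
      Stp 0 b ι SH SE w w2 fH gH ξ y (fun t => gH (y t)) y := by
  obtain ⟨K, hK, hs⟩ := stp_facts (fH := fH) S hg hL hf
  have hG := hg.nH.hG
  have hC := S.hC
  have hγ : 0 < γ := by linarith [S.hγ1]
  set α := C*‖ξ‖ + 1 with hα
  have hα0 : 0 ≤ α := by positivity
  set α' := ‖gH 0‖ + G*α with hα'
  have hα'0 : 0 ≤ α' := by positivity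
  set β := K * (‖ξ‖ + (‖fH 0‖ + L*α) + G*α' + 1) + C^2*‖ξ‖ with hβ
  have hβ0 : 0 ≤ β := by positivity
  set β' := G * (α'*C + 1) with hβ'
  have hβ'0 : 0 ≤ β' := by positivity
  set M := α + α' + β + β' with hMd
  have hM : 0 ≤ M := by positivity
  set N := ‖gH 0‖ + G * M + 20*G*C^2*(1+M)^2 + ‖fH 0‖ + L * M with hN
  have hN0 : 0 ≤ N := by positivity
  clear_value N M β' β α' α
  obtain ⟨l, δ, hl, hδ, hct⟩ := contr (fH := fH) S hg hL hf M hM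
  set δ' := min δ (1/(1+K*N+N+β)) with hδ'
  have hδ'0 : 0 < δ' := lt_min hδ (by positivity)
  set b := min T (δ'^(1/γ)) with hb
  have hb0 : 0 < b := lt_min S.hT (Real.rpow_pos_of_pos hδ'0 _)
  have hbT : b ≤ T := min_le_left _ _
  have hbγ : (b-0)^γ ≤ δ' := by
    rw [sub_zero]
    calc b^γ ≤ (δ'^(1/γ))^γ := Real.rpow_le_rpow hb0.le (min_le_right _ _) hγ.le
      _ = δ' := by rw [← Real.rpow_mul hδ'0.le, one_div_mul_cancel hγ.ne', Real.rpow_one]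
  have hθ0 : 0 ≤ (b-0)^γ := Real.rpow_nonneg (by linarith) _
  have hbδ : (b-0)^γ ≤ δ := hbγ.trans (min_le_left _ _)
  have hθ1 : (1+K*N+N+β) * (b-0)^γ ≤ 1 := by
    have := hbγ.trans (min_le_right _ _)
    rwa [le_div_iff₀ (by positivity), mul_comm] at this
  clear_value b δ'
  have hθ2 : (1+K*N+N+β) * (b-0)^γ = (b-0)^γ + K*N*(b-0)^γ + N*(b-0)^γ + β*(b-0)^γ := by ring
  have hθ3 : 0 ≤ K*N*(b-0)^γ := by positivity
  have hθ4 : 0 ≤ N*(b-0)^γ := by positivity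
  have hθ5 : 0 ≤ β*(b-0)^γ := by positivity
  have hwb : ∀ s t, 0 ≤ s → s ≤ t → t ≤ b → ‖w t - w s‖ ≤ C * (t-s)^γ := 
    fun s t h1 h2 h3 => S.wb s t (by linarith) h2 (by linarith)
  let P : (ℝ → H) × (ℝ → (Fin d → ℝ) →L[ℝ] H) → Prop := fun p => 
    CB γ 0 b ι w p.1 p.2 α α' β β' ∧ ContinuousOn p.1 (Icc 0 b)
  have hPM : ∀ p, P p → CB γ 0 b ι w p.1 p.2 M M M M := fun p hp => 
    hp.1.mono (by linarith) (by linarith) (by linarith) (by linarith)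
  have step : ∀ p : (ℝ → H) × (ℝ → (Fin d → ℝ) →L[ℝ] H), ∃ Y : ℝ → H, P p → 
      Stp 0 b ι SH SE w w2 fH gH ξ p.1 p.2 Y ∧ P (Y, fun t => gH (p.1 t)) := by
    intro p
    by_cases hp : P p
    swap
    · exact ⟨0, fun h => absurd h hp⟩
    obtain ⟨Y, hY⟩ := stp_exists (fH := fH) S hg hL hf b M hbT hb0.le hM ξ p.1 p.2 (hPM p hp) hp.2
    refine ⟨Y, fun _ => ⟨hY, ?_⟩⟩
    obtain ⟨N', hN'0, hN', r1, r2, r3, -⟩ := hs 0 b M α α' ξ p.1 p.2 Y le_rfl hb0.le hbT hM (by linarith) 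
      (by linarith) (hp.1.mono le_rfl le_rfl (by linarith) (by linarith)) hY
    rw [← hN] at hN'
    rw [hN'] at r1 r2 r3
    refine ⟨⟨fun t h1 h2 => (r1 t h1 h2).trans ?_, fun t h1 h2 => ?_, fun s t h1 h2 h3 => 
      (r3 s t h1 h2 h3).trans ?_, fun s t h1 h2 h3 => ?_⟩, 
      mild_cont S 0 b (K*N) (by linarith) Y (by positivity) r2⟩
    · linarith
    · show ‖gH (p.1 t)‖ ≤ α'
      have e1 := hg.nH.l0 (p.1 t) 0
      rw [sub_zero] at e1
      have e2 := norm_le_norm_add_norm_sub' (gH (p.1 t)) (gH 0)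
      have : G * ‖p.1 t‖ ≤ G * α := by have := hp.1.hA t h1 h2; gcongr
      linarith
    · have h0 : 0 ≤ (t-s)^(2*γ) := Real.rpow_nonneg (by linarith) _
      refine mul_le_mul_of_nonneg_right ?_ h0
      have e1 : K * (‖ξ‖ + (‖fH 0‖ + L*α) + G*α' + N*(b-0)^γ) ≤ K * (‖ξ‖ + (‖fH 0‖ + L*α) + G*α' + 1) := by
        have : N*(b-0)^γ ≤ 1 := by linarith
        gcongr
      have e2 : 0 ≤ C^2*‖ξ‖ := by positivity
      linarith
    · show ‖io d ι (gH (p.1 t)) - io d ι (gH (p.1 s))‖ ≤ _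
      rw [hg.hc, hg.hc]
      refine (hg.nE.l0 _ _).trans ?_
      have e1 := hp.1.inc S.ιle hwb hγ.le hβ0 s t h1 h2 h3
      have h0 : 0 ≤ (t-s)^γ := Real.rpow_nonneg (by linarith) _
      have e2 : (α'*C + β*(b-0)^γ)*(t-s)^γ ≤ (α'*C + 1)*(t-s)^γ := by
        have : β*(b-0)^γ ≤ 1 := by linarith
        gcongr
      rw [hβ', mul_assoc]
      have := e1.trans e2
      gcongr
  choose F hF using step
  let p : ℕ → (ℝ → H) × (ℝ → (Fin d → ℝ) →L[ℝ] H) := fun k => 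
    Nat.rec (fun t => SH t ξ, fun _ => 0) (fun _ q => (F q, fun t => gH (q.1 t))) k
  have hps : ∀ k, p (k+1) = (F (p k), fun t => gH ((p k).1 t)) := fun k => rfl
  have hp0 : p 0 = (fun t => SH t ξ, fun _ => 0) := rfl
  clear_value p
  have hP : ∀ k, P (p k) := by
    intro k
    induction k with
    | zero =>
      rw [hp0]
      refine ⟨⟨fun t h1 h2 => ?_, fun t h1 h2 => ?_, fun s t h1 h2 h3 => ?_, fun s t h1 h2 h3 => ?_⟩, ?_⟩
      · exact (S.SHb t h1 (by linarith) ξ).trans (by linarith)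
      · show ‖(0 : (Fin d → ℝ) →L[ℝ] H)‖ ≤ α'
        rw [norm_zero]; exact hα'0
      · show ‖ι (SH t ξ) - ι (SH s ξ) - ι ((0 : (Fin d → ℝ) →L[ℝ] H) (w t - w s))‖ ≤ _
        have e1 : SH t ξ = SH (t-s) (SH s ξ) := by
          rw [← S.SHsg _ _ (by linarith) h1, sub_add_cancel]
        have e2 := S.shold (t-s) (by linarith) (by linarith) (SH s ξ)
        rw [zero_apply, map_zero, sub_zero, e1, S.comm (t-s) (by linarith)]
        refine e2.trans ?_
        have e3 := S.SHb s h1 (by linarith) ξ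
        have h0 : 0 ≤ (t-s)^(2*γ) := Real.rpow_nonneg (by linarith) _
        calc C * (t-s)^(2*γ) * ‖SH s ξ‖ ≤ C * (t-s)^(2*γ) * (C * ‖ξ‖) := by gcongr
          _ = C^2*‖ξ‖ * (t-s)^(2*γ) := by ring
          _ ≤ β * (t-s)^(2*γ) := by
            refine mul_le_mul_of_nonneg_right ?_ h0
            have : 0 ≤ K * (‖ξ‖ + (‖fH 0‖ + L*α) + G*α' + 1) := by positivity
            linarith
      · show ‖ι.comp (0 : (Fin d → ℝ) →L[ℝ] H) - ι.comp 0‖ ≤ _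
        rw [sub_self, norm_zero]
        have h0 : 0 ≤ (t-s)^γ := Real.rpow_nonneg (by linarith) _
        positivity
      · exact (S.SHc ξ).mono fun t ht => ht.1
    | succ k ih => rw [hps]; exact (hF _ ih).2
  have hst : ∀ k, Stp 0 b ι SH SE w w2 fH gH ξ (p k).1 (p k).2 (p (k+1)).1 := fun k => by
    rw [hps]; exact (hF _ (hP k)).1
  have hps1 : ∀ k, (p (k+1)).2 = fun t => gH ((p k).1 t) := fun k => by rw [hps]
  have hl0 : 0 < l := by linarith
  set n0 := 2*M*l^2 with hn0
  have hn00 : 0 ≤ n0 := by positivity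
  clear_value n0
  have hD : ∀ k, CB γ 0 b ι w (fun t => (p (k+1)).1 t - (p k).1 t) (fun t => (p (k+1)).2 t - (p k).2 t) 
      (n0*(1/2)^k/l^2) (n0*(1/2)^k/l) (n0*(1/2)^k) (n0*(1/2)^k) := by
    intro k
    induction k with
    | zero =>
      have hl2 : 1 ≤ l^2 := one_le_pow₀ hl
      have e : 2*M ≤ n0 := by
        rw [hn0]
        exact le_mul_of_one_le_right (by linarith) hl2
      rw [pow_zero, mul_one]
      refine ((hPM _ (hP 1)).sub (hPM _ (hP 0))).mono ?_ ?_ ?_ ?_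
      · rw [hn0, mul_div_cancel_right₀ _ (by positivity)]; linarith
      · have : n0/l = 2*M*l := by rw [hn0]; field_simp
        rw [this]
        have : 2*M ≤ 2*M*l := le_mul_of_one_le_right (by linarith) hl
        linarith
      · linarith
      · linarith
    | succ k ih =>
      have := hct 0 b (n0*(1/2)^k) ξ _ _ _ _ _ _ le_rfl hbT hbδ (by positivity) (hPM _ (hP (k+1))) 
        (hPM _ (hP k)) ih (hst (k+1)) (hst k)
      have e : n0*(1/2)^(k+1) = n0*(1/2)^k/2 := by ring
      rw [e, hps1 (k+1), hps1 k]
      exact this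
  have hDD : ∀ k i, CB γ 0 b ι w (fun t => (p k).1 t - (p (k+i)).1 t) (fun t => (p k).2 t - (p (k+i)).2 t)
      (2*n0*(1/2)^k*(1-(1/2)^i)/l^2) (2*n0*(1/2)^k*(1-(1/2)^i)/l) (2*n0*(1/2)^k*(1-(1/2)^i)) 
      (2*n0*(1/2)^k*(1-(1/2)^i)) := by
    intro k i
    induction i with
    | zero =>
      constructor <;> simp
    | succ i ih =>
      have := ih.sub (hD (k+i))
      have e1 : (fun t => ((p k).1 t - (p (k+i)).1 t) - ((p (k+i+1)).1 t - (p (k+i)).1 t)) = 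
        fun t => (p k).1 t - (p (k+(i+1))).1 t := by funext t; rw [sub_sub_sub_cancel_right]; rfl
      have e2 : (fun t => ((p k).2 t - (p (k+i)).2 t) - ((p (k+i+1)).2 t - (p (k+i)).2 t)) = 
        fun t => (p k).2 t - (p (k+(i+1))).2 t := by funext t; rw [sub_sub_sub_cancel_right]; rfl
      rw [e1, e2] at this
      have e3 : 2*n0*(1/2)^k*(1-(1/2)^(i+1)) = 2*n0*(1/2)^k*(1-(1/2)^i) + n0*(1/2)^(k+i) := by ring
      rw [e3, add_div, add_div]
      exact this
  have hlim : ∀ t, ∃ z, 0 ≤ t → t ≤ b → Tendsto (fun k => (p k).1 t) atTop (𝓝 z) := by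
    intro t
    by_cases ht : 0 ≤ t ∧ t ≤ b
    swap
    · exact ⟨0, fun h1 h2 => absurd ⟨h1, h2⟩ ht⟩
    have : CauchySeq (fun k => (p k).1 t) := by
      refine cauchySeq_of_le_geometric (1/2) (n0/l^2) (by norm_num) fun k => ?_
      rw [dist_comm, dist_eq_norm]
      refine ((hD k).hA t ht.1 ht.2).trans (le_of_eq (by ring))
    obtain ⟨z, hz⟩ := cauchySeq_tendsto_of_complete this
    exact ⟨z, fun _ _ => hz⟩
  choose y hy using hlim
  have hgc : Continuous gH := hg.nH.D0.continuous
  have hy' : ∀ t, 0 ≤ t → t ≤ b → Tendsto (fun k => (p k).2 t) atTop (𝓝 (gH (y t))) := by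
    intro t h1 h2
    rw [← tendsto_add_atTop_iff_nat 1]
    simp only [hps1]
    exact (hgc.tendsto _).comp (hy t h1 h2)
  have hyM : CB γ 0 b ι w y (fun t => gH (y t)) M M M M := CB.limit (fun k => hPM _ (hP k)) hy hy'
  have hyd : ∀ k, CB γ 0 b ι w (fun t => (p k).1 t - y t) (fun t => (p k).2 t - gH (y t)) 
      (2*n0*(1/2)^k/l^2) (2*n0*(1/2)^k/l) (2*n0*(1/2)^k) (2*n0*(1/2)^k) := by
    intro k
    refine CB.limit (p := fun i t => (p k).1 t - (p (k+i)).1 t) (p' := fun i t => (p k).2 t - (p (k+i)).2 t) 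
      (fun i => ?_) (fun t h1 h2 => ?_) (fun t h1 h2 => ?_)
    · have e0 : 2*n0*(1/2)^k*(1-(1/2)^i) ≤ 2*n0*(1/2)^k := by
        refine mul_le_of_le_one_right (by positivity) ?_
        have : (0:ℝ) ≤ (1/2)^i := by positivity
        linarith
      exact (hDD k i).mono (by gcongr) (by gcongr) e0 e0
    · refine tendsto_const_nhds.sub ?_
      have := (tendsto_add_atTop_iff_nat k).2 (hy t h1 h2)
      simpa only [add_comm k] using this
    · refine tendsto_const_nhds.sub ?_
      have := (tendsto_add_atTop_iff_nat k).2 (hy' t h1 h2)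
      simpa only [add_comm k] using this
  have hz0 : ∀ c : ℝ, Tendsto (fun k : ℕ => c*(1/2:ℝ)^k/l^2) atTop (𝓝 0) := by
    intro c
    have := (tendsto_pow_atTop_nhds_zero_of_lt_one (r := (1/2:ℝ)) (by norm_num) (by norm_num)).const_mul c
    have := this.div_const (l^2)
    simpa using this
  have hyc : ContinuousOn y (Icc 0 b) := by
    have hu : TendstoUniformlyOn (fun k t => (p k).1 t) y atTop (Icc 0 b) := by
      rw [Metric.tendstoUniformlyOn_iff]
      intro ε hε
      filter_upwards [(hz0 (2*n0)).eventually (gt_mem_nhds hε)] with k hk t ht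
      rw [dist_comm, dist_eq_norm]
      exact ((hyd k).hA t ht.1 ht.2).trans_lt hk
    exact hu.continuousOn (Frequently.of_forall fun k => (hP k).2)
  obtain ⟨Y, hY⟩ := stp_exists (fH := fH) S hg hL hf b M hbT hb0.le hM ξ y _ hyM hyc
  have hYy : ∀ t, 0 ≤ t → t ≤ b → y t = Y t := by
    intro t h1 h2
    have e1 : Tendsto (fun k => (p (k+1)).1 t) atTop (𝓝 (y t)) := (tendsto_add_atTop_iff_nat 1).2 (hy t h1 h2)
    refine tendsto_nhds_unique e1 ?_
    rw [tendsto_iff_norm_sub_tendsto_zero]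
    refine squeeze_zero (fun k => norm_nonneg _) (fun k => ?_) (hz0 n0)
    have := (hct 0 b (2*n0*(1/2)^k) ξ _ _ _ _ _ _ le_rfl hbT hbδ (by positivity) (hPM _ (hP k)) 
        hyM (hyd k) (hst k) hY).hA t h1 h2
    refine this.trans (le_of_eq (by ring))
  refine ⟨b, M, hb0, hbT, hM, y, hyM, fun t h1 h2 => ?_⟩
  rw [hYy t h1 h2]
  exact hY t h1 h2
end partEight

section partNine
theorem hs_bound {V : Type*} [NormedAddCommGroup V] {a b e : ℝ} {F : ℝ → ℝ → V} 
    (h : BddAbove (holderSet a b e F)) : 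
    ∃ m, 0 ≤ m ∧ ∀ s t, a ≤ s → s < t → t ≤ b → ‖F s t‖ ≤ m * (t-s)^e := by
  obtain ⟨m, hm⟩ := h
  refine ⟨max m 0, le_max_right _ _, fun s t h1 h2 h3 => ?_⟩
  have := hm ⟨s, t, h1, h2, h3, rfl⟩
  have hp : 0 < (t-s)^e := Real.rpow_pos_of_pos (by linarith) _
  rw [div_le_iff₀ hp] at this
  exact this.trans (mul_le_mul_of_nonneg_right (le_max_left _ _) hp.le)

theorem hs_of {V : Type*} [NormedAddCommGroup V] {a b e : ℝ} {F : ℝ → ℝ → V} (m : ℝ)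
    (h : ∀ s t, a ≤ s → s < t → t ≤ b → ‖F s t‖ ≤ m * (t-s)^e) : BddAbove (holderSet a b e F) := by
  refine ⟨m, ?_⟩
  rintro r ⟨s, t, h1, h2, h3, rfl⟩
  have hp : 0 < (t-s)^e := Real.rpow_pos_of_pos (by linarith) _
  rw [div_le_iff₀ hp]
  exact h s t h1 h2 h3

theorem rpow_split (h T a b : ℝ) (h0 : 0 < h) (hT : h ≤ T) (hab : a ≤ b) : 
    h ^ b ≤ T ^ (b-a) * h ^ a := by
  have : h ^ b = h^(b-a) * h^a := by rw [← Real.rpow_add h0]; congr 1; ring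
  rw [this]
  exact mul_le_mul_of_nonneg_right (Real.rpow_le_rpow h0.le hT (by linarith)) 
    (Real.rpow_nonneg h0.le _)

variable {d : ℕ} {γ T C : ℝ} {ι : H →L[ℝ] E} {SH : ℝ → H →L[ℝ] H} {SE : ℝ → E →L[ℝ] E}
  {Sm : ℝ → E →L[ℝ] H} {w : ℝ → Fin d → ℝ} {w2 : ℝ → ℝ → Fin d → Fin d → ℝ}
variable {gH : H → (Fin d → ℝ) →L[ℝ] H} {g : E → (Fin d → ℝ) →L[ℝ] E} {G : ℝ} {fH : H → H} {L : ℝ}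
  {η : ℝ}

theorem sol_to (S : RSetup γ T ι SH SE Sm w w2 C) (hg : GS ι (io d ι) gH g G) (hη : 0 ≤ η)
    (b : ℝ) (hb : b ≤ T) (hb0 : 0 ≤ b) (ξ : H) (y : ℝ → H) 
    (hy : IsSolution γ η b ι SH SE w w2 fH gH ξ y) : 
    (∃ M, 0 ≤ M ∧ CB γ 0 b ι w y (fun t => gH (y t)) M M M M) ∧ 
      Stp 0 b ι SH SE w w2 fH gH ξ y (fun t => gH (y t)) y := by
  obtain ⟨hy0, ⟨b1, b2, b3, b4⟩, Gu, hGu, hsol⟩ := hy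
  have hC := S.hC
  have hG := hg.nH.hG
  have hγ : 0 < γ := by linarith [S.hγ1]
  constructor
  · obtain ⟨m1, p1, h1⟩ := hs_bound b1
    obtain ⟨m2', h2'⟩ := b2
    obtain ⟨m4, p4, h4⟩ := hs_bound b4
    have h2 : ∀ t, 0 ≤ t → t ≤ b → ‖gH (y t)‖ ≤ m2' := fun t i1 i2 => h2' ⟨t, i1, i2, rfl⟩
    have p2 : 0 ≤ m2' := (norm_nonneg _).trans (h2 0 le_rfl hb0)
    obtain ⟨A, hA0, hA⟩ : ∃ A, 0 ≤ A ∧ ∀ t, 0 ≤ t → t ≤ b → ‖y t‖ ≤ A := by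
      have pb : 0 ≤ b^η := Real.rpow_nonneg hb0 _
      refine ⟨C*‖ξ‖ + m1 * b^η, by positivity, fun t i1 i2 => ?_⟩
      rcases i1.eq_or_lt with rfl | i1'
      · rw [hy0]
        have : 0 ≤ m1 * b^η := by positivity
        nlinarith [norm_nonneg ξ]
      · have := h1 0 t le_rfl i1' i2
        rw [sub_zero, hy0] at this
        have e : y t = SH t ξ + (y t - SH t ξ) := by abel
        rw [e]
        refine (norm_add_le _ _).trans (add_le_add (S.SHb t i1 (by linarith) ξ) (this.trans ?_))
        exact mul_le_mul_of_nonneg_left (Real.rpow_le_rpow i1 i2 hη) p1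
    have hyw : ∀ s t, 0 ≤ s → s ≤ t → t ≤ b → ‖gH (y s) (w t - w s)‖ ≤ m2' * C * (t-s)^γ := by
      intro s t i1 i2 i3
      refine ((gH (y s)).le_opNorm _).trans ?_
      rw [mul_assoc]
      exact mul_le_mul (h2 s i1 (by linarith)) (S.wb s t i1 i2 (by linarith)) (norm_nonneg _) p2
    set B := m4 + C * A + C * (m2' * C * C) with hBdef
    have hB0 : 0 ≤ B := by positivity
    have hB : ∀ s t, 0 ≤ s → s ≤ t → t ≤ b → 
        ‖ι (y t) - ι (y s) - ι (gH (y s) (w t - w s))‖ ≤ B * (t-s)^(2*γ) := by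
      intro s t i1 i2 i3
      have q : 0 ≤ (t-s)^(2*γ) := Real.rpow_nonneg (by linarith) _
      rcases i2.eq_or_lt with rfl | i2'
      · simp only [sub_self, map_zero, norm_zero] at q ⊢
        positivity
      have e : ι (y t) - ι (y s) - ι (gH (y s) (w t - w s)) = 
        (ι (y t) - SE (t-s) (ι (y s)) - SE (t-s) (ι (gH (y s) (w t - w s)))) + 
        (SE (t-s) (ι (y s)) - ι (y s)) + 
        (SE (t-s) (ι (gH (y s) (w t - w s))) - ι (gH (y s) (w t - w s))) := by abel
      rw [e]
      refine (norm_add₃_le).trans ?_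
      have j1 := h4 s t i1 i2' i3
      have j2 := S.shold (t-s) (by linarith) (by linarith) (y s)
      have j3 := S.shold (t-s) (by linarith) (by linarith) (gH (y s) (w t - w s))
      have k2 : C * (t-s)^(2*γ) * ‖y s‖ ≤ C * (t-s)^(2*γ) * A := 
        mul_le_mul_of_nonneg_left (hA s i1 (by linarith)) (by positivity)
      have k3 : C * (t-s)^(2*γ) * ‖gH (y s) (w t - w s)‖ ≤ C * (t-s)^(2*γ) * (m2' * C * C) := 
        mul_le_mul_of_nonneg_left ((hyw s t i1 i2 i3).trans (mul_le_mul_of_nonneg_left 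
          (S.hTγ _ (by linarith) (by linarith)) (by positivity))) (by positivity)
      calc _ ≤ m4 * (t-s)^(2*γ) + C * (t-s)^(2*γ) * A + C * (t-s)^(2*γ) * (m2' * C * C) := 
            add_le_add (add_le_add j1 (j2.trans k2)) (j3.trans k3)
        _ = B * (t-s)^(2*γ) := by rw [hBdef]; ring
    set B' := G * (m2' * C + B * C) with hB'def
    have hB'0 : 0 ≤ B' := by positivity
    have hB' : ∀ s t, 0 ≤ s → s ≤ t → t ≤ b → 
        ‖ι.comp (gH (y t)) - ι.comp (gH (y s))‖ ≤ B' * (t-s)^γ := by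
      intro s t i1 i2 i3
      have q : 0 ≤ (t-s)^γ := Real.rpow_nonneg (by linarith) _
      have e1 : ∀ x, ι.comp (gH x) = g (ι x) := hg.hc
      rw [e1, e1]
      refine (hg.nE.l0 _ _).trans ?_
      have e : ι (y t) - ι (y s) = ι (gH (y s) (w t - w s)) + 
        (ι (y t) - ι (y s) - ι (gH (y s) (w t - w s))) := by abel
      have k : ‖ι (y t) - ι (y s)‖ ≤ m2' * C * (t-s)^γ + B * (C * (t-s)^γ) := by
        rw [e]
        refine (norm_add_le _ _).trans (add_le_add ((S.ιle _).trans (hyw s t i1 i2 i3)) 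
          ((hB s t i1 i2 i3).trans (mul_le_mul_of_nonneg_left ?_ hB0)))
        rw [rpow_dbl _ _ (by linarith), sq]
        exact mul_le_mul_of_nonneg_right (S.hTγ _ (by linarith) (by linarith)) q
      calc _ ≤ G * (m2' * C * (t-s)^γ + B * (C * (t-s)^γ)) := 
            mul_le_mul_of_nonneg_left k (by positivity)
        _ = _ := by rw [hB'def]; ring
    have hcb : CB γ 0 b ι w y (fun t => gH (y t)) A m2' B B' := ⟨hA, h2, hB, hB'⟩
    exact ⟨A + m2' + B + B', by positivity, hcb.mono (by linarith) (by linarith) (by linarith) 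
      (by linarith)⟩
  · intro t i1 i2
    obtain ⟨hi, X, hX, hyt⟩ := hsol t i1 i2
    refine ⟨hi, X, ?_, ?_⟩
    · refine riemann_congr 0 t _ _ _ hX fun u v j1 j2 j3 => ?_
      unfold germ
      rw [ctr_of_tensor (dz gH y (fun t => gH (y t)) u) (Gu u) ?_ (w2 v u)]
      intro p q
      rw [hGu u j1 (by linarith)]
      rfl
    · rw [sub_zero]; exact hyt

theorem to_sol (S : RSetup γ T ι SH SE Sm w w2 C) (hg : GS ι (io d ι) gH g G) (hη : η ≤ γ)
    (hL : 0 ≤ L) (hf : ∀ x y, ‖fH x - fH y‖ ≤ L * ‖x - y‖)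
    (b : ℝ) (hb : b ≤ T) (hb0 : 0 < b) (M : ℝ) (hM : 0 ≤ M) (ξ : H) (y : ℝ → H) 
    (hy : CB γ 0 b ι w y (fun t => gH (y t)) M M M M)
    (hY : Stp 0 b ι SH SE w w2 fH gH ξ y (fun t => gH (y t)) y) : 
    IsSolution γ η b ι SH SE w w2 fH gH ξ y := by
  have hC := S.hC
  have hγ : 0 < γ := by linarith [S.hγ1]
  obtain ⟨K, hK, hs⟩ := stp_facts (fH := fH) S hg hL hf
  obtain ⟨N, hN, -, -, h1, -, -⟩ := hs 0 b M M M ξ y _ y le_rfl hb0.le hb hM le_rfl le_rfl hy hY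
  refine ⟨?_, ⟨?_, ?_, ?_, ?_⟩, fun u => ctr (dz gH y (fun t => gH (y t)) u), ?_, ?_⟩
  · obtain ⟨-, X, hX, e⟩ := hY 0 le_rfl hb0.le
    have hX0 : ι X = 0 := by
      by_contra hne
      obtain ⟨δ, hδ, h⟩ := hX ‖ι X‖ (norm_pos_iff.2 hne)
      have := h 0 (fun _ => 0) rfl rfl (by simp) (by simp)
      simp at this
    have hX1 : X = 0 := S.inj (by rw [hX0, map_zero])
    rw [e, hX1]
    simp [S.SH0]
  · refine hs_of (K * N * b^(γ-η)) fun s t i1 i2 i3 => (h1 s t i1 i2.le i3).trans ?_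
    rw [mul_assoc (K*N)]
    exact mul_le_mul_of_nonneg_left (rpow_split _ _ _ _ (by linarith) (by linarith) hη) 
      (by positivity)
  · refine ⟨M, ?_⟩
    rintro r ⟨u, i1, i2, rfl⟩
    exact hy.hA' u i1 i2
  · refine hs_of (M + C * C * M) fun s t i1 i2 i3 => ?_
    have q : 0 ≤ (t-s)^γ := Real.rpow_nonneg (by linarith) _
    have e : ι.comp (gH (y t)) - (SE (t-s)).comp (ι.comp (gH (y s))) = 
      (ι.comp (gH (y t)) - ι.comp (gH (y s))) - 
        ((SE (t-s)).comp (ι.comp (gH (y s))) - ι.comp (gH (y s))) := by abel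
    have k : ‖(SE (t-s)).comp (ι.comp (gH (y s))) - ι.comp (gH (y s))‖ ≤ C * C * M * (t-s)^γ := by
      refine ContinuousLinearMap.opNorm_le_bound _ (by positivity) fun x => ?_
      have j := S.shold (t-s) (by linarith) (by linarith) (gH (y s) x)
      have j2 : ‖gH (y s) x‖ ≤ M * ‖x‖ := ((gH (y s)).le_opNorm x).trans 
        (mul_le_mul_of_nonneg_right (hy.hA' s i1 (by linarith)) (norm_nonneg _))
      refine le_trans j ?_
      rw [rpow_dbl _ _ (by linarith), sq]
      calc _ ≤ C * (C * (t-s)^γ) * (M * ‖x‖) := by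
            have := S.hTγ (t-s) (by linarith) (by linarith)
            gcongr
        _ = _ := by ring
    show ‖ι.comp (gH (y t)) - (SE (t-s)).comp (ι.comp (gH (y s)))‖ ≤ _
    rw [e]
    refine (norm_sub_le _ _).trans ((add_le_add (hy.hB' s t i1 i2.le i3) k).trans (le_of_eq ?_))
    ring
  · refine hs_of (M + C * M + C * (M * C * C)) fun s t i1 i2 i3 => ?_
    have q : 0 ≤ (t-s)^(2*γ) := Real.rpow_nonneg (by linarith) _
    have e : ι (y t) - SE (t-s) (ι (y s)) - SE (t-s) (ι (gH (y s) (w t - w s))) = 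
      (ι (y t) - ι (y s) - ι (gH (y s) (w t - w s))) - (SE (t-s) (ι (y s)) - ι (y s)) - 
        (SE (t-s) (ι (gH (y s) (w t - w s))) - ι (gH (y s) (w t - w s))) := by abel
    show ‖ι (y t) - SE (t-s) (ι (y s)) - SE (t-s) (ι (gH (y s) (w t - w s)))‖ ≤ _
    rw [e]
    have j2 := S.shold (t-s) (by linarith) (by linarith) (y s)
    have j3 := S.shold (t-s) (by linarith) (by linarith) (gH (y s) (w t - w s))
    have j4 : ‖gH (y s) (w t - w s)‖ ≤ M * C * C := by
      refine ((gH (y s)).le_opNorm _).trans ?_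
      rw [mul_assoc]
      exact mul_le_mul (hy.hA' s i1 (by linarith)) ((S.wb s t i1 i2.le (by linarith)).trans 
        (mul_le_mul_of_nonneg_left (S.hTγ _ (by linarith) (by linarith)) (by linarith))) 
        (norm_nonneg _) hM
    have k2 : C * (t-s)^(2*γ) * ‖y s‖ ≤ C * (t-s)^(2*γ) * M := 
      mul_le_mul_of_nonneg_left (hy.hA s i1 (by linarith)) (by positivity)
    have k3 : C * (t-s)^(2*γ) * ‖gH (y s) (w t - w s)‖ ≤ C * (t-s)^(2*γ) * (M * C * C) := 
      mul_le_mul_of_nonneg_left j4 (by positivity)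
    refine (norm_sub_le _ _).trans ((add_le_add ((norm_sub_le _ _).trans (add_le_add 
      (hy.hB s t i1 i2.le i3) (j2.trans k2))) (j3.trans k3)).trans (le_of_eq ?_))
    ring
  · intro u i1 i2 p q
    rw [ctr_tensor]
    rfl
  · intro t i1 i2
    obtain ⟨hi, X, hX, e⟩ := hY t i1 i2
    rw [sub_zero] at e
    exact ⟨hi, X, hX, e⟩

theorem setup_of (γ T : ℝ) (hγ1 : 1 / 3 < γ) (hγ2 : γ ≤ 1 / 2) (hT : 0 < T)
    (hι_inj : Function.Injective ι) (hι : ∀ x : H, ‖ι x‖ ≤ ‖x‖)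
    (hSH0 : SH 0 = ContinuousLinearMap.id ℝ H)
    (hSHsg : ∀ a b : ℝ, 0 ≤ a → 0 ≤ b → SH (a + b) = (SH a).comp (SH b))
    (hSEsg : ∀ a b : ℝ, 0 ≤ a → 0 ≤ b → SE (a + b) = (SE a).comp (SE b))
    (hSHc : ∀ x : H, ContinuousOn (fun u => SH u x) (Ici (0 : ℝ)))
    (hcomm : ∀ u : ℝ, 0 ≤ u → ∀ x : H, ι (SH u x) = SE u (ι x))
    (MS : ℝ) (hMS : ∀ u : ℝ, 0 ≤ u → u ≤ T → ‖SH u‖ ≤ MS ∧ ‖SE u‖ ≤ MS)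
    (CS : ℝ)
    (hSm : ∀ u : ℝ, 0 < u → u ≤ T →
      (∀ x : E, ι (Sm u x) = SE u x) ∧ ∀ x : E, ‖Sm u x‖ ≤ CS * u ^ (-(2 * γ)) * ‖x‖)
    (hShold : ∀ u : ℝ, 0 ≤ u → u ≤ T → ∀ x : H, ‖ι (SH u x) - ι x‖ ≤ CS * u ^ (2 * γ) * ‖x‖)
    (hw : IsRoughPath γ 0 T w w2) : ∃ C, RSetup γ T ι SH SE Sm w w2 C := by
  obtain ⟨hch, hw1, hw2⟩ := hw
  obtain ⟨m1, p1, h1⟩ := hs_bound hw1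
  obtain ⟨m2, p2, h2⟩ := hs_bound hw2
  have q1 : 0 ≤ T^γ := Real.rpow_nonneg hT.le _
  have q2 : 0 ≤ T^(1-γ) := Real.rpow_nonneg hT.le _
  have q3 : 0 ≤ T^(1-2*γ) := Real.rpow_nonneg hT.le _
  have q4 : 0 ≤ (d:ℝ)^2 := by positivity
  have q5 := abs_nonneg MS
  have q6 := abs_nonneg CS
  have q7 := le_abs_self MS
  have q8 := le_abs_self CS
  obtain ⟨C, hC⟩ : ∃ C, C = 1 + (d:ℝ)^2 + |MS| + |CS| + m1 + m2 + T^γ + T^(1-γ) + T^(1-2*γ) := 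
    ⟨_, rfl⟩
  have c0 : 0 ≤ C := by linarith
  have key : ∀ a : ℝ, a ≤ 1 → T^(1-a) ≤ C → ∀ h, 0 ≤ h → h ≤ T → h ≤ C * h^a := by
    intro a ha hTa h h0 hh
    rcases h0.eq_or_lt with rfl | h0'
    · have := Real.rpow_nonneg (le_refl (0:ℝ)) a
      positivity
    · have := rpow_split h T a 1 h0' hh ha
      rw [Real.rpow_one] at this
      exact this.trans (mul_le_mul_of_nonneg_right hTa (Real.rpow_nonneg h0 _))
  refine ⟨C, ⟨by linarith, hγ1, hγ2, hT, by linarith, ?_, key γ (by linarith) (by linarith), 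
    key (2*γ) (by linarith) (by linarith), hι_inj, hι, ?_, ?_, ?_, hSHc, hcomm, ?_, ?_, ?_, ?_, ?_, 
    hch, ?_, ?_⟩⟩
  · intro h h0 hh
    have := Real.rpow_le_rpow h0 hh (by linarith : 0 ≤ γ)
    linarith
  · intro x; rw [hSH0]; rfl
  · intro a b ha hb x; rw [hSHsg a b ha hb]; rfl
  · intro a b ha hb x; rw [hSEsg a b ha hb]; rfl
  · intro u h0 hu x
    refine ((SH u).le_opNorm x).trans (mul_le_mul_of_nonneg_right ?_ (norm_nonneg _))
    linarith [(hMS u h0 hu).1]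
  · intro u h0 hu x
    refine ((SE u).le_opNorm x).trans (mul_le_mul_of_nonneg_right ?_ (norm_nonneg _))
    linarith [(hMS u h0 hu).2]
  · exact fun u h0 hu => (hSm u h0 hu).1
  · intro u h0 hu x
    refine ((hSm u h0 hu).2 x).trans ?_
    have := Real.rpow_nonneg h0.le (-(2*γ))
    have : CS ≤ C := by linarith
    gcongr
  · intro u h0 hu x
    rw [← hcomm u h0]
    refine (hShold u h0 hu x).trans ?_
    have := Real.rpow_nonneg h0 (2*γ)
    have : CS ≤ C := by linarith
    gcongr
  · intro s t i1 i2 i3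
    have := Real.rpow_nonneg (sub_nonneg.2 i2) γ
    rcases i2.eq_or_lt with rfl | i2'
    · rw [sub_self (w s), norm_zero]; positivity
    · refine (h1 s t i1 i2' i3).trans ?_
      have : m1 ≤ C := by linarith
      gcongr
  · intro s t i1 i2 i3
    have := Real.rpow_nonneg (sub_nonneg.2 i2) (2*γ)
    rcases i2.eq_or_lt with rfl | i2'
    · have z : w2 s s = 0 := by
        have := hch s s s i1 le_rfl le_rfl i3
        have z2 : tensor (w s - w s) (w s - w s) = 0 := by
          funext i j; simp [tensor]
        rw [z2, sub_self, zero_sub, neg_eq_zero] at this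
        exact this
      rw [z, norm_zero]; positivity
    · refine (h2 s t i1 i2' i3).trans ?_
      have : m2 ≤ C := by linarith
      gcongr
end partNine

/-- Theorem 2.2: local existence and uniqueness for the rough evolution equation
`dy = (Ay + f(y))du + g(y)dw` with initial condition `ξ ∈ H`. -/
theorem stmt_1 {H E : Type*} [NormedAddCommGroup H] [NormedSpace ℝ H] [CompleteSpace H]
    [NormedAddCommGroup E] [NormedSpace ℝ E] [CompleteSpace E]
    {d : ℕ} (γ η : ℝ) (hγ1 : 1 / 3 < γ) (hγ2 : γ ≤ 1 / 2) (hη1 : 0 ≤ η) (hη2 : η < γ)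
    (T : ℝ) (hT : 0 < T)
    (ι : H →L[ℝ] E) (hι_inj : Function.Injective ι) (hι : ∀ x : H, ‖ι x‖ ≤ ‖x‖)
    (SH : ℝ → H →L[ℝ] H) (SE : ℝ → E →L[ℝ] E)
    (hSH0 : SH 0 = ContinuousLinearMap.id ℝ H) (hSE0 : SE 0 = ContinuousLinearMap.id ℝ E)
    (hSHsg : ∀ a b : ℝ, 0 ≤ a → 0 ≤ b → SH (a + b) = (SH a).comp (SH b))
    (hSEsg : ∀ a b : ℝ, 0 ≤ a → 0 ≤ b → SE (a + b) = (SE a).comp (SE b))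
    (hSHc : ∀ x : H, ContinuousOn (fun u => SH u x) (Ici (0 : ℝ)))
    (hSEc : ∀ x : E, ContinuousOn (fun u => SE u x) (Ici (0 : ℝ)))
    (hcomm : ∀ u : ℝ, 0 ≤ u → ∀ x : H, ι (SH u x) = SE u (ι x))
    (MS : ℝ) (hMS : ∀ u : ℝ, 0 ≤ u → u ≤ T → ‖SH u‖ ≤ MS ∧ ‖SE u‖ ≤ MS)
    (CS : ℝ) (Sm : ℝ → E →L[ℝ] H)
    (hSm : ∀ u : ℝ, 0 < u → u ≤ T →
      (∀ x : E, ι (Sm u x) = SE u x) ∧ ∀ x : E, ‖Sm u x‖ ≤ CS * u ^ (-(2 * γ)) * ‖x‖)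
    (hShold : ∀ u : ℝ, 0 ≤ u → u ≤ T → ∀ x : H, ‖ι (SH u x) - ι x‖ ≤ CS * u ^ (2 * γ) * ‖x‖)
    (f : E → E) (fH : H → H) (Lf LfH : NNReal)
    (hf : LipschitzWith Lf f) (hfH : LipschitzWith LfH fH)
    (hfcomm : ∀ x : H, ι (fH x) = f (ι x))
    (g : E → (Fin d → ℝ) →L[ℝ] E) (gH : H → (Fin d → ℝ) →L[ℝ] H)
    (hg : ContDiff ℝ 3 g) (hgH : ContDiff ℝ 3 gH) (Cg : ℝ)
    (hgb : ∀ x : E, ‖iteratedFDeriv ℝ 1 g x‖ ≤ Cg ∧ ‖iteratedFDeriv ℝ 2 g x‖ ≤ Cg ∧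
      ‖iteratedFDeriv ℝ 3 g x‖ ≤ Cg)
    (hgHb : ∀ x : H, ‖iteratedFDeriv ℝ 1 gH x‖ ≤ Cg ∧ ‖iteratedFDeriv ℝ 2 gH x‖ ≤ Cg ∧
      ‖iteratedFDeriv ℝ 3 gH x‖ ≤ Cg)
    (hgcomm : ∀ (x : H) (h : Fin d → ℝ), ι (gH x h) = g (ι x) h)
    (w : ℝ → Fin d → ℝ) (w2 : ℝ → ℝ → Fin d → Fin d → ℝ)
    (hw : IsRoughPath γ 0 T w w2) (ξ : H) :
    ∃ T₀ : ℝ, 0 < T₀ ∧ T₀ ≤ T ∧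
      (∃ y : ℝ → H, IsSolution γ η T₀ ι SH SE w w2 fH gH ξ y) ∧
      ∀ y₁ y₂ : ℝ → H, IsSolution γ η T₀ ι SH SE w w2 fH gH ξ y₁ →
        IsSolution γ η T₀ ι SH SE w w2 fH gH ξ y₂ →
        ∀ t : ℝ, 0 ≤ t → t ≤ T₀ → y₁ t = y₂ t := by
  obtain ⟨C, S⟩ := setup_of (Sm := Sm) γ T hγ1 hγ2 hT hι_inj hι hSH0 hSHsg hSEsg hSHc hcomm MS hMS CS
    hSm hShold hw
  have hG : GS ι (io d ι) gH g (1 + |Cg|) := by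
    have h1 : (1:ℝ) ≤ 1 + |Cg| := by linarith [abs_nonneg Cg]
    have h2 : Cg ≤ 1 + |Cg| := by linarith [le_abs_self Cg]
    refine ⟨NB_of gH Cg _ h1 h2 hgH hgHb, NB_of g Cg _ h1 h2 hg hgb, fun x => ?_⟩
    ext1 v
    exact hgcomm x v
  have hL : (0:ℝ) ≤ (LfH : ℝ) := LfH.2
  have hfL : ∀ x y, ‖fH x - fH y‖ ≤ (LfH : ℝ) * ‖x - y‖ := fun x y => by
    have := hfH.dist_le_mul x y
    rwa [dist_eq_norm, dist_eq_norm] at this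
  obtain ⟨b, M, hb0, hb, hM, y, hy, hY⟩ := exist (fH := fH) S hG hL hfL ξ
  refine ⟨b, hb0, hb, ⟨y, to_sol (fH := fH) S hG hη2.le hL hfL b hb hb0 M hM ξ y hy hY⟩, ?_⟩
  intro y₁ y₂ s1 s2 t h0 h1
  obtain ⟨⟨M1, p1, c1⟩, e1⟩ := sol_to S hG hη1 b hb hb0.le ξ y₁ s1
  obtain ⟨⟨M2, p2, c2⟩, e2⟩ := sol_to S hG hη1 b hb hb0.le ξ y₂ s2
  exact uniq_long (fH := fH) S hG hL hfL (M1+M2) (by linarith) b hb ξ y₁ y₂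
    (c1.mono (by linarith) (by linarith) (by linarith) (by linarith))
    (c2.mono (by linarith) (by linarith) (by linarith) (by linarith)) e1 e2 t h0 h1
    (s1.1.trans s2.1.symm)

end
end

section
/- Let g : V → W be twice Fréchet differentiable with ‖Dg(x)‖ ≤ M and ‖D²g(x)‖ ≤ M for all x ∈ V. Then there is a constant C, depending only on M, such that for all x₁, x₂, x₃, x₄ ∈ V: ‖g(x₁) − g(x₂) − g(x₃) + g(x₄)‖ ≤ C( ‖x₁ − x₂ − x₃ + x₄‖ + (‖x₁ − x₃‖ + ‖x₂ − x₄‖) · ‖x₃ − x₄‖ ). -/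
theorem stmt_12 {V W : Type*} [NormedAddCommGroup V] [NormedSpace ℝ V]
    [NormedAddCommGroup W] [NormedSpace ℝ W] (M : ℝ) (hM : 0 < M) :
    ∃ C : ℝ, ∀ g : V → W, Differentiable ℝ g → Differentiable ℝ (fderiv ℝ g) →
      (∀ x : V, ‖fderiv ℝ g x‖ ≤ M) → (∀ x : V, ‖fderiv ℝ (fderiv ℝ g) x‖ ≤ M) →
      ∀ x₁ x₂ x₃ x₄ : V,
        ‖g x₁ - g x₂ - g x₃ + g x₄‖ ≤
          C * (‖x₁ - x₂ - x₃ + x₄‖ + (‖x₁ - x₃‖ + ‖x₂ - x₄‖) * ‖x₃ - x₄‖) := by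
  refine ⟨M, ?_⟩
  intro g hg hg' h1 h2 x₁ x₂ x₃ x₄
  have A : ‖g x₁ - g (x₂ + (x₃ - x₄))‖ ≤ M * ‖x₁ - (x₂ + (x₃ - x₄))‖ :=
    convex_univ.norm_image_sub_le_of_norm_fderiv_le (𝕜 := ℝ) (fun x _ => hg x)
      (fun x _ => h1 x) (Set.mem_univ _) (Set.mem_univ _)
  have L : ∀ z d : V, ‖fderiv ℝ g (z + d) - fderiv ℝ g z‖ ≤ M * ‖d‖ := by
    intro z d
    have := convex_univ.norm_image_sub_le_of_norm_fderiv_le (𝕜 := ℝ) (fun x _ => hg' x)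
      (fun x _ => h2 x) (Set.mem_univ z) (Set.mem_univ (z + d))
    simpa using this
  have B : ‖(g (x₂ + (x₃ - x₄)) - g x₂) - (g (x₄ + (x₃ - x₄)) - g x₄)‖
      ≤ (M * ‖x₃ - x₄‖) * ‖x₂ - x₄‖ := by
    refine convex_univ.norm_image_sub_le_of_norm_hasFDerivWithin_le (𝕜 := ℝ)
      (f := fun z => g (z + (x₃ - x₄)) - g z)
      (f' := fun z => fderiv ℝ g (z + (x₃ - x₄)) - fderiv ℝ g z)
      (fun z _ => ?_) (fun z _ => L z _) (Set.mem_univ _) (Set.mem_univ _)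
    refine HasFDerivAt.hasFDerivWithinAt (HasFDerivAt.sub ?_ (hg z).hasFDerivAt)
    exact (hasFDerivAt_comp_add_right _).2 (hg _).hasFDerivAt
  have e1 : x₁ - (x₂ + (x₃ - x₄)) = x₁ - x₂ - x₃ + x₄ := by abel
  have e2 : x₄ + (x₃ - x₄) = x₃ := by abel
  rw [e1] at A
  rw [e2] at B
  have e3 : g x₁ - g x₂ - g x₃ + g x₄ = (g x₁ - g (x₂ + (x₃ - x₄))) +
      ((g (x₂ + (x₃ - x₄)) - g x₂) - (g x₃ - g x₄)) := by abel
  rw [e3]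
  have P : 0 ≤ M * (‖x₁ - x₃‖ * ‖x₃ - x₄‖) := by positivity
  refine (norm_add_le _ _).trans ?_
  nlinarith [A, B, P]
end

section
/- Let g : V → W be twice Fréchet differentiable with Dg(0) = 0 and ‖D²g(x)‖ ≤ M for all x ∈ V. Then there is a constant C, depending only on M, such that for all x₁, x₂, x₃, x₄ ∈ V: ‖g(x₁) − g(x₂) − g(x₃) + g(x₄)‖ ≤ C( max(‖x₁‖, ‖x₂‖) · ‖x₁ − x₂ − x₃ + x₄‖ + (‖x₁ − x₃‖ + ‖x₂ − x₄‖) · ‖x₃ − x₄‖ ). -/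
theorem stmt_13 {V W : Type*} [NormedAddCommGroup V] [NormedSpace ℝ V]
    [NormedAddCommGroup W] [NormedSpace ℝ W] (M : ℝ) (hM : 0 < M) :
    ∃ C : ℝ, ∀ g : V → W, Differentiable ℝ g → Differentiable ℝ (fderiv ℝ g) →
      fderiv ℝ g 0 = 0 → (∀ x : V, ‖fderiv ℝ (fderiv ℝ g) x‖ ≤ M) →
      ∀ x₁ x₂ x₃ x₄ : V,
        ‖g x₁ - g x₂ - g x₃ + g x₄‖ ≤
          C * (max ‖x₁‖ ‖x₂‖ * ‖x₁ - x₂ - x₃ + x₄‖ +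
            (‖x₁ - x₃‖ + ‖x₂ - x₄‖) * ‖x₃ - x₄‖) := by
  refine ⟨M, fun g hg hg2 h0 hb x₁ x₂ x₃ x₄ => ?_⟩
  have lip : ∀ x y : V, ‖fderiv ℝ g x - fderiv ℝ g y‖ ≤ M * ‖x - y‖ := fun x y =>
    Convex.norm_image_sub_le_of_norm_fderiv_le (s := Set.univ) (fun z _ => hg2 z)
      (fun z _ => hb z) convex_univ (Set.mem_univ y) (Set.mem_univ x)
  have line : ∀ (a b : V) (t : ℝ),
      HasDerivAt (fun t : ℝ => g (b + t • (a - b)))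
        (fderiv ℝ g (b + t • (a - b)) (a - b)) t := by
    intro a b t
    have h1 : HasDerivAt (fun t : ℝ => b + t • (a - b)) (a - b) t := by
      simpa using ((hasDerivAt_id t).smul_const (a - b)).const_add b
    exact (hg _).hasFDerivAt.comp_hasDerivAt t h1
  have key := norm_image_sub_le_of_norm_deriv_le_segment_01'
    (f := fun t : ℝ => g (x₂ + t • (x₁ - x₂)) - g (x₄ + t • (x₃ - x₄)))
    (C := M * (max ‖x₁‖ ‖x₂‖ * ‖x₁ - x₂ - x₃ + x₄‖ +
            (‖x₁ - x₃‖ + ‖x₂ - x₄‖) * ‖x₃ - x₄‖))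
    (fun t _ => ((line x₁ x₂ t).sub (line x₃ x₄ t)).hasDerivWithinAt) ?_
  · have e : g x₁ - g x₂ - g x₃ + g x₄ = (g x₁ - g x₃) - (g x₂ - g x₄) := by abel
    rw [e]
    simpa using key
  · rintro t ⟨ht0, ht1⟩
    set y := x₂ + t • (x₁ - x₂) with hy
    set z := x₄ + t • (x₃ - x₄) with hz
    have e : fderiv ℝ g y (x₁ - x₂) - fderiv ℝ g z (x₃ - x₄)
        = fderiv ℝ g y (x₁ - x₂ - x₃ + x₄) + (fderiv ℝ g y - fderiv ℝ g z) (x₃ - x₄) := by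
      simp only [map_sub, map_add, ContinuousLinearMap.sub_apply]
      abel
    have comb : ∀ a b : V, ‖(1 - t) • b + t • a‖ ≤ (1 - t) * ‖b‖ + t * ‖a‖ := by
      intro a b
      refine (norm_add_le _ _).trans (le_of_eq ?_)
      rw [norm_smul, norm_smul, Real.norm_of_nonneg ht0, Real.norm_of_nonneg (by linarith)]
    have hyn : ‖y‖ ≤ max ‖x₁‖ ‖x₂‖ := by
      have : y = (1 - t) • x₂ + t • x₁ := by rw [hy]; module
      rw [this]
      refine (comb x₁ x₂).trans ?_
      nlinarith [le_max_left ‖x₁‖ ‖x₂‖, le_max_right ‖x₁‖ ‖x₂‖]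
    have hyz : ‖y - z‖ ≤ ‖x₁ - x₃‖ + ‖x₂ - x₄‖ := by
      have : y - z = (1 - t) • (x₂ - x₄) + t • (x₁ - x₃) := by rw [hy, hz]; module
      rw [this]
      refine (comb _ _).trans ?_
      nlinarith [norm_nonneg (x₁ - x₃), norm_nonneg (x₂ - x₄)]
    have hDy : ‖fderiv ℝ g y‖ ≤ M * ‖y‖ := by simpa [h0] using lip y 0
    rw [e]
    calc _ ≤ ‖fderiv ℝ g y‖ * ‖x₁ - x₂ - x₃ + x₄‖
          + ‖fderiv ℝ g y - fderiv ℝ g z‖ * ‖x₃ - x₄‖ :=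
          (norm_add_le _ _).trans (add_le_add (ContinuousLinearMap.le_opNorm _ _)
            (ContinuousLinearMap.le_opNorm _ _))
      _ ≤ (M * max ‖x₁‖ ‖x₂‖) * ‖x₁ - x₂ - x₃ + x₄‖
          + (M * (‖x₁ - x₃‖ + ‖x₂ - x₄‖)) * ‖x₃ - x₄‖ := by
          have h1 := hDy.trans (mul_le_mul_of_nonneg_left hyn hM.le)
          have h2 := (lip y z).trans (mul_le_mul_of_nonneg_left hyz hM.le)
          gcongr
      _ = _ := by ring
end
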